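/- Let N = 3, λ > 0 and 2 < p ≤ 4. Then there exists μ₀ > 0 such that for every μ > μ₀, problem (1.1) admits a positive solution: a classical solution u of problem (1.1) lying in X with u(x) > 0 for all x ∈ ℝ^3_+. -/

import Mathlib

open MeasureTheory Real Topology Filter

noncomputable section

/-- `ℝ^N` as Euclidean space. -/
abbrev Euc (N : ℕ) := EuclideanSpace ℝ (Fin N)

/-- Gaussian-type weight `K(x) = exp(|x|²/4)`. -/
noncomputable def Kw {N : ℕ} (x : Euc N) : ℝ := Real.exp (‖x‖ ^ 2 / 4)

/-- critical Sobolev exponent `2* = 2N/(N-2)` -/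
noncomputable def twoStar (N : ℕ) : ℝ := 2 * (N : ℝ) / ((N : ℝ) - 2)

/-- critical trace exponent `2_* = 2(N-1)/(N-2)` -/
noncomputable def twoStarL (N : ℕ) : ℝ := 2 * ((N : ℝ) - 1) / ((N : ℝ) - 2)

/-- `i`-th partial derivative of `u` at `x` -/
noncomputable def pd {N : ℕ} (u : Euc N → ℝ) (i : Fin N) (x : Euc N) : ℝ :=
  fderiv ℝ u x (EuclideanSpace.single i 1)

/-- `|∇u(x)|²` -/
noncomputable def gradSq {N : ℕ} (u : Euc N → ℝ) (x : Euc N) : ℝ :=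
  ∑ i, (pd u i x) ^ 2

/-- `x · ∇u(x)` -/
noncomputable def radial {N : ℕ} (u : Euc N → ℝ) (x : Euc N) : ℝ :=
  ∑ i, x i * pd u i x

/-- Laplacian `Δu(x)` -/
noncomputable def lap {N : ℕ} (u : Euc N → ℝ) (x : Euc N) : ℝ :=
  ∑ i, pd (pd u i) i x

/-- index of the vertical coordinate `x_N` -/
def lastIdx (N : ℕ) (h : 0 < N) : Fin N := ⟨N - 1, by omega⟩

/-- open upper half-space `ℝ^N_+` -/
def upperHS (N : ℕ) (h : 0 < N) : Set (Euc N) := {x | 0 < x (lastIdx N h)}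

/-- closed upper half-space -/
def upperHSc (N : ℕ) (h : 0 < N) : Set (Euc N) := {x | 0 ≤ x (lastIdx N h)}

/-- boundary hyperplane `∂ℝ^N_+` -/
def bdryHS (N : ℕ) (h : 0 < N) : Set (Euc N) := {x | x (lastIdx N h) = 0}

/-- vertical derivative `∂u/∂x_N`, taken within the closed half-space -/
noncomputable def pdN (N : ℕ) (h : 0 < N) (u : Euc N → ℝ) (x : Euc N) : ℝ :=
  fderivWithin ℝ u (upperHSc N h) x (EuclideanSpace.single (lastIdx N h) 1)

/-- embedding of `ℝ^{N-1}` as the boundary of the half-space, `y ↦ (y, 0)` -/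
noncomputable def emb (N : ℕ) (y : Euc (N - 1)) : Euc N :=
  (EuclideanSpace.equiv (Fin N) ℝ).symm
    (fun i => if hi : (i : ℕ) < N - 1 then y ⟨(i : ℕ), hi⟩ else 0)

/-- finite weighted energy, i.e. membership in the space `X` -/
def FiniteEnergy (N : ℕ) (h : 0 < N) (u : Euc N → ℝ) : Prop :=
  IntegrableOn (fun x => Kw x * (gradSq u x + (u x) ^ 2)) (upperHS N h)

/-- classical solution of problem (1.1) -/
structure IsClassicalSolution (N : ℕ) (h : 0 < N) (lam mu p : ℝ) (u : Euc N → ℝ) : Prop where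
  smooth2 : ContDiffOn ℝ 2 u (upperHS N h)
  smooth1 : ContDiffOn ℝ 1 u (upperHSc N h)
  pde : ∀ x ∈ upperHS N h,
    -lap u x - (1 / 2) * radial u x
      = lam * |u x| ^ (twoStar N - 2) * u x + mu * |u x| ^ (p - 2) * u x
  bc : ∀ x ∈ bdryHS N h,
    -pdN N h u x = Real.sqrt lam * |u x| ^ (twoStarL N - 2) * u x

/-- `x_N⁰ = √(N/(N-2))` -/
noncomputable def xN0 (N : ℕ) : ℝ := Real.sqrt ((N : ℝ) / ((N : ℝ) - 2))

/-- `k_N = (N(N-2))^{(N-2)/4}` -/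
noncomputable def kN (N : ℕ) : ℝ := ((N : ℝ) * ((N : ℝ) - 2)) ^ (((N : ℝ) - 2) / 4)

/-- `|x'|²`, squared norm of the horizontal part -/
noncomputable def horizSq {N : ℕ} (h : 0 < N) (x : Euc N) : ℝ :=
  ∑ i ∈ Finset.univ.erase (lastIdx N h), (x i) ^ 2

/-- the family `φ_{ε,τ}` -/
noncomputable def bubbleT (N : ℕ) (h : 0 < N) (ε τ : ℝ) (x : Euc N) : ℝ :=
  (ε * Real.sqrt ((N : ℝ) * ((N : ℝ) - 2)) /
      (ε ^ 2 + horizSq h x + (x (lastIdx N h) + ε * τ * xN0 N) ^ 2)) ^ (((N : ℝ) - 2) / 2)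

/-- the boundary bubble `U_ε = φ_{ε,1}` -/
noncomputable def Ubub (N : ℕ) (h : 0 < N) (ε : ℝ) (x : Euc N) : ℝ := bubbleT N h ε 1 x

/-- `K₁ = ∫_{ℝ^N_+} |∇U_ε|²` (an `ε`-independent constant, computed at `ε = 1`) -/
noncomputable def Kone (N : ℕ) (h : 0 < N) : ℝ :=
  ∫ x in upperHS N h, gradSq (Ubub N h 1) x

/-- `K₂ = ∫_{ℝ^N_+} U_ε^{2*}` -/
noncomputable def Ktwo (N : ℕ) (h : 0 < N) : ℝ :=
  ∫ x in upperHS N h, (Ubub N h 1 x) ^ twoStar N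

/-- `K₃ = ∫_{ℝ^{N-1}} U_ε(x',0)^{2_*}` -/
noncomputable def Kthree (N : ℕ) (h : 0 < N) : ℝ :=
  ∫ y : Euc (N - 1), (Ubub N h 1 (emb N y)) ^ twoStarL N

/-- cut-off function: `φ ∈ C_c^∞(ℝ^N,[0,1])`, `φ ≡ 1` on `B₁(0)`, `φ ≡ 0` outside `B₂(0)` -/
structure IsCutoff (N : ℕ) (φ : Euc N → ℝ) : Prop where
  smooth : ContDiff ℝ (⊤ : ℕ∞) φ
  mem01 : ∀ x, φ x ∈ Set.Icc (0 : ℝ) 1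
  eq_one : ∀ x ∈ Metric.closedBall (0 : Euc N) 1, φ x = 1
  eq_zero : ∀ x ∉ Metric.ball (0 : Euc N) 2, φ x = 0

/-- truncated weighted bubble `Ũ_ε = K^{-1/2} φ U_ε` -/
noncomputable def Ut (N : ℕ) (h : 0 < N) (φ : Euc N → ℝ) (ε : ℝ) (x : Euc N) : ℝ :=
  (Kw x) ^ (-(1 : ℝ) / 2) * φ x * Ubub N h ε x

/-- smooth compactly supported test functions on the closed half-space -/
structure IsTestFun (N : ℕ) (h : 0 < N) (u : Euc N → ℝ) : Prop where
  smooth : ContDiff ℝ (⊤ : ℕ∞) u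
  cpt : HasCompactSupport u
  supp : tsupport u ⊆ upperHSc N h

/-- the norm of the space `X`: `‖u‖ = (∫ K |∇u|²)^{1/2}` -/
noncomputable def Xnorm (N : ℕ) (h : 0 < N) (u : Euc N → ℝ) : ℝ :=
  Real.sqrt (∫ x in upperHS N h, Kw x * gradSq u x)

set_option linter.all false

namespace Ham

variable {Y : Type*} [MeasurableSpace Y]

theorem iadd {μ : Measure Y} {f g : Y → ℝ} (hf : Integrable f μ) (hg : Integrable g μ) :
    Integrable (fun x => f x + g x) μ := hf.add hg

theorem isub {μ : Measure Y} {f g : Y → ℝ} (hf : Integrable f μ) (hg : Integrable g μ) :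
    Integrable (fun x => f x - g x) μ := hf.sub hg

/-- Bilinear form of a kernel. -/
def Bf (ν : Measure Y) (k : Y → Y → ℝ) (φ w : Y → ℝ) : ℝ :=
  ∫ z, k z.1 z.2 * φ z.1 * w z.2 ∂(ν.prod ν)

/-- Kernel with Schur bound `S`. -/
structure KerS (ν : Measure Y) (k : Y → Y → ℝ) (S : ℝ) : Prop where
  meas : Measurable (fun z : Y × Y => k z.1 z.2)
  nn : ∀ x y, 0 ≤ k x y
  symm : ∀ x y, k x y = k y x
  S0 : 0 ≤ S
  bd : ∀ x, ∫⁻ y, ENNReal.ofReal (k x y) ∂ν ≤ ENNReal.ofReal S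

theorem KerS.sq {ν : Measure Y} [IsFiniteMeasure ν] {k : Y → Y → ℝ} {S : ℝ} (h : KerS ν k S)
    {w : Y → ℝ} (wm : Measurable w) (w2 : Integrable (fun y => w y ^ 2) ν) :
    Integrable (fun z : Y × Y => k z.1 z.2 * w z.1 ^ 2) (ν.prod ν) ∧
      ∫ z, k z.1 z.2 * w z.1 ^ 2 ∂(ν.prod ν) ≤ S * ∫ y, w y ^ 2 ∂ν := by
  have hm : Measurable (fun z : Y × Y => k z.1 z.2 * w z.1 ^ 2) :=
    h.meas.mul ((wm.comp measurable_fst).pow_const 2)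
  have hnn : ∀ z : Y × Y, 0 ≤ k z.1 z.2 * w z.1 ^ 2 := fun z => mul_nonneg (h.nn _ _) (sq_nonneg _)
  have key : ∫⁻ z, ENNReal.ofReal (k z.1 z.2 * w z.1 ^ 2) ∂(ν.prod ν)
      ≤ ENNReal.ofReal (S * ∫ y, w y ^ 2 ∂ν) := by
    rw [lintegral_prod _ hm.ennreal_ofReal.aemeasurable]
    calc ∫⁻ x, ∫⁻ y, ENNReal.ofReal (k x y * w x ^ 2) ∂ν ∂ν
        ≤ ∫⁻ x, ENNReal.ofReal S * ENNReal.ofReal (w x ^ 2) ∂ν := by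
          refine lintegral_mono fun x => ?_
          have : ∀ y, ENNReal.ofReal (k x y * w x ^ 2)
              = ENNReal.ofReal (k x y) * ENNReal.ofReal (w x ^ 2) := fun y =>
            ENNReal.ofReal_mul (h.nn x y)
          simp_rw [this]
          have hmx : Measurable (fun y => k x y) := h.meas.comp measurable_prodMk_left
          rw [lintegral_mul_const _ hmx.ennreal_ofReal]
          exact mul_le_mul_left (h.bd x) _
      _ = ENNReal.ofReal (S * ∫ y, w y ^ 2 ∂ν) := by
          rw [lintegral_const_mul _ (wm.pow_const 2).ennreal_ofReal,
            ENNReal.ofReal_mul h.S0, ofReal_integral_eq_lintegral_ofReal w2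
              (Eventually.of_forall fun y => sq_nonneg _)]
  have hi : Integrable (fun z : Y × Y => k z.1 z.2 * w z.1 ^ 2) (ν.prod ν) := by
    refine ⟨hm.aestronglyMeasurable, ?_⟩
    rw [hasFiniteIntegral_iff_ofReal (Eventually.of_forall hnn)]
    exact key.trans_lt ENNReal.ofReal_lt_top
  refine ⟨hi, ?_⟩
  rw [← ofReal_integral_eq_lintegral_ofReal hi (Eventually.of_forall hnn)] at key
  exact (ENNReal.ofReal_le_ofReal_iff
    (mul_nonneg h.S0 (integral_nonneg fun y => sq_nonneg _))).1 key

theorem KerS.sq' {ν : Measure Y} [IsFiniteMeasure ν] {k : Y → Y → ℝ} {S : ℝ} (h : KerS ν k S)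
    {w : Y → ℝ} (wm : Measurable w) (w2 : Integrable (fun y => w y ^ 2) ν) :
    Integrable (fun z : Y × Y => k z.1 z.2 * w z.2 ^ 2) (ν.prod ν) ∧
      ∫ z, k z.1 z.2 * w z.2 ^ 2 ∂(ν.prod ν) ≤ S * ∫ y, w y ^ 2 ∂ν := by
  obtain ⟨h1, h2⟩ := h.sq wm w2
  have e : (fun z : Y × Y => k z.1 z.2 * w z.2 ^ 2)
      = (fun z : Y × Y => k z.1 z.2 * w z.1 ^ 2) ∘ Prod.swap := by
    funext z; simp [h.symm z.1 z.2]
  constructor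
  · rw [e]; exact h1.swap
  · rw [e]
    have := integral_prod_swap (μ := ν) (ν := ν) (fun z : Y × Y => k z.1 z.2 * w z.1 ^ 2)
    simp only [Function.comp_def]
    rw [this]; exact h2

theorem KerS.intg {ν : Measure Y} [IsFiniteMeasure ν] {k : Y → Y → ℝ} {S : ℝ} (h : KerS ν k S)
    {φ w : Y → ℝ} (φm : Measurable φ) (φ2 : Integrable (fun y => φ y ^ 2) ν)
    (wm : Measurable w) (w2 : Integrable (fun y => w y ^ 2) ν) :
    Integrable (fun z : Y × Y => k z.1 z.2 * φ z.1 * w z.2) (ν.prod ν) := by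
  refine Integrable.mono' ((h.sq φm φ2).1.add (h.sq' wm w2).1)
    ((h.meas.mul (φm.comp measurable_fst)).mul (wm.comp measurable_snd)).aestronglyMeasurable
    (Eventually.of_forall fun z => ?_)
  simp only [Pi.add_apply, norm_mul, Real.norm_eq_abs, abs_of_nonneg (h.nn _ _)]
  have := h.nn z.1 z.2
  have h1 : |φ z.1| * |w z.2| ≤ φ z.1 ^ 2 + w z.2 ^ 2 := by
    nlinarith [sq_nonneg (|φ z.1| - |w z.2|), sq_abs (φ z.1), sq_abs (w z.2),
      sq_nonneg (φ z.1), sq_nonneg (w z.2)]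
  calc _ = k z.1 z.2 * (|φ z.1| * |w z.2|) := by ring
    _ ≤ k z.1 z.2 * (φ z.1 ^ 2 + w z.2 ^ 2) := mul_le_mul_of_nonneg_left h1 this
    _ = _ := by ring

theorem KerS.abs_le {ν : Measure Y} [IsFiniteMeasure ν] {k : Y → Y → ℝ} {S : ℝ} (h : KerS ν k S)
    {w : Y → ℝ} (wm : Measurable w) (w2 : Integrable (fun y => w y ^ 2) ν) :
    |Bf ν k w w| ≤ S * ∫ y, w y ^ 2 ∂ν := by
  have h1 := h.sq wm w2
  have h2 := h.sq' wm w2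
  have : |Bf ν k w w| ≤ ∫ z, ((k z.1 z.2 * w z.1 ^ 2) / 2 + (k z.1 z.2 * w z.2 ^ 2) / 2)
      ∂(ν.prod ν) := by
    unfold Bf
    rw [← Real.norm_eq_abs]
    refine norm_integral_le_of_norm_le
      (g := fun z : Y × Y => (k z.1 z.2 * w z.1 ^ 2) / 2 + (k z.1 z.2 * w z.2 ^ 2) / 2)
      ((h1.1.div_const 2).add (h2.1.div_const 2))
      (Eventually.of_forall fun z => ?_)
    simp only [norm_mul, Real.norm_eq_abs, abs_of_nonneg (h.nn _ _)]
    have := h.nn z.1 z.2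
    have h1 : |w z.1| * |w z.2| ≤ (w z.1 ^ 2 + w z.2 ^ 2) / 2 := by
      nlinarith [sq_nonneg (|w z.1| - |w z.2|), sq_abs (w z.1), sq_abs (w z.2)]
    nlinarith [mul_le_mul_of_nonneg_left h1 this]
  rw [integral_add (h1.1.div_const 2) (h2.1.div_const 2), integral_div, integral_div] at this
  linarith [h1.2, h2.2]

theorem KerS.symmB {ν : Measure Y} [IsFiniteMeasure ν] {k : Y → Y → ℝ} {S : ℝ} (h : KerS ν k S)
    (φ w : Y → ℝ) : Bf ν k φ w = Bf ν k w φ := by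
  unfold Bf
  rw [← integral_prod_swap]
  refine integral_congr_ae (Eventually.of_forall fun z => ?_)
  simp only [Prod.fst_swap, Prod.snd_swap, h.symm z.2 z.1]
  ring

theorem KerS.iter {ν : Measure Y} [IsFiniteMeasure ν] {k : Y → Y → ℝ} {S : ℝ} (h : KerS ν k S)
    {φ w : Y → ℝ} (φm : Measurable φ) (φ2 : Integrable (fun y => φ y ^ 2) ν)
    (wm : Measurable w) (w2 : Integrable (fun y => w y ^ 2) ν) :
    Bf ν k φ w = ∫ x, φ x * (∫ y, k x y * w y ∂ν) ∂ν := by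
  unfold Bf
  rw [integral_prod _ (h.intg φm φ2 wm w2)]
  refine integral_congr_ae (Eventually.of_forall fun x => ?_)
  simp only
  rw [← integral_const_mul]
  refine integral_congr_ae (Eventually.of_forall fun y => ?_)
  simp only; ring

theorem KerS.expand {ν : Measure Y} [IsFiniteMeasure ν] {k : Y → Y → ℝ} {S : ℝ} (h : KerS ν k S)
    {φ w : Y → ℝ} (φm : Measurable φ) (φ2 : Integrable (fun y => φ y ^ 2) ν)
    (wm : Measurable w) (w2 : Integrable (fun y => w y ^ 2) ν) (s : ℝ) :
    Bf ν k (fun y => w y + s * φ y) (fun y => w y + s * φ y)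
      = Bf ν k w w + 2 * s * Bf ν k φ w + s ^ 2 * Bf ν k φ φ := by
  have e1 := h.intg wm w2 wm w2
  have e2 := h.intg φm φ2 wm w2
  have e3 := h.intg wm w2 φm φ2
  have e4 := h.intg φm φ2 φm φ2
  have hs := h.symmB w φ
  have : Bf ν k (fun y => w y + s * φ y) (fun y => w y + s * φ y)
      = Bf ν k w w + (s * Bf ν k φ w + (s * Bf ν k w φ + s ^ 2 * Bf ν k φ φ)) := by
    unfold Bf
    have f34 : Integrable (fun z : Y × Y => s * (k z.1 z.2 * w z.1 * φ z.2)
        + s ^ 2 * (k z.1 z.2 * φ z.1 * φ z.2)) (ν.prod ν) :=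
      (e3.const_mul s).add (e4.const_mul (s ^ 2))
    have f234 : Integrable (fun z : Y × Y => s * (k z.1 z.2 * φ z.1 * w z.2)
        + (s * (k z.1 z.2 * w z.1 * φ z.2)
        + s ^ 2 * (k z.1 z.2 * φ z.1 * φ z.2))) (ν.prod ν) :=
      (e2.const_mul s).add f34
    rw [← integral_const_mul, ← integral_const_mul, ← integral_const_mul,
      ← integral_add (e3.const_mul _) (e4.const_mul _),
      ← integral_add (e2.const_mul _) f34, ← integral_add e1 f234]
    refine integral_congr_ae (Eventually.of_forall fun z => ?_)
    simp only [Pi.add_apply]; ring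
  rw [this, hs]; ring

theorem Bf_smul (ν : Measure Y) (k : Y → Y → ℝ) (w : Y → ℝ) (t : ℝ) :
    Bf ν k (fun y => t * w y) (fun y => t * w y) = t ^ 2 * Bf ν k w w := by
  unfold Bf
  rw [← integral_const_mul]
  refine integral_congr_ae (Eventually.of_forall fun z => ?_)
  simp only; ring

end Ham

namespace Ham

/-- Pointwise hypotheses on the nonlinearity, with uniform constants. -/
structure NL (f F : ℝ → ℝ) (δ : ℝ → ℝ) (Q b C b' C' : ℝ) : Prop where
  f0 : f 0 = 0
  F0 : ∀ s, 0 ≤ s → 0 ≤ F s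
  cont : ContinuousOn f (Set.Ici 0)
  pos : ∀ s, 0 < s → 0 < f s
  strict : ∀ s s', 0 < s → s < s' → f s * s' < f s' * s
  Fb : ∀ s s', 0 ≤ s → 0 ≤ s' → f s * (s' ^ 2 - s ^ 2) ≤ 2 * s * (F s' - F s)
  F00 : F 0 = 0
  Q0 : 0 < Q
  fQ : ∀ s, 0 ≤ s → f s ≤ Q * s
  δ0 : ∀ A, 0 < A → 0 < δ A
  sm : ∀ A s, 0 < A → 0 ≤ s → s ≤ δ A → A * f s ≤ s
  b0 : 0 < b
  C0 : 0 ≤ C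
  lin : ∀ s, 0 ≤ s → b * s - C ≤ f s
  b0' : 0 < b'
  lin' : ∀ s, 0 ≤ s → b' * s - C' ≤ f s * s / 2 - F s

/-- generalized inverse of `f`. -/
def gi (f : ℝ → ℝ) (x : ℝ) : ℝ := sInf {s | 0 ≤ s ∧ x ≤ f s}

/-- dual nonlinearity -/
def Fs (f F : ℝ → ℝ) (x : ℝ) : ℝ := x * gi f x - F (gi f x)

section
variable {f F δ : ℝ → ℝ} {Q b C b' C' : ℝ}

theorem NL.mono (h : NL f F δ Q b C b' C') {s s' : ℝ} (hs : 0 ≤ s) (h2 : s < s') : f s < f s' := by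
  rcases hs.eq_or_lt with rfl | hs
  · rw [h.f0]; exact h.pos _ h2
  · have h1 := h.strict s s' hs h2
    have h3 := h.pos s' (hs.trans h2)
    by_contra hc
    push Not at hc
    nlinarith

theorem NL.mono_le (h : NL f F δ Q b C b' C') {s s' : ℝ} (hs : 0 ≤ s) (h2 : s ≤ s') :
    f s ≤ f s' := by
  rcases h2.eq_or_lt with rfl | h2
  · exact le_rfl
  · exact (h.mono hs h2).le

theorem NL.f_nn (h : NL f F δ Q b C b' C') {s : ℝ} (hs : 0 ≤ s) : 0 ≤ f s := by
  simpa [h.f0] using h.mono_le le_rfl hs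

theorem NL.surj (h : NL f F δ Q b C b' C') {x : ℝ} (hx : 0 ≤ x) : ∃ s, 0 ≤ s ∧ f s = x := by
  set R := (x + C) / b with hR
  have hR0 : 0 ≤ R := div_nonneg (by linarith [h.C0]) h.b0.le
  have hfR : x ≤ f R := by
    have := h.lin R hR0
    have h2 : b * R = x + C := by rw [hR]; field_simp [h.b0.ne']
    linarith
  have := intermediate_value_Icc hR0 (h.cont.mono (fun z hz => hz.1))
  obtain ⟨s, hs, hs2⟩ := this ⟨by rw [h.f0]; exact hx, hfR⟩
  exact ⟨s, hs.1, hs2⟩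

theorem NL.gf (h : NL f F δ Q b C b' C') {s : ℝ} (hs : 0 ≤ s) : gi f (f s) = s := by
  have : {z | 0 ≤ z ∧ f s ≤ f z} = Set.Ici s := by
    ext z
    simp only [Set.mem_setOf_eq, Set.mem_Ici]
    constructor
    · rintro ⟨h1, h2⟩
      by_contra hc
      push Not at hc
      exact absurd (h.mono h1 hc) (not_lt.2 h2)
    · intro hz
      exact ⟨hs.trans hz, h.mono_le hs hz⟩
  unfold gi
  rw [this, csInf_Ici]

theorem NL.gneg (h : NL f F δ Q b C b' C') {x : ℝ} (hx : x ≤ 0) : gi f x = 0 := by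
  have : {z | 0 ≤ z ∧ x ≤ f z} = Set.Ici 0 := by
    ext z
    simp only [Set.mem_setOf_eq, Set.mem_Ici]
    exact ⟨fun h => h.1, fun hz => ⟨hz, hx.trans (h.f_nn hz)⟩⟩
  unfold gi
  rw [this, csInf_Ici]

theorem NL.g0 (h : NL f F δ Q b C b' C') : gi f 0 = 0 := h.gneg le_rfl

theorem NL.gnn (h : NL f F δ Q b C b' C') (x : ℝ) : 0 ≤ gi f x :=
  Real.sInf_nonneg fun _ hs => hs.1

theorem NL.fg (h : NL f F δ Q b C b' C') {x : ℝ} (hx : 0 ≤ x) : f (gi f x) = x := by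
  obtain ⟨s, hs, rfl⟩ := h.surj hx
  rw [h.gf hs]

theorem NL.le_iff (h : NL f F δ Q b C b' C') {x s : ℝ} (hs : 0 ≤ s) :
    gi f x ≤ s ↔ x ≤ f s := by
  rcases le_total x 0 with hx | hx
  · rw [h.gneg hx]; exact ⟨fun _ => hx.trans (h.f_nn hs), fun _ => hs⟩
  · constructor
    · intro h1
      rw [← h.fg hx]; exact h.mono_le (h.gnn x) h1
    · intro h1
      by_contra hc
      push Not at hc
      have := h.mono hs hc
      rw [h.fg hx] at this
      linarith

theorem NL.gmono (h : NL f F δ Q b C b' C') : Monotone (gi f) := by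
  intro x x' hx
  rcases le_total x' 0 with h0 | h0
  · rw [h.gneg h0, h.gneg (hx.trans h0)]
  · rw [h.le_iff (h.gnn _), h.fg h0]; exact hx

theorem NL.gcont (h : NL f F δ Q b C b' C') : Continuous (gi f) := by
  rw [continuous_iff_continuousAt]
  intro x
  rw [ContinuousAt, tendsto_order]
  constructor
  · intro s hs
    rcases lt_or_ge s 0 with h0 | h0
    · exact Eventually.of_forall fun z => h0.trans_le (h.gnn z)
    · have h1 : f s < x := by rw [← not_le, ← h.le_iff h0, not_le]; exact hs
      filter_upwards [lt_mem_nhds h1] with z hz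
      rw [← not_le, h.le_iff h0, not_le]; exact hz
  · intro s hs
    have h0 : 0 < s := (h.gnn x).trans_lt hs
    have key : ∀ z, z < f s → gi f z < s := by
      intro z hz
      rcases le_total z 0 with hz0 | hz0
      · rw [h.gneg hz0]; exact h0
      · by_contra hc
        push Not at hc
        have := h.mono_le h0.le hc
        rw [h.fg hz0] at this
        linarith
    have h1 : x < f s := by
      have := h.mono (h.gnn x) hs
      rcases le_total x 0 with hx | hx
      · exact hx.trans_lt (h.pos s h0)
      · rwa [h.fg hx] at this
    filter_upwards [gt_mem_nhds h1] with z hz using key z hz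

theorem NL.gpos (h : NL f F δ Q b C b' C') {x : ℝ} (hx : 0 < x) : 0 < gi f x := by
  rw [← not_le, h.le_iff le_rfl, h.f0]; exact not_le.2 hx

theorem NL.gstrict (h : NL f F δ Q b C b' C') {x x' : ℝ} (hx : 0 < x) (hx' : x < x') :
    gi f x' * x < gi f x * x' := by
  have h1 := h.gpos hx
  have e1 := h.fg hx.le
  have e2 := h.fg (hx.trans hx').le
  have h2 : gi f x < gi f x' := by
    rw [← not_le, h.le_iff h1.le, e1]; exact not_le.2 hx'
  have := h.strict _ _ h1 h2
  rw [e1, e2] at this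
  linarith

theorem NL.gscale (h : NL f F δ Q b C b' C') {x a : ℝ} (hx : 0 ≤ x) (ha : 1 ≤ a) :
    gi f (a * x) ≤ a * gi f x := by
  rcases hx.eq_or_lt with rfl | hx
  · simp [h.g0]
  rcases ha.eq_or_lt with rfl | ha
  · simp
  have := h.gstrict hx (show x < a * x by nlinarith)
  nlinarith

theorem NL.xQ (h : NL f F δ Q b C b' C') {x : ℝ} (hx : 0 ≤ x) : x ≤ Q * gi f x := by
  have := h.fQ _ (h.gnn x)
  rwa [h.fg hx] at this

theorem NL.gup (h : NL f F δ Q b C b' C') {x : ℝ} (hx : 0 ≤ x) : b * gi f x ≤ x + C := by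
  have := h.lin _ (h.gnn x)
  rw [h.fg hx] at this
  linarith

theorem NL.gsm (h : NL f F δ Q b C b' C') {x A : ℝ} (hA : 0 < A) (hx : 0 ≤ x)
    (hx' : x ≤ δ A / A) : A * x ≤ gi f x := by
  rcases le_total (gi f x) (δ A) with h1 | h1
  · have := h.sm A _ hA (h.gnn x) h1
    rwa [h.fg hx] at this
  · have : x * A ≤ δ A := (le_div_iff₀ hA).1 hx'
    linarith

theorem NL.Fconv (h : NL f F δ Q b C b' C') {s s' : ℝ} (hs : 0 ≤ s) (hs' : 0 ≤ s') :
    F s + f s * (s' - s) ≤ F s' := by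
  rcases hs.eq_or_lt with rfl | hs
  · rw [h.f0, h.F00]; simpa using h.F0 s' hs'
  · have h1 := h.Fb s s' hs.le hs'
    have h2 := h.pos s hs
    have h3 : 2 * s * (f s * (s' - s)) ≤ 2 * s * (F s' - F s) := by
      have : 0 ≤ f s * (s' - s) ^ 2 := by positivity
      nlinarith
    have := le_of_mul_le_mul_left h3 (by linarith : 0 < 2 * s)
    linarith

theorem NL.S1 (h : NL f F δ Q b C b' C') {x x' : ℝ} (hx : 0 ≤ x) (hx' : 0 ≤ x') :
    Fs f F x + gi f x * (x' - x) ≤ Fs f F x' := by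
  have := h.Fconv (h.gnn x') (h.gnn x)
  rw [h.fg hx'] at this
  unfold Fs
  linarith

theorem NL.S2 (h : NL f F δ Q b C b' C') {x a : ℝ} (hx : 0 ≤ x) (ha : 0 ≤ a) :
    Fs f F (a * x) ≤ Fs f F x + (a ^ 2 - 1) / 2 * (gi f x * x) := by
  rcases hx.eq_or_lt with rfl | hx
  · simp
  have h1 := h.Fb (gi f x) (gi f (a * x)) (h.gnn _) (h.gnn _)
  rw [h.fg hx.le] at h1
  have h2 := h.gpos hx
  unfold Fs
  set s := gi f x
  set s' := gi f (a * x)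
  have h3 : 0 ≤ x * (s' - a * s) ^ 2 := by positivity
  have h4 : 2 * s * (a * x * s' - F s') ≤ 2 * s * (x * s - F s + (a ^ 2 - 1) / 2 * (s * x)) := by
    nlinarith
  exact le_of_mul_le_mul_left h4 (by linarith)

theorem NL.Fhalf (h : NL f F δ Q b C b' C') {s : ℝ} (hs : 0 ≤ s) : F s ≤ f s * s / 2 := by
  rcases hs.eq_or_lt with rfl | hs
  · simp [h.F00]
  · have := h.Fb s 0 hs.le le_rfl
    rw [h.F00] at this
    have h3 : 2 * s * (F s) ≤ 2 * s * (f s * s / 2) := by nlinarith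
    exact le_of_mul_le_mul_left h3 (by linarith)

theorem NL.Fs_half (h : NL f F δ Q b C b' C') {x : ℝ} (hx : 0 ≤ x) :
    x * gi f x / 2 ≤ Fs f F x := by
  have := h.Fhalf (h.gnn x)
  rw [h.fg hx] at this
  unfold Fs; linarith

theorem NL.Fs_nn (h : NL f F δ Q b C b' C') {x : ℝ} (hx : 0 ≤ x) : 0 ≤ Fs f F x := by
  have := h.Fs_half hx
  have := mul_nonneg hx (h.gnn x)
  linarith

theorem NL.S3 (h : NL f F δ Q b C b' C') {x : ℝ} (hx : 0 ≤ x) :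
    x ^ 2 / (2 * Q) ≤ Fs f F x := by
  have h1 := h.Fs_half hx
  have h2 := h.xQ hx
  have hQ := h.Q0
  rw [div_le_iff₀ (by linarith)]
  nlinarith [mul_le_mul_of_nonneg_left h2 hx]

theorem NL.Fs_le (h : NL f F δ Q b C b' C') {x : ℝ} : Fs f F x ≤ x * gi f x := by
  have := h.F0 _ (h.gnn x)
  unfold Fs; linarith

theorem NL.Hs (h : NL f F δ Q b C b' C') {x : ℝ} (hx : 0 ≤ x) :
    b' / Q * x - C' ≤ Fs f F x - x * gi f x / 2 := by
  have h1 := h.lin' _ (h.gnn x)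
  rw [h.fg hx] at h1
  have h2 := h.xQ hx
  have h3 : b' / Q * x ≤ b' * gi f x := by
    have hq := h.Q0
    have : x / Q ≤ gi f x := by rw [div_le_iff₀ hq]; linarith
    calc b' / Q * x = b' * (x / Q) := by ring
      _ ≤ _ := mul_le_mul_of_nonneg_left this h.b0'.le
  unfold Fs; linarith

end
end Ham

namespace Ham

variable {Y : Type*} [MeasurableSpace Y]

/-- admissible functions -/
structure Adm (ν : Measure Y) (w : Y → ℝ) : Prop where
  meas : Measurable w
  nn : ∀ y, 0 ≤ w y
  sq : Integrable (fun y => w y ^ 2) ν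

/-- data of the Hammerstein problem -/
structure Dat (ν : Measure Y) (G : Y → Y → ℝ) (f F : Y → ℝ → ℝ) (δ : ℝ → ℝ)
    (Q b C b' C' S : ℝ) : Prop where
  nl : ∀ y, NL (f y) (F y) δ Q b C b' C'
  fm : Measurable (fun z : Y × ℝ => f z.1 z.2)
  Fm : Measurable (fun z : Y × ℝ => F z.1 z.2)
  ker : KerS ν G S
  split : ∀ η, 0 < η → ∃ (G1 G2 : Y → Y → ℝ) (C2 : ℝ), (∀ x y, G x y = G1 x y + G2 x y) ∧
    KerS ν G1 η ∧ Measurable (fun z : Y × Y => G2 z.1 z.2) ∧ (∀ x y, 0 ≤ G2 x y) ∧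
    (∀ x y, G2 x y ≤ C2)

/-- dual functional -/
def Iw (ν : Measure Y) (G : Y → Y → ℝ) (f F : Y → ℝ → ℝ) (w : Y → ℝ) : ℝ :=
  ∫ y, Fs (f y) (F y) (w y) ∂ν - Bf ν G w w / 2

/-- Nehari functional -/
def Nw (ν : Measure Y) (G : Y → Y → ℝ) (f : Y → ℝ → ℝ) (w : Y → ℝ) : ℝ :=
  ∫ y, gi (f y) (w y) * w y ∂ν - Bf ν G w w

theorem mul_int {ν : Measure Y} {u w : Y → ℝ} (um : Measurable u) (u2 : Integrable (fun y => u y ^ 2) ν)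
    (wm : Measurable w) (w2 : Integrable (fun y => w y ^ 2) ν) :
    Integrable (fun y => u y * w y) ν := by
  refine Integrable.mono' (u2.add w2) (um.mul wm).aestronglyMeasurable
    (Eventually.of_forall fun y => ?_)
  simp only [Pi.add_apply, norm_mul, Real.norm_eq_abs]
  nlinarith [sq_nonneg (|u y| - |w y|), sq_abs (u y), sq_abs (w y), sq_nonneg (u y),
    sq_nonneg (w y)]

theorem int1 {ν : Measure Y} [IsFiniteMeasure ν] {w : Y → ℝ} (wm : Measurable w)
    (w2 : Integrable (fun y => w y ^ 2) ν) : Integrable w ν := by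
  have := mul_int wm w2 (measurable_const (a := (1:ℝ))) (integrable_const _)
  simpa using this

theorem Adm.smul {ν : Measure Y} {w : Y → ℝ} (h : Adm ν w) {t : ℝ} (ht : 0 ≤ t) :
    Adm ν (fun y => t * w y) :=
  ⟨h.meas.const_mul t, fun y => mul_nonneg ht (h.nn y), by
    simpa [mul_pow] using h.sq.const_mul (t ^ 2)⟩

theorem Adm.add {ν : Measure Y} {w φ : Y → ℝ} (h : Adm ν w) (h' : Adm ν φ) :
    Adm ν (fun y => w y + φ y) := by
  refine ⟨h.meas.add h'.meas, fun y => add_nonneg (h.nn y) (h'.nn y), ?_⟩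
  refine Integrable.mono' ((h.sq.const_mul 2).add (h'.sq.const_mul 2))
    ((h.meas.add h'.meas).pow_const 2).aestronglyMeasurable (Eventually.of_forall fun y => ?_)
  simp only [Pi.add_apply, norm_pow, Real.norm_eq_abs, sq_abs]
  nlinarith [sq_nonneg (w y - φ y)]

section
variable {ν : Measure Y} [IsFiniteMeasure ν] {G : Y → Y → ℝ} {f F : Y → ℝ → ℝ} {δ : ℝ → ℝ}
  {Q b C b' C' S : ℝ}

theorem Dat.gmeas (h : Dat ν G f F δ Q b C b' C' S) {w : Y → ℝ} (wm : Measurable w) :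
    Measurable (fun y => gi (f y) (w y)) := by
  refine measurable_of_Iic fun c => ?_
  rcases lt_or_ge c 0 with hc | hc
  · have : (fun y => gi (f y) (w y)) ⁻¹' Set.Iic c = ∅ := by
      ext y
      simp only [Set.mem_preimage, Set.mem_Iic, Set.mem_empty_iff_false, iff_false, not_le]
      exact hc.trans_le ((h.nl y).gnn _)
    rw [this]; exact MeasurableSet.empty
  · have : (fun y => gi (f y) (w y)) ⁻¹' Set.Iic c = {y | w y ≤ f y c} := by
      ext y
      simp only [Set.mem_preimage, Set.mem_Iic]
      exact (h.nl y).le_iff hc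
    rw [this]
    exact measurableSet_le wm (h.fm.comp (measurable_id.prodMk measurable_const))

theorem Dat.gsq (h : Dat ν G f F δ Q b C b' C' S) {w : Y → ℝ} (hw : Adm ν w) :
    Integrable (fun y => gi (f y) (w y) ^ 2) ν := by
  refine Integrable.mono' (((hw.sq.const_mul 2).add (integrable_const (2 * C ^ 2))).div_const (b ^ 2))
    ((h.gmeas hw.meas).pow_const 2).aestronglyMeasurable (Eventually.of_forall fun y => ?_)
  have hn := h.nl y
  have h1 := hn.gup (hw.nn y)
  have h2 := hn.gnn (w y)
  have hb := hn.b0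
  simp only [Pi.add_apply, norm_pow, Real.norm_eq_abs, sq_abs]
  rw [le_div_iff₀ (by positivity)]
  have : (b * gi (f y) (w y)) ^ 2 ≤ (w y + C) ^ 2 := pow_le_pow_left₀ (by positivity) h1 2
  nlinarith [sq_nonneg (w y - C)]

theorem Dat.gw_int (h : Dat ν G f F δ Q b C b' C' S) {w φ : Y → ℝ} (hw : Adm ν w)
    (hφ : Adm ν φ) : Integrable (fun y => gi (f y) (w y) * φ y) ν :=
  mul_int (h.gmeas hw.meas) (h.gsq hw) hφ.meas hφ.sq

theorem Dat.Fs_meas (h : Dat ν G f F δ Q b C b' C' S) {w : Y → ℝ} (hw : Measurable w) :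
    Measurable (fun y => Fs (f y) (F y) (w y)) :=
  (hw.mul (h.gmeas hw)).sub (h.Fm.comp (measurable_id.prodMk (h.gmeas hw)))

theorem Dat.Fs_int (h : Dat ν G f F δ Q b C b' C' S) {w : Y → ℝ} (hw : Adm ν w) :
    Integrable (fun y => Fs (f y) (F y) (w y)) ν := by
  refine Integrable.mono' (h.gw_int hw hw) (h.Fs_meas hw.meas).aestronglyMeasurable
    (Eventually.of_forall fun y => ?_)
  rw [Real.norm_eq_abs, abs_of_nonneg ((h.nl y).Fs_nn (hw.nn y)), mul_comm]
  exact (h.nl y).Fs_le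

theorem Bf_nn (h : ∀ x y, 0 ≤ G x y) {w φ : Y → ℝ} (hw : Adm ν w) (hφ : Adm ν φ) :
    0 ≤ Bf ν G w φ :=
  integral_nonneg fun z => mul_nonneg (mul_nonneg (h _ _) (hw.nn _)) (hφ.nn _)

theorem Dat.I_scale (h : Dat ν G f F δ Q b C b' C' S) {w : Y → ℝ} (hw : Adm ν w) {a : ℝ}
    (ha : 0 ≤ a) : Iw ν G f F (fun y => a * w y) ≤ Iw ν G f F w + (a ^ 2 - 1) / 2 * Nw ν G f w := by
  unfold Iw Nw
  rw [Bf_smul]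
  have : ∫ y, Fs (f y) (F y) (a * w y) ∂ν ≤
      ∫ y, (Fs (f y) (F y) (w y) + (a ^ 2 - 1) / 2 * (gi (f y) (w y) * w y)) ∂ν :=
    integral_mono (h.Fs_int (hw.smul ha)) ((h.Fs_int hw).add ((h.gw_int hw hw).const_mul _))
      fun y => (h.nl y).S2 (hw.nn y) ha
  rw [integral_add (h.Fs_int hw) ((h.gw_int hw hw).const_mul _), integral_const_mul] at this
  nlinarith

/-- weak sequential compactness in `L²`. -/
theorem weak_seq [MeasurableSpace.CountablyGenerated Y] {w : ℕ → Y → ℝ} (hw : ∀ n, Adm ν (w n))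
    (h1 : ∀ n, ∫ y, w n y ^ 2 ∂ν = 1) :
    ∃ (φ : ℕ → ℕ) (u : Y → ℝ), StrictMono φ ∧ Adm ν u ∧
      ∀ k : Y → ℝ, Measurable k → Integrable (fun y => k y ^ 2) ν →
        Tendsto (fun n => ∫ y, k y * w (φ n) y ∂ν) atTop (𝓝 (∫ y, k y * u y ∂ν)) := by
  have hL : ∀ n, MemLp (w n) 2 ν := fun n =>
    (memLp_two_iff_integrable_sq (hw n).meas.aestronglyMeasurable).2 (hw n).sq
  have : Fact ((1 : ENNReal) ≤ 2) := ⟨by norm_num⟩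
  let H := Lp ℝ 2 ν
  let W : ℕ → WeakDual ℝ H := fun n => StrongDual.toWeakDual (InnerProductSpace.toDual ℝ H ((hL n).toLp))
  have hball : ∀ n, W n ∈ WeakDual.toStrongDual ⁻¹' (Metric.closedBall (0 : StrongDual ℝ H) 1) := by
    intro n
    simp only [Set.mem_preimage, Metric.mem_closedBall, dist_zero_right]
    have : ‖(hL n).toLp‖ ≤ 1 := by
      have e : ‖(hL n).toLp‖ ^ 2 = 1 := by
        rw [← real_inner_self_eq_norm_sq, L2.inner_def, ← h1 n]
        refine integral_congr_ae ?_
        filter_upwards [(hL n).coeFn_toLp] with y hy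
        simp [hy, sq]
      nlinarith [norm_nonneg ((hL n).toLp)]
    have e2 : WeakDual.toStrongDual (W n) = InnerProductSpace.toDual ℝ H ((hL n).toLp) := rfl
    rw [e2, LinearIsometryEquiv.norm_map]; exact this
  have : Fact ((2 : ENNReal) ≠ ⊤) := ⟨by norm_num⟩
  have : SecondCountableTopology H := inferInstanceAs (SecondCountableTopology (Lp ℝ 2 ν))
  have : TopologicalSpace.SeparableSpace H := inferInstance
  obtain ⟨ℓ, -, φ, hφ, hlim⟩ := WeakDual.isSeqCompact_closedBall ℝ H (0 : StrongDual ℝ H) 1 hball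
  let z : H := (InnerProductSpace.toDual ℝ H).symm (WeakDual.toStrongDual ℓ)
  have hz : ∀ k (hk : MemLp k 2 ν), Tendsto (fun n => ∫ y, k y * w (φ n) y ∂ν) atTop
      (𝓝 (∫ y, k y * z y ∂ν)) := by
    intro k hk
    have e := (WeakDual.eval_continuous (𝕜 := ℝ) (E := H) (hk.toLp)).continuousAt.tendsto.comp hlim
    have e1 : ∀ n, (W n) hk.toLp = ∫ y, k y * w n y ∂ν := by
      intro n
      change inner ℝ ((hL n).toLp) hk.toLp = _
      rw [L2.inner_def]
      refine integral_congr_ae ?_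
      filter_upwards [(hL n).coeFn_toLp, hk.coeFn_toLp] with y hy hy'
      simp [hy, hy']
    have e2 : ℓ hk.toLp = ∫ y, k y * z y ∂ν := by
      have : (WeakDual.toStrongDual ℓ) = InnerProductSpace.toDual ℝ H z := by simp [z]
      change (WeakDual.toStrongDual ℓ) hk.toLp = _
      rw [this, InnerProductSpace.toDual_apply_apply, L2.inner_def]
      refine integral_congr_ae ?_
      filter_upwards [hk.coeFn_toLp] with y hy'
      simp [hy']
    rw [e2] at e
    refine e.congr fun n => ?_
    exact e1 _
  -- nonnegative measurable representative
  have zsm := (Lp.memLp z).aestronglyMeasurable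
  set z' : Y → ℝ := zsm.mk z with hz'
  have z'm : Measurable z' := zsm.stronglyMeasurable_mk.measurable
  have zz' : (z : Y → ℝ) =ᵐ[ν] z' := zsm.ae_eq_mk
  have z'L : MemLp z' 2 ν := (memLp_congr_ae zz').1 (Lp.memLp z)
  have z'sq : Integrable (fun y => z' y ^ 2) ν :=
    (memLp_two_iff_integrable_sq z'm.aestronglyMeasurable).1 z'L
  have znn : 0 ≤ᵐ[ν] z' := by
    refine ae_nonneg_of_forall_setIntegral_nonneg (int1 z'm z'sq) ?_
    intro s hs _
    have hk : MemLp (s.indicator (fun _ => (1:ℝ))) 2 ν := memLp_indicator_const 2 hs 1 (Or.inr (measure_ne_top _ _))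
    have := hz _ hk
    have e : ∫ y, s.indicator (fun _ => (1:ℝ)) y * z y ∂ν = ∫ y in s, z' y ∂ν := by
      rw [← integral_indicator hs]
      refine integral_congr_ae ?_
      filter_upwards [zz'] with y hy
      by_cases hys : y ∈ s <;> simp [hys, hy]
    rw [e] at this
    refine ge_of_tendsto' this fun n => integral_nonneg fun y => ?_
    exact mul_nonneg (Set.indicator_nonneg (fun _ _ => zero_le_one) _) ((hw _).nn y)
  refine ⟨φ, fun y => max (z' y) 0, hφ, ⟨z'm.max measurable_const, fun y => le_max_right _ _, ?_⟩, ?_⟩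
  · refine z'sq.congr ?_
    filter_upwards [znn] with y hy
    rw [max_eq_left (show (0:ℝ) ≤ z' y from hy)]
  · intro k km k2
    have := hz k ((memLp_two_iff_integrable_sq km.aestronglyMeasurable).2 k2)
    convert this using 2
    refine integral_congr_ae ?_
    filter_upwards [znn, zz'] with y hy hy'
    rw [hy', max_eq_left (show (0:ℝ) ≤ z' y from hy)]

end
end Ham

namespace Ham

variable {Y : Type*} [MeasurableSpace Y]
variable {ν : Measure Y} [IsFiniteMeasure ν] {G : Y → Y → ℝ} {f F : Y → ℝ → ℝ} {δ : ℝ → ℝ}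
  {Q b C b' C' S : ℝ}

theorem cs1 {w d : Y → ℝ} (wm : Measurable w) (w2 : Integrable (fun y => w y ^ 2) ν)
    (h1 : ∫ y, w y ^ 2 ∂ν = 1) (dm : Measurable d) (d2 : Integrable (fun y => d y ^ 2) ν) :
    (∫ y, w y * d y ∂ν) ^ 2 ≤ ∫ y, d y ^ 2 ∂ν := by
  set c := ∫ y, w y * d y ∂ν with hc
  have h0 : 0 ≤ ∫ y, (d y - c * w y) ^ 2 ∂ν := integral_nonneg fun y => sq_nonneg _
  have e : ∀ y, (d y - c * w y) ^ 2 = d y ^ 2 + ((-2 * c) * (w y * d y) + c ^ 2 * w y ^ 2) := by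
    intro y; ring
  simp_rw [e] at h0
  have hwd := mul_int wm w2 dm d2
  rw [integral_add d2 (iadd (hwd.const_mul (-2 * c)) (w2.const_mul (c ^ 2))),
    integral_add (hwd.const_mul (-2 * c)) (w2.const_mul (c ^ 2)), integral_const_mul,
    integral_const_mul, h1, ← hc] at h0
  nlinarith

theorem Dconv2 {G2 : Y → Y → ℝ} {C2 : ℝ} {S2 : ℝ} (hk : KerS ν G2 S2) (hb : ∀ x y, G2 x y ≤ C2)
    {w : ℕ → Y → ℝ} (hw : ∀ n, Adm ν (w n)) (h1 : ∀ n, ∫ y, w n y ^ 2 ∂ν = 1)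
    {u : Y → ℝ} (hu : Adm ν u)
    (hlim : ∀ k : Y → ℝ, Measurable k → Integrable (fun y => k y ^ 2) ν →
        Tendsto (fun n => ∫ y, k y * w n y ∂ν) atTop (𝓝 (∫ y, k y * u y ∂ν))) :
    Tendsto (fun n => Bf ν G2 (w n) (w n)) atTop (𝓝 (Bf ν G2 u u)) := by
  set T : (Y → ℝ) → Y → ℝ := fun w x => ∫ y, G2 x y * w y ∂ν with hT
  have hgx : ∀ x, Measurable (fun y => G2 x y) := fun x => hk.meas.comp measurable_prodMk_left
  have Tm : ∀ w, Measurable w → Measurable (T w) := by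
    intro w wm
    have : StronglyMeasurable (fun z : Y × Y => G2 z.1 z.2 * w z.2) :=
      (hk.meas.mul (wm.comp measurable_snd)).stronglyMeasurable
    exact this.integral_prod_right.measurable
  have hG2sq : ∀ x, Integrable (fun y => G2 x y ^ 2) ν := fun x =>
    Integrable.mono' (integrable_const (C2 ^ 2)) ((hgx x).pow_const 2).aestronglyMeasurable
      (Eventually.of_forall fun y => by
        simp only [norm_pow, Real.norm_eq_abs, sq_abs]
        exact pow_le_pow_left₀ (hk.nn x y) (hb x y) 2)
  have Tlim : ∀ x, Tendsto (fun n => T (w n) x) atTop (𝓝 (T u x)) := fun x =>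
    hlim _ (hgx x) (hG2sq x)
  set R := C2 * (ν.real Set.univ + 1) with hR
  have hC2 : ∀ x : Y, 0 ≤ C2 := fun x => (hk.nn x x).trans (hb x x)
  have Tn : ∀ n x, |T (w n) x| ≤ R := by
    intro n x
    have : |T (w n) x| ≤ ∫ y, C2 * (1 + w n y ^ 2) ∂ν := by
      rw [← Real.norm_eq_abs]
      refine norm_integral_le_of_norm_le (g := fun y => C2 * (1 + w n y ^ 2))
        (((integrable_const 1).add (hw n).sq).const_mul C2) (Eventually.of_forall fun y => ?_)
      rw [norm_mul, Real.norm_eq_abs, Real.norm_eq_abs, abs_of_nonneg (hk.nn x y),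
        abs_of_nonneg ((hw n).nn y)]
      have h3 := (hw n).nn y
      exact mul_le_mul (hb x y) (by nlinarith [sq_nonneg (w n y - 1)]) h3 (hC2 x)
    rw [integral_const_mul, integral_add (integrable_const 1) (hw n).sq, h1 n] at this
    simpa [hR] using this
  have Tu : ∀ x, |T u x| ≤ R := fun x => le_of_tendsto' (Tlim x).abs fun n => Tn n x
  have bsq : ∀ g : Y → ℝ, Measurable g → (∀ x, |g x| ≤ 2 * R) → Integrable (fun x => g x ^ 2) ν :=
    fun g gm gb => Integrable.mono' (integrable_const ((2 * R) ^ 2))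
      (gm.pow_const 2).aestronglyMeasurable (Eventually.of_forall fun y => by
        simp only [norm_pow, Real.norm_eq_abs]
        exact pow_le_pow_left₀ (abs_nonneg _) (gb y) 2)
  have hR0 : ∀ x : Y, 0 ≤ R := fun x => (abs_nonneg _).trans (Tu x)
  have Tusq := bsq _ (Tm u hu.meas) fun x => (Tu x).trans (by linarith [hR0 x])
  have dm : ∀ n, Measurable (fun x => T (w n) x - T u x) := fun n =>
    (Tm _ (hw n).meas).sub (Tm _ hu.meas)
  have db : ∀ n x, |T (w n) x - T u x| ≤ 2 * R := fun n x => by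
    have := abs_sub (T (w n) x) (T u x)
    linarith [Tn n x, Tu x]
  have dsq : ∀ n, Integrable (fun x => (T (w n) x - T u x) ^ 2) ν := fun n => bsq _ (dm n) (db n)
  have d0 : Tendsto (fun n => ∫ x, (T (w n) x - T u x) ^ 2 ∂ν) atTop (𝓝 0) := by
    have := tendsto_integral_of_dominated_convergence (μ := ν)
      (F := fun n x => (T (w n) x - T u x) ^ 2) (f := fun _ => (0:ℝ)) (fun _ => (2 * R) ^ 2)
      (fun n => ((dm n).pow_const 2).aestronglyMeasurable) (integrable_const _)
      (fun n => Eventually.of_forall fun x => by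
        simp only [norm_pow, Real.norm_eq_abs]
        exact pow_le_pow_left₀ (abs_nonneg _) (db n x) 2)
      (Eventually.of_forall fun x => by
        have := ((Tlim x).sub_const (T u x)).pow 2
        simpa using this)
    simpa using this
  have d1 : Tendsto (fun n => ∫ x, w n x * (T (w n) x - T u x) ∂ν) atTop (𝓝 0) := by
    have : Tendsto (fun n => (∫ x, w n x * (T (w n) x - T u x) ∂ν) ^ 2) atTop (𝓝 0) :=
      squeeze_zero (fun n => sq_nonneg _)
        (fun n => cs1 (hw n).meas (hw n).sq (h1 n) (dm n) (dsq n)) d0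
    have h3 := this.sqrt
    simp only [Real.sqrt_sq_eq_abs, Real.sqrt_zero] at h3
    exact (tendsto_zero_iff_abs_tendsto_zero _).2 h3
  have d2 := hlim _ (Tm u hu.meas) Tusq
  have := d2.add d1
  rw [add_zero] at this
  have eu : Bf ν G2 u u = ∫ y, T u y * u y ∂ν := by
    rw [hk.iter hu.meas hu.sq hu.meas hu.sq]
    simp only [hT, mul_comm]
  rw [eu]
  refine this.congr fun n => ?_
  rw [hk.iter (hw n).meas (hw n).sq (hw n).meas (hw n).sq,
    ← integral_add (mul_int (Tm _ hu.meas) Tusq (hw n).meas (hw n).sq)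
      (mul_int (hw n).meas (hw n).sq (dm n) (dsq n))]
  refine integral_congr_ae (Eventually.of_forall fun y => ?_)
  simp only [hT]; ring

theorem Dat.Dconv (h : Dat ν G f F δ Q b C b' C' S)
    {w : ℕ → Y → ℝ} (hw : ∀ n, Adm ν (w n)) (h1 : ∀ n, ∫ y, w n y ^ 2 ∂ν = 1)
    {u : Y → ℝ} (hu : Adm ν u)
    (hlim : ∀ k : Y → ℝ, Measurable k → Integrable (fun y => k y ^ 2) ν →
        Tendsto (fun n => ∫ y, k y * w n y ∂ν) atTop (𝓝 (∫ y, k y * u y ∂ν))) :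
    Tendsto (fun n => Bf ν G (w n) (w n)) atTop (𝓝 (Bf ν G u u)) := by
  rw [Metric.tendsto_atTop]
  intro e he
  have hsu : 0 ≤ ∫ y, u y ^ 2 ∂ν := integral_nonneg fun y => sq_nonneg _
  set Su := ∫ y, u y ^ 2 ∂ν
  obtain ⟨G1, G2, C2, hs, k1, m2, n2, b2⟩ := h.split (e / (2 * (1 + Su))) (by positivity)
  have k2 : KerS ν G2 (C2 ⊔ 0 * ν.real Set.univ + (max C2 0) * ν.real Set.univ) := by
    refine ⟨m2, n2, fun x y => ?_, ?_, fun x => ?_⟩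
    · have := h.ker.symm x y
      rw [hs, hs, k1.symm x y] at this
      linarith
    · have : 0 ≤ ν.real Set.univ := measureReal_nonneg
      positivity
    · calc ∫⁻ y, ENNReal.ofReal (G2 x y) ∂ν ≤ ∫⁻ y, ENNReal.ofReal (max C2 0) ∂ν :=
            lintegral_mono fun y => ENNReal.ofReal_le_ofReal ((b2 x y).trans (le_max_left _ _))
        _ = ENNReal.ofReal (max C2 0 * ν.real Set.univ) := by
            rw [lintegral_const, ENNReal.ofReal_mul (le_max_right _ _), ofReal_measureReal]
        _ ≤ _ := by
            refine ENNReal.ofReal_le_ofReal ?_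
            have : 0 ≤ max C2 (0 * ν.real Set.univ) := le_max_of_le_right (by simp)
            linarith
  have hsum : ∀ v, Adm ν v → Bf ν G v v = Bf ν G1 v v + Bf ν G2 v v := by
    intro v hv
    unfold Bf
    rw [← integral_add (k1.intg hv.meas hv.sq hv.meas hv.sq) (k2.intg hv.meas hv.sq hv.meas hv.sq)]
    refine integral_congr_ae (Eventually.of_forall fun z => ?_)
    simp only [hs]; ring
  have hc2 := Dconv2 k2 b2 hw h1 hu hlim
  rw [Metric.tendsto_atTop] at hc2
  obtain ⟨n0, hn0⟩ := hc2 (e / 2) (by positivity)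
  refine ⟨n0, fun n hn => ?_⟩
  have a1 := k1.abs_le (hw n).meas (hw n).sq
  have a2 := k1.abs_le hu.meas hu.sq
  have a3 := hn0 n hn
  rw [h1 n] at a1
  rw [Real.dist_eq] at a3 ⊢
  rw [hsum _ (hw n), hsum _ hu]
  have : e / (2 * (1 + Su)) * 1 + e / (2 * (1 + Su)) * Su = e / 2 := by field_simp
  have t : Bf ν G1 (w n) (w n) + Bf ν G2 (w n) (w n) - (Bf ν G1 u u + Bf ν G2 u u)
      = Bf ν G1 (w n) (w n) - Bf ν G1 u u + (Bf ν G2 (w n) (w n) - Bf ν G2 u u) := by ring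
  rw [t]
  have a4 := abs_add_le (Bf ν G1 (w n) (w n) - Bf ν G1 u u) (Bf ν G2 (w n) (w n) - Bf ν G2 u u)
  have a5 := abs_sub (Bf ν G1 (w n) (w n)) (Bf ν G1 u u)
  linarith

/-- Levels reachable by rays. -/
def lev (ν : Measure Y) (G : Y → Y → ℝ) (f F : Y → ℝ → ℝ) : Set ℝ :=
  {c | ∃ w, Adm ν w ∧ (0 < ∫ y, w y ^ 2 ∂ν) ∧ ∀ t, 0 ≤ t → Iw ν G f F (fun y => t * w y) ≤ c}

theorem lev_norm {c : ℝ} (hc : c ∈ lev ν G f F) : ∃ w, Adm ν w ∧ (∫ y, w y ^ 2 ∂ν = 1) ∧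
    ∀ t, 0 ≤ t → Iw ν G f F (fun y => t * w y) ≤ c := by
  obtain ⟨w, hw, hp, hI⟩ := hc
  set S := ∫ y, w y ^ 2 ∂ν with hS
  refine ⟨fun y => (√S)⁻¹ * w y, hw.smul (by positivity), ?_, fun t ht => ?_⟩
  · simp only [mul_pow]
    rw [integral_const_mul, ← hS, inv_pow, Real.sq_sqrt hp.le]
    field_simp
  · have := hI (t * (√S)⁻¹) (by positivity)
    simpa [mul_assoc] using this

theorem Dat.lev_nn (h : Dat ν G f F δ Q b C b' C' S) {c : ℝ} (hc : c ∈ lev ν G f F) : 0 ≤ c := by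
  obtain ⟨w, hw, hp, hI⟩ := hc
  have := hI 0 le_rfl
  refine le_trans ?_ this
  have e : (fun y => (0:ℝ) * w y) = fun y => (0:ℝ) * w y := rfl
  unfold Iw
  rw [Bf_smul]
  have : 0 ≤ ∫ y, Fs (f y) (F y) (0 * w y) ∂ν := integral_nonneg fun y => by
    simpa using (h.nl y).Fs_nn le_rfl
  simpa using this

theorem Dat.exists_min [MeasurableSpace.CountablyGenerated Y] (h : Dat ν G f F δ Q b C b' C' S)
    (hne : (lev ν G f F).Nonempty) :
    ∃ w, Adm ν w ∧ 0 < Bf ν G w w ∧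
      ∀ t, 0 ≤ t → Iw ν G f F (fun y => t * w y) ≤ sInf (lev ν G f F) := by
  set c := sInf (lev ν G f F) with hc
  have hbdd : BddBelow (lev ν G f F) := ⟨0, fun _ hx => h.lev_nn hx⟩
  obtain ⟨cn, -, hcn, hmem⟩ := exists_seq_tendsto_sInf hne hbdd
  choose w hw h1 hI using fun n => lev_norm (hmem n)
  obtain ⟨φ, u, hφ, hu, hlim⟩ := weak_seq hw h1
  have hcφ : Tendsto (fun n => cn (φ n)) atTop (𝓝 c) := hcn.comp hφ.tendsto_atTop
  have hD := h.Dconv (w := fun n => w (φ n)) (fun n => hw _) (fun n => h1 _) hu hlim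
  refine ⟨u, hu, ?_, ?_⟩
  · have hQ : ∀ y : Y, 0 < Q := fun y => (h.nl y).Q0
    have hY : Nonempty Y := by
      by_contra hY
      rw [not_nonempty_iff] at hY
      have := h1 0
      rw [Measure.eq_zero_of_isEmpty ν, integral_zero_measure] at this
      exact zero_ne_one this
    have hQ0 := hQ hY.some
    have key : ∀ t : ℝ, 0 ≤ t → t ^ 2 * (1 / (2 * Q) - Bf ν G u u / 2) ≤ c := by
      intro t ht
      have l : Tendsto (fun n => t ^ 2 * (1 / (2 * Q) - Bf ν G (w (φ n)) (w (φ n)) / 2)) atTop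
          (𝓝 (t ^ 2 * (1 / (2 * Q) - Bf ν G u u / 2))) :=
        (tendsto_const_nhds.sub (hD.div_const 2)).const_mul _
      refine le_of_tendsto_of_tendsto' l hcφ fun n => ?_
      have i1 := hI (φ n) t ht
      unfold Iw at i1
      rw [Bf_smul] at i1
      have i2 : ∫ y, (t * w (φ n) y) ^ 2 / (2 * Q) ∂ν
          ≤ ∫ y, Fs (f y) (F y) (t * w (φ n) y) ∂ν :=
        integral_mono (((hw (φ n)).smul ht).sq.div_const _) (h.Fs_int ((hw _).smul ht))
          fun y => (h.nl y).S3 (((hw (φ n)).smul ht).nn y)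
      simp only [mul_pow] at i2
      rw [integral_div, integral_const_mul, h1] at i2
      have : t ^ 2 * (1 / (2 * Q) - Bf ν G (w (φ n)) (w (φ n)) / 2)
        = t ^ 2 * 1 / (2 * Q) - t ^ 2 * Bf ν G (w (φ n)) (w (φ n)) / 2 := by ring
      linarith
    by_contra hcon
    push Not at hcon
    have hA : 0 < 1 / (2 * Q) := by positivity
    have k1 := key (√((c + 1) * (2 * Q))) (Real.sqrt_nonneg _)
    have hc0 : 0 ≤ c := by
      simpa using key 0 le_rfl
    rw [Real.sq_sqrt (by positivity)] at k1
    have : (c + 1) * (2 * Q) * (1 / (2 * Q)) = c + 1 := by field_simp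
    have h5 : (c + 1) * (2 * Q) * (1 / (2 * Q)) ≤
      (c + 1) * (2 * Q) * (1 / (2 * Q) - Bf ν G u u / 2) :=
      mul_le_mul_of_nonneg_left (by linarith) (by positivity)
    linarith
  · intro t ht
    have hut := hu.smul ht
    -- weak lower semicontinuity
    have l1 := hlim _ (h.gmeas hut.meas) (h.gsq hut)
    have key : ∀ n, ∫ y, Fs (f y) (F y) (t * u y) ∂ν
        + t * (∫ y, gi (f y) (t * u y) * w (φ n) y ∂ν - ∫ y, gi (f y) (t * u y) * u y ∂ν)
        ≤ cn (φ n) + t ^ 2 * Bf ν G (w (φ n)) (w (φ n)) / 2 := by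
      intro n
      have i1 := hI (φ n) t ht
      unfold Iw at i1
      rw [Bf_smul] at i1
      have hg1 := h.gw_int hut (hw (φ n))
      have hg2 := h.gw_int hut hu
      have i3 : ∫ y, (Fs (f y) (F y) (t * u y) + t * (gi (f y) (t * u y) * w (φ n) y
          - gi (f y) (t * u y) * u y)) ∂ν ≤ ∫ y, Fs (f y) (F y) (t * w (φ n) y) ∂ν := by
        refine integral_mono ((h.Fs_int hut).add ((hg1.sub hg2).const_mul t))
          (h.Fs_int ((hw _).smul ht)) fun y => ?_
        have := (h.nl y).S1 (hut.nn y) (((hw (φ n)).smul ht).nn y)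
        simp only at this ⊢
        nlinarith
      rw [integral_add (h.Fs_int hut) ((isub hg1 hg2).const_mul t), integral_const_mul,
        integral_sub hg1 hg2] at i3
      linarith
    have L1 : Tendsto (fun n => ∫ y, Fs (f y) (F y) (t * u y) ∂ν
        + t * (∫ y, gi (f y) (t * u y) * w (φ n) y ∂ν - ∫ y, gi (f y) (t * u y) * u y ∂ν)) atTop
        (𝓝 (∫ y, Fs (f y) (F y) (t * u y) ∂ν
        + t * (∫ y, gi (f y) (t * u y) * u y ∂ν - ∫ y, gi (f y) (t * u y) * u y ∂ν))) :=
      ((l1.sub_const _).const_mul t).const_add _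
    have L2 : Tendsto (fun n => cn (φ n) + t ^ 2 * Bf ν G (w (φ n)) (w (φ n)) / 2) atTop
        (𝓝 (c + t ^ 2 * Bf ν G u u / 2)) := hcφ.add ((hD.const_mul _).div_const 2)
    have := le_of_tendsto_of_tendsto' L1 L2 key
    unfold Iw
    rw [Bf_smul]
    simp only [sub_self, mul_zero, add_zero] at this
    linarith

end Ham

namespace Ham

variable {Y : Type*} [MeasurableSpace Y]
variable {ν : Measure Y} [IsFiniteMeasure ν] {G : Y → Y → ℝ} {f F : Y → ℝ → ℝ} {δ : ℝ → ℝ}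
  {Q b C b' C' S : ℝ}

/-- continuity of `q ↦ ∫ g (q₁ w + q₂ φ) ψ`. -/
theorem Dat.gcontP (h : Dat ν G f F δ Q b C b' C' S) {w φ ψ : Y → ℝ} (hw : Adm ν w)
    (hφ : Adm ν φ) (hψ : Adm ν ψ) :
    ContinuousOn (fun q : ℝ × ℝ => ∫ y, gi (f y) (q.1 * w y + q.2 * φ y) * ψ y ∂ν)
      (Set.Ici 0 ×ˢ Set.Ici 0) := by
  intro q hq
  obtain ⟨hq1, hq2⟩ := hq
  simp only [Set.mem_Ici] at hq1 hq2
  have A : Adm ν (fun y => (q.1 + 1) * w y + (q.2 + 1) * φ y) :=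
    (hw.smul (by linarith)).add (hφ.smul (by linarith))
  refine tendsto_integral_filter_of_dominated_convergence
    (fun y => gi (f y) ((q.1 + 1) * w y + (q.2 + 1) * φ y) * ψ y) ?_ ?_ (h.gw_int A hψ) ?_
  · refine Eventually.of_forall fun q' => ?_
    exact ((h.gmeas ((hw.meas.const_mul _).add (hφ.meas.const_mul _))).mul
      hψ.meas).aestronglyMeasurable
  · have e1 : ∀ᶠ q' : ℝ × ℝ in 𝓝[Set.Ici 0 ×ˢ Set.Ici 0] q, q'.1 < q.1 + 1 :=
      mem_nhdsWithin_of_mem_nhds ((continuous_fst.tendsto q).eventually_lt_const (by linarith))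
    have e2 : ∀ᶠ q' : ℝ × ℝ in 𝓝[Set.Ici 0 ×ˢ Set.Ici 0] q, q'.2 < q.2 + 1 :=
      mem_nhdsWithin_of_mem_nhds ((continuous_snd.tendsto q).eventually_lt_const (by linarith))
    filter_upwards [e1, e2] with q' h1 h2
    refine Eventually.of_forall fun y => ?_
    rw [norm_mul, Real.norm_eq_abs, Real.norm_eq_abs, abs_of_nonneg ((h.nl y).gnn _),
      abs_of_nonneg (hψ.nn y)]
    refine mul_le_mul_of_nonneg_right ((h.nl y).gmono ?_) (hψ.nn y)
    have := mul_le_mul_of_nonneg_right h1.le (hw.nn y)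
    have := mul_le_mul_of_nonneg_right h2.le (hφ.nn y)
    linarith
  · refine Eventually.of_forall fun y => ?_
    have : Continuous (fun q : ℝ × ℝ => gi (f y) (q.1 * w y + q.2 * φ y) * ψ y) :=
      ((h.nl y).gcont.comp (by fun_prop)).mul continuous_const
    exact this.continuousWithinAt

theorem Dat.gcont1 (h : Dat ν G f F δ Q b C b' C' S) {w ψ : Y → ℝ} (hw : Adm ν w)
    (hψ : Adm ν ψ) :
    ContinuousOn (fun t : ℝ => ∫ y, gi (f y) (t * w y) * ψ y ∂ν) (Set.Ici 0) := by
  have h1 := h.gcontP hw hw hψ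
  have h2 : ContinuousOn (fun t : ℝ => ((t, 0) : ℝ × ℝ)) (Set.Ici 0) :=
    (by fun_prop : Continuous fun t : ℝ => ((t, 0) : ℝ × ℝ)).continuousOn
  have := h1.comp h2 (fun t ht => ⟨ht, by simp⟩)
  simpa [Function.comp_def] using this

theorem Dat.Ncont (h : Dat ν G f F δ Q b C b' C' S) {w : Y → ℝ} (hw : Adm ν w) :
    ContinuousOn (fun t : ℝ => Nw ν G f (fun y => t * w y)) (Set.Ici 0) := by
  have e : (fun t : ℝ => Nw ν G f (fun y => t * w y))
      = fun t => t * (∫ y, gi (f y) (t * w y) * w y ∂ν) - t ^ 2 * Bf ν G w w := by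
    funext t
    unfold Nw
    rw [Bf_smul, ← integral_const_mul]
    congr 2
    funext y; ring
  rw [e]
  exact (continuousOn_id.mul (h.gcont1 hw hw)).sub (by fun_prop)

theorem Adm.int_pos {w : Y → ℝ} (hw : Adm ν w) (hD : 0 < Bf ν G w w) : ¬ (w =ᵐ[ν] 0) := by
  intro h0
  have : Bf ν G w w = 0 := by
    unfold Bf
    refine integral_eq_zero_of_ae ?_
    have h1 : ∀ᵐ z ∂(ν.prod ν), w z.1 = 0 := Measure.quasiMeasurePreserving_fst.ae h0
    filter_upwards [h1] with z hz
    simp [hz]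
  linarith

theorem Dat.exists_nehari (h : Dat ν G f F δ Q b C b' C' S) {w : Y → ℝ} (hw : Adm ν w)
    (hD : 0 < Bf ν G w w) {c : ℝ} (hI : ∀ t, 0 ≤ t → Iw ν G f F (fun y => t * w y) ≤ c) :
    ∃ t, 0 < t ∧ Nw ν G f (fun y => t * w y) = 0 := by
  have hne := hw.int_pos hD
  have hY : Nonempty Y := by
    by_contra hY
    rw [not_nonempty_iff] at hY
    exact hne (Eventually.of_forall fun y => (hY.false y).elim)
  have hn0 := h.nl hY.some
  have hsq : 0 < ∫ y, w y ^ 2 ∂ν := by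
    rw [integral_pos_iff_support_of_nonneg (fun y => sq_nonneg _) hw.sq]
    rw [pos_iff_ne_zero]
    intro h0
    refine hne ?_
    have : ∀ᵐ y ∂ν, y ∉ Function.support (fun y => w y ^ 2) := measure_eq_zero_iff_ae_notMem.1 h0
    filter_upwards [this] with y hy
    simpa using hy
  have h1 : 0 < ∫ y, w y ∂ν := by
    rw [integral_pos_iff_support_of_nonneg hw.nn (int1 hw.meas hw.sq)]
    rw [pos_iff_ne_zero]
    intro h0
    refine hne ?_
    have : ∀ᵐ y ∂ν, y ∉ Function.support w := measure_eq_zero_iff_ae_notMem.1 h0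
    filter_upwards [this] with y hy
    simpa using hy
  set S2 := ∫ y, w y ^ 2 ∂ν with hS2
  set D := Bf ν G w w with hDd
  -- small t
  have small : ∃ t, 0 < t ∧ 0 < Nw ν G f (fun y => t * w y) := by
    set A := 2 * (D + 1) / S2 with hA
    have hA0 : 0 < A := by positivity
    set d := δ A / A with hd
    have hd0 : 0 < d := div_pos (hn0.δ0 A hA0) hA0
    have l : Tendsto (fun n : ℕ => ∫ y, (if w y ≤ n * d then w y ^ 2 else 0) ∂ν) atTop (𝓝 S2) := by
      refine tendsto_integral_of_dominated_convergence (fun y => w y ^ 2) (fun n => ?_) hw.sq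
        (fun n => Eventually.of_forall fun y => ?_) (Eventually.of_forall fun y => ?_)
      · exact (Measurable.ite (measurableSet_le hw.meas measurable_const)
          (hw.meas.pow_const 2) measurable_const).aestronglyMeasurable
      · split_ifs
        · simp
        · simp [sq_nonneg]
      · refine tendsto_const_nhds.congr' ?_
        obtain ⟨n0, hn0⟩ := exists_nat_ge (w y / d)
        filter_upwards [eventually_ge_atTop n0] with n hn
        rw [if_pos]
        rw [div_le_iff₀ hd0] at hn0
        refine hn0.trans (mul_le_mul_of_nonneg_right (by exact_mod_cast hn) hd0.le)
    have l2 := (l.eventually_const_lt (show S2 / 2 < S2 by linarith)).and (eventually_ge_atTop 1)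
    obtain ⟨n, hn, hn1⟩ := l2.exists
    have hnp : (0:ℝ) < n := by exact_mod_cast hn1
    set t : ℝ := 1 / n with ht
    have ht0 : 0 < t := by positivity
    refine ⟨t, ht0, ?_⟩
    have hwt := hw.smul ht0.le
    have k : ∫ y, A * t ^ 2 * (if w y ≤ n * d then w y ^ 2 else 0) ∂ν
        ≤ ∫ y, gi (f y) (t * w y) * (t * w y) ∂ν := by
      have hi : Integrable (fun y => if w y ≤ n * d then w y ^ 2 else 0) ν := by
        refine Integrable.mono' hw.sq (Measurable.ite (measurableSet_le hw.meas measurable_const)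
          (hw.meas.pow_const 2) measurable_const).aestronglyMeasurable
          (Eventually.of_forall fun y => ?_)
        split_ifs
        · simp
        · simp [sq_nonneg]
      refine integral_mono (hi.const_mul _) (h.gw_int hwt hwt) fun y => ?_
      have hy0 := hwt.nn y
      split_ifs with hy
      · have := (h.nl y).gsm hA0 hy0 (by
          rw [ht, one_div, inv_mul_le_iff₀ hnp]; exact hy)
        have h3 := mul_le_mul_of_nonneg_right this hy0
        calc _ = A * (t * w y) * (t * w y) := by ring
          _ ≤ _ := h3
      · rw [mul_zero]; exact mul_nonneg ((h.nl y).gnn _) hy0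
    rw [integral_const_mul] at k
    unfold Nw
    rw [Bf_smul]
    have e : A * t ^ 2 * (S2 / 2) = t ^ 2 * (D + 1) := by rw [hA]; field_simp
    have h5 : A * t ^ 2 * (S2 / 2) ≤ A * t ^ 2 * ∫ y, (if w y ≤ n * d then w y ^ 2 else 0) ∂ν :=
      mul_le_mul_of_nonneg_left hn.le (by positivity)
    have : 0 < t ^ 2 := by positivity
    simp only at k ⊢
    nlinarith
  have large : ∃ t, 0 < t ∧ Nw ν G f (fun y => t * w y) ≤ 0 := by
    by_contra hcon
    push Not at hcon
    have hb := hn0.b0'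
    have hQ := hn0.Q0
    have key : ∀ t : ℝ, 0 < t → b' / Q * t * (∫ y, w y ∂ν) - C' * ν.real Set.univ ≤ c := by
      intro t ht
      have hwt := hw.smul ht.le
      have e1 := hI t ht.le
      have e2 := hcon t ht
      unfold Iw at e1
      unfold Nw at e2
      have hgi := h.gw_int hwt hwt
      have e3 : ∫ y, (b' / Q * t * w y - C') ∂ν ≤
          ∫ y, (Fs (f y) (F y) (t * w y) - gi (f y) (t * w y) * (t * w y) / 2) ∂ν := by
        refine integral_mono (isub ((int1 hw.meas hw.sq).const_mul _) (integrable_const _))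
          (isub (h.Fs_int hwt) (hgi.div_const 2)) fun y => ?_
        have := (h.nl y).Hs (hwt.nn y)
        simp only at this ⊢
        linarith
      rw [integral_sub ((int1 hw.meas hw.sq).const_mul _) (integrable_const _),
        integral_sub (h.Fs_int hwt) (hgi.div_const 2), integral_const_mul, integral_div] at e3
      simp only [integral_const, smul_eq_mul] at e3 e1 e2
      linarith
    set P := b' / Q * (∫ y, w y ∂ν) with hP
    have hP0 : 0 < P := by positivity
    have := key ((|c + C' * ν.real Set.univ| + 1) / P) (by positivity)
    have e : b' / Q * ((|c + C' * ν.real Set.univ| + 1) / P) * (∫ y, w y ∂ν)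
        = |c + C' * ν.real Set.univ| + 1 := by
      have : b' / Q * ((|c + C' * ν.real Set.univ| + 1) / P) * (∫ y, w y ∂ν)
        = P * ((|c + C' * ν.real Set.univ| + 1) / P) := by rw [hP]; ring
      rw [this]; field_simp
    rw [e] at this
    linarith [le_abs_self (c + C' * ν.real Set.univ)]
  obtain ⟨t1, ht1, hN1⟩ := small
  obtain ⟨t2, ht2, hN2⟩ := large
  have hc := h.Ncont hw
  have : Set.uIcc t2 t1 ⊆ Set.Ioi 0 := by
    intro t ht
    rw [Set.mem_uIcc] at ht
    rcases ht with ht | ht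
    · exact ht2.trans_le ht.1
    · exact ht1.trans_le ht.1
  have hc' := hc.mono (this.trans Set.Ioi_subset_Ici_self)
  have iv := intermediate_value_uIcc hc'
  obtain ⟨t, ht, ht'⟩ := iv (Set.mem_uIcc.2 (Or.inl ⟨hN2, hN1.le⟩))
  exact ⟨t, this ht, ht'⟩

end Ham

namespace Ham

variable {Y : Type*} [MeasurableSpace Y]
variable {ν : Measure Y} [IsFiniteMeasure ν] {G : Y → Y → ℝ} {f F : Y → ℝ → ℝ} {δ : ℝ → ℝ}
  {Q b C b' C' S : ℝ}

theorem Dat.Nstrict (h : Dat ν G f F δ Q b C b' C' S) {w : Y → ℝ} (hw : Adm ν w)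
    (hD : 0 < Bf ν G w w) {a a' : ℝ} (ha : 0 < a) (haa : a < a') :
    (∫ y, gi (f y) (a' * w y) * w y ∂ν) * a < (∫ y, gi (f y) (a * w y) * w y ∂ν) * a' := by
  have i1 := h.gw_int (hw.smul ha.le) hw
  have i2 := h.gw_int (hw.smul (ha.trans haa).le) hw
  rw [← integral_mul_const, ← integral_mul_const]
  have key : ∀ y, 0 < w y → gi (f y) (a' * w y) * w y * a < gi (f y) (a * w y) * w y * a' := by
    intro y h0
    have := (h.nl y).gstrict (mul_pos ha h0) (mul_lt_mul_of_pos_right haa h0)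
    nlinarith
  have key' : ∀ y, 0 ≤ gi (f y) (a * w y) * w y * a' - gi (f y) (a' * w y) * w y * a := by
    intro y
    rcases (hw.nn y).eq_or_lt with h0 | h0
    · simp [← h0]
    · linarith [key y h0]
  have i3 := isub (i1.mul_const a') (i2.mul_const a)
  have nn : 0 ≤ ∫ y, (gi (f y) (a * w y) * w y * a' - gi (f y) (a' * w y) * w y * a) ∂ν :=
    integral_nonneg key'
  have e := integral_sub (i1.mul_const a') (i2.mul_const a)
  rcases nn.eq_or_lt with h0 | h0
  · exfalso
    have := (integral_eq_zero_iff_of_nonneg key' i3).1 h0.symm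
    refine hw.int_pos hD ?_
    filter_upwards [this] with y hy
    by_contra hc
    have h0 : 0 < w y := lt_of_le_of_ne (hw.nn y) (Ne.symm hc)
    have := key y h0
    simp only [Pi.zero_apply] at hy
    linarith
  · linarith

theorem Dat.EL1 (h : Dat ν G f F δ Q b C b' C' S) {w φ : Y → ℝ} (hw : Adm ν w)
    (hD : 0 < Bf ν G w w)
    (hI : ∀ t, 0 ≤ t → Iw ν G f F (fun y => t * w y) ≤ sInf (lev ν G f F))
    (hN : Nw ν G f w = 0) (hφ : Adm ν φ) {η : ℝ} (hη : 0 < η) (hη1 : η < 1) :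
    ∀ᶠ s in 𝓝[>] (0:ℝ), (1 - η) * Bf ν G φ w ≤ (1 + η) * ∫ y, gi (f y) (1 * w y + s * φ y) * φ y ∂ν := by
  set D := Bf ν G w w with hDd
  have hN' : ∫ y, gi (f y) (w y) * w y ∂ν = D := by unfold Nw at hN; linarith
  have bddb : BddBelow (lev ν G f F) := ⟨0, fun _ hx => h.lev_nn hx⟩
  -- Nehari function along w + s φ
  have Neq : ∀ t s : ℝ, Nw ν G f (fun y => t * (w y + s * φ y))
      = t * ((∫ y, gi (f y) (t * w y + (t * s) * φ y) * w y ∂ν)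
        + s * (∫ y, gi (f y) (t * w y + (t * s) * φ y) * φ y ∂ν)
        - t * (D + 2 * s * Bf ν G φ w + s ^ 2 * Bf ν G φ φ)) ∨ t < 0 ∨ s < 0 := by
    intro t s
    rcases lt_or_ge t 0 with ht | ht
    · exact Or.inr (Or.inl ht)
    rcases lt_or_ge s 0 with hs | hs
    · exact Or.inr (Or.inr hs)
    left
    unfold Nw
    rw [Bf_smul, h.ker.expand hφ.meas hφ.sq hw.meas hw.sq]
    have A : Adm ν (fun y => t * w y + (t * s) * φ y) := (hw.smul ht).add (hφ.smul (by positivity))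
    have j1 := h.gw_int A hw
    have j2 := h.gw_int A hφ
    have : ∫ y, gi (f y) (t * (w y + s * φ y)) * (t * (w y + s * φ y)) ∂ν
        = t * ((∫ y, gi (f y) (t * w y + (t * s) * φ y) * w y ∂ν)
        + s * (∫ y, gi (f y) (t * w y + (t * s) * φ y) * φ y ∂ν)) := by
      rw [← integral_const_mul, ← integral_add j1 (j2.const_mul s), ← integral_const_mul]
      refine integral_congr_ae (Eventually.of_forall fun y => ?_)
      simp only
      rw [show t * (w y + s * φ y) = t * w y + (t * s) * φ y by ring]
      ring
    rw [this]; ring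
  have Nlim : ∀ a : ℝ, 0 < a → Tendsto (fun s => Nw ν G f (fun y => a * (w y + s * φ y)))
      (𝓝[>] 0) (𝓝 (a * ((∫ y, gi (f y) (a * w y) * w y ∂ν) - a * D))) := by
    intro a ha
    have c1 : ∀ ψ, Adm ν ψ → Tendsto (fun s => ∫ y, gi (f y) (a * w y + (a * s) * φ y) * ψ y ∂ν)
        (𝓝[>] 0) (𝓝 (∫ y, gi (f y) (a * w y) * ψ y ∂ν)) := by
      intro ψ hψ
      have h1 := h.gcontP hw hφ hψ (a, 0) ⟨ha.le, by simp⟩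
      have h2 : Tendsto (fun s : ℝ => ((a, a * s) : ℝ × ℝ)) (𝓝[>] 0)
          (𝓝[Set.Ici 0 ×ˢ Set.Ici 0] (a, 0)) := by
        refine tendsto_nhdsWithin_iff.2 ⟨?_, ?_⟩
        · have : Continuous (fun s : ℝ => ((a, a * s) : ℝ × ℝ)) := by fun_prop
          have := this.tendsto 0
          simp only [mul_zero] at this
          exact this.mono_left nhdsWithin_le_nhds
        · filter_upwards [self_mem_nhdsWithin] with s hs
          exact ⟨ha.le, mul_nonneg ha.le (le_of_lt hs)⟩
      have := h1.tendsto.comp h2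
      simpa [Function.comp_def] using this
    have c0 : Tendsto (fun s : ℝ => s) (𝓝[>] 0) (𝓝 0) := tendsto_id.mono_left nhdsWithin_le_nhds
    have big := (((c1 w hw).add (c0.mul (c1 φ hφ))).sub
      ((((tendsto_const_nhds (x := D)).add ((c0.const_mul 2).mul_const (Bf ν G φ w))).add
        ((c0.pow 2).mul_const (Bf ν G φ φ))).const_mul a)).const_mul a
    have e : a * ((∫ y, gi (f y) (a * w y) * w y ∂ν) - a * D) =
      a * ((∫ y, gi (f y) (a * w y) * w y ∂ν) + 0 * (∫ y, gi (f y) (a * w y) * φ y ∂ν)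
        - a * (D + 2 * 0 * Bf ν G φ w + 0 ^ 2 * Bf ν G φ φ)) := by ring
    rw [e]
    refine big.congr' ?_
    filter_upwards [self_mem_nhdsWithin] with s hs
    have hs' : (0:ℝ) < s := hs
    rcases Neq a s with h1 | h1 | h1
    · exact h1.symm
    · linarith
    · linarith
  have st1 := h.Nstrict hw hD (a := 1) (a' := 1 + η) one_pos (by linarith)
  have st2 := h.Nstrict hw hD (a := 1 - η) (a' := 1) (by linarith) (by linarith)
  simp only [one_mul, mul_one, hN'] at st1 st2
  have ev1 := (Nlim (1 + η) (by linarith)).eventually_lt_const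
    (show (1 + η) * ((∫ y, gi (f y) ((1 + η) * w y) * w y ∂ν) - (1 + η) * D) < 0 by nlinarith)
  have ev2 := (Nlim (1 - η) (by linarith)).eventually_const_lt
    (show 0 < (1 - η) * ((∫ y, gi (f y) ((1 - η) * w y) * w y ∂ν) - (1 - η) * D) by
      exact mul_pos (by linarith) (by linarith))
  filter_upwards [ev1, ev2, self_mem_nhdsWithin] with s h1 h2 hs
  have hs0 : (0:ℝ) < s := hs
  have hsA : Adm ν (fun y => w y + s * φ y) := hw.add (hφ.smul hs0.le)
  have cN := (h.Ncont hsA).mono (show Set.Icc (1 - η) (1 + η) ⊆ Set.Ici 0 from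
    fun t ht => by have := ht.1; simp only [Set.mem_Ici]; linarith)
  obtain ⟨t, ht, ht0⟩ := intermediate_value_Icc' (by linarith) cN ⟨h1.le, h2.le⟩
  have htp : 0 < t := by linarith [ht.1]
  simp only at ht0
  have htA := hsA.smul htp.le
  have htw := hw.smul htp.le
  -- t w_s is a maximum of the ray
  have hDφ := Bf_nn (ν := ν) h.ker.nn hφ hφ
  have hDφw := Bf_nn (ν := ν) h.ker.nn hφ hw
  have mem : Iw ν G f F (fun y => t * (w y + s * φ y)) ∈ lev ν G f F := by
    refine ⟨fun y => t * (w y + s * φ y), htA, ?_, fun τ hτ => ?_⟩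
    · have hne : 0 < ∫ y, w y ^ 2 ∂ν := by
        refine lt_of_le_of_ne (integral_nonneg fun y => sq_nonneg _) fun h0 => ?_
        have := (integral_eq_zero_iff_of_nonneg (fun y => sq_nonneg (w y)) hw.sq).1 h0.symm
        refine hw.int_pos hD ?_
        filter_upwards [this] with y hy
        simpa using hy
      calc 0 < t ^ 2 * ∫ y, w y ^ 2 ∂ν := by positivity
        _ = ∫ y, t ^ 2 * w y ^ 2 ∂ν := by rw [integral_const_mul]
        _ ≤ _ := by
          refine integral_mono (hw.sq.const_mul _) htA.sq fun y => ?_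
          simp only
          rw [mul_pow]
          refine mul_le_mul_of_nonneg_left (pow_le_pow_left₀ (hw.nn y) ?_ 2) (by positivity)
          have := mul_nonneg hs0.le (hφ.nn y)
          linarith
    · have := h.I_scale htA hτ
      rw [ht0, mul_zero, add_zero] at this
      exact this
  have low := csInf_le bddb mem
  have up := hI t htp.le
  have cmp := up.trans low
  unfold Iw at cmp
  rw [Bf_smul, Bf_smul, h.ker.expand hφ.meas hφ.sq hw.meas hw.sq] at cmp
  have jg := h.gw_int htA hφ
  have s1 : ∫ y, (Fs (f y) (F y) (t * (w y + s * φ y))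
      + (-(t * s)) * (gi (f y) (t * (w y + s * φ y)) * φ y)) ∂ν ≤ ∫ y, Fs (f y) (F y) (t * w y) ∂ν := by
    refine integral_mono (iadd (h.Fs_int htA) (jg.const_mul _)) (h.Fs_int htw) fun y => ?_
    have := (h.nl y).S1 (htA.nn y) (htw.nn y)
    simp only at this ⊢
    nlinarith
  rw [integral_add (h.Fs_int htA) (jg.const_mul _), integral_const_mul] at s1
  have s2 : t * Bf ν G φ w ≤ ∫ y, gi (f y) (t * (w y + s * φ y)) * φ y ∂ν := by
    have h6 : t * s * (t * Bf ν G φ w) ≤ t * s * ∫ y, gi (f y) (t * (w y + s * φ y)) * φ y ∂ν := by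
      have : 0 ≤ t ^ 2 * (s ^ 2 * Bf ν G φ φ) := by positivity
      nlinarith
    exact le_of_mul_le_mul_left h6 (by positivity)
  have s3 : ∫ y, gi (f y) (t * (w y + s * φ y)) * φ y ∂ν
      ≤ (1 + η) * ∫ y, gi (f y) (1 * w y + s * φ y) * φ y ∂ν := by
    rw [← integral_const_mul]
    have e : (fun y => 1 * w y + s * φ y) = fun y => w y + s * φ y := by funext y; ring
    refine integral_mono jg ((h.gw_int (w := fun y => 1 * w y + s * φ y) (by rw [e]; exact hsA) hφ).const_mul _) fun y => ?_
    simp only [one_mul]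
    have a1 := (h.nl y).gmono (mul_le_mul_of_nonneg_right ht.2 (hsA.nn y))
    have a2 := (h.nl y).gscale (hsA.nn y) (show 1 ≤ 1 + η by linarith)
    calc _ ≤ ((1 + η) * gi (f y) (w y + s * φ y)) * φ y :=
          mul_le_mul_of_nonneg_right (a1.trans a2) (hφ.nn y)
      _ = _ := by ring
  have s4 : (1 - η) * Bf ν G φ w ≤ t * Bf ν G φ w := mul_le_mul_of_nonneg_right ht.1 hDφw
  linarith

theorem Dat.EL2 (h : Dat ν G f F δ Q b C b' C' S) {w φ : Y → ℝ} (hw : Adm ν w)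
    (hD : 0 < Bf ν G w w)
    (hI : ∀ t, 0 ≤ t → Iw ν G f F (fun y => t * w y) ≤ sInf (lev ν G f F))
    (hN : Nw ν G f w = 0) (hφ : Adm ν φ) :
    Bf ν G φ w ≤ ∫ y, gi (f y) (w y) * φ y ∂ν := by
  have step : ∀ η : ℝ, 0 < η → η < 1 →
      (1 - η) * Bf ν G φ w ≤ (1 + η) * ∫ y, gi (f y) (w y) * φ y ∂ν := by
    intro η h0 h1
    have ev := h.EL1 hw hD hI hN hφ h0 h1
    have c1 : Tendsto (fun s : ℝ => ∫ y, gi (f y) (1 * w y + s * φ y) * φ y ∂ν) (𝓝[>] 0)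
        (𝓝 (∫ y, gi (f y) (w y) * φ y ∂ν)) := by
      have h1 := h.gcontP hw hφ hφ (1, 0) ⟨by simp, by simp⟩
      have h2 : Tendsto (fun s : ℝ => ((1, s) : ℝ × ℝ)) (𝓝[>] 0)
          (𝓝[Set.Ici 0 ×ˢ Set.Ici 0] (1, 0)) := by
        refine tendsto_nhdsWithin_iff.2 ⟨?_, ?_⟩
        · have : Continuous (fun s : ℝ => ((1, s) : ℝ × ℝ)) := by fun_prop
          exact (this.tendsto 0).mono_left nhdsWithin_le_nhds
        · filter_upwards [self_mem_nhdsWithin] with s hs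
          exact ⟨zero_le_one' ℝ, le_of_lt (show (0:ℝ) < s from hs)⟩
      have := h1.tendsto.comp h2
      simpa [Function.comp_def] using this
    exact ge_of_tendsto (c1.const_mul _) ev
  have l1 : Tendsto (fun η : ℝ => (1 - η) * Bf ν G φ w) (𝓝[>] 0) (𝓝 ((1 - 0) * Bf ν G φ w)) :=
    (((by fun_prop : Continuous fun η : ℝ => (1 - η) * Bf ν G φ w)).tendsto 0).mono_left
      nhdsWithin_le_nhds
  have l2 : Tendsto (fun η : ℝ => (1 + η) * ∫ y, gi (f y) (w y) * φ y ∂ν) (𝓝[>] 0)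
      (𝓝 ((1 + 0) * ∫ y, gi (f y) (w y) * φ y ∂ν)) :=
    (((by fun_prop : Continuous fun η : ℝ => (1 + η) * ∫ y, gi (f y) (w y) * φ y ∂ν)).tendsto
      0).mono_left nhdsWithin_le_nhds
  have := le_of_tendsto_of_tendsto l1 l2 (by
    filter_upwards [self_mem_nhdsWithin, mem_nhdsWithin_of_mem_nhds (Iio_mem_nhds one_pos)]
      with η h0 h1
    exact step η h0 h1)
  linarith

/-- Main abstract result. -/
theorem Dat.solve [MeasurableSpace.CountablyGenerated Y] (h : Dat ν G f F δ Q b C b' C' S)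
    {E : Set Y} (hE : MeasurableSet E) (hE0 : 0 < ν.real E) {Λ CΛ : ℝ} (hΛ : 0 < Λ)
    (hFΛ : ∀ y ∈ E, ∀ s, 0 ≤ s → Λ * s ^ 2 / 2 - CΛ ≤ F y s)
    (hDE : ν.real E ≤ Λ * Bf ν G (E.indicator fun _ => 1) (E.indicator fun _ => 1)) :
    ∃ w, Adm ν w ∧ 0 < Bf ν G w w ∧ (∀ᵐ x ∂ν, w x = f x (∫ y, G x y * w y ∂ν)) ∧
      (∀ᵐ x ∂ν, Integrable (fun y => G x y * w y) ν) ∧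
      Integrable (fun x => f x (gi (f x) (w x)) * gi (f x) (w x) / 2 - F x (gi (f x) (w x))) ν ∧
      ∫ x, (f x (gi (f x) (w x)) * gi (f x) (w x) / 2 - F x (gi (f x) (w x))) ∂ν ≤ CΛ * ν.real E ∧
      (∀ᵐ x ∂ν, gi (f x) (w x) = ∫ y, G x y * w y ∂ν) := by
  set e : Y → ℝ := E.indicator fun _ => 1 with he
  have eA : Adm ν e := by
    refine ⟨measurable_const.indicator hE, fun y => Set.indicator_nonneg (fun _ _ => zero_le_one) _, ?_⟩
    have : (fun y => e y ^ 2) = e := by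
      funext y; by_cases hy : y ∈ E <;> simp [he, hy]
    rw [this]
    exact (integrable_const 1).indicator hE
  have ie : ∀ a : ℝ, ∫ y, a * e y ∂ν = a * ν.real E := by
    intro a
    rw [integral_const_mul, he, integral_indicator_const _ hE]
    simp
  have lmem : CΛ * ν.real E ∈ lev ν G f F := by
    refine ⟨e, eA, ?_, fun t ht => ?_⟩
    · have : (fun y => e y ^ 2) = fun y => 1 * e y := by
        funext y; by_cases hy : y ∈ E <;> simp [he, hy]
      rw [this, ie]; simpa using hE0
    · unfold Iw
      rw [Bf_smul]
      have hte := eA.smul ht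
      have : ∫ y, Fs (f y) (F y) (t * e y) ∂ν ≤ ∫ y, (t ^ 2 / (2 * Λ) + CΛ) * e y ∂ν := by
        refine integral_mono (h.Fs_int hte) ((int1 eA.meas eA.sq).const_mul _) fun y => ?_
        by_cases hy : y ∈ E
        · simp only [he, Set.indicator_of_mem hy, mul_one]
          have h1 := hFΛ y hy _ ((h.nl y).gnn t)
          unfold Fs
          set s := gi (f y) t
          have h2 : t * s ≤ t ^ 2 / (2 * Λ) + Λ * s ^ 2 / 2 := by
            have : t ^ 2 / (2 * Λ) + Λ * s ^ 2 / 2 - t * s = (t - Λ * s) ^ 2 / (2 * Λ) := by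
              field_simp; ring
            have h3 : 0 ≤ (t - Λ * s) ^ 2 / (2 * Λ) := by positivity
            linarith
          linarith
        · simp only [he, Set.indicator_of_notMem hy, mul_zero]
          have := (h.nl y).Fs_le (x := 0)
          simpa using this
      rw [ie] at this
      have h4 : t ^ 2 / (2 * Λ) * ν.real E ≤ t ^ 2 / (2 * Λ) * (Λ * Bf ν G e e) :=
        mul_le_mul_of_nonneg_left hDE (by positivity)
      have h5 : t ^ 2 / (2 * Λ) * (Λ * Bf ν G e e) = t ^ 2 * Bf ν G e e / 2 := by
        field_simp
      simp only at this ⊢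
      nlinarith
  have bddb : BddBelow (lev ν G f F) := ⟨0, fun _ hx => h.lev_nn hx⟩
  obtain ⟨w0, hw0, hD0, hI0⟩ := h.exists_min ⟨_, lmem⟩
  obtain ⟨t0, ht0, hN0⟩ := h.exists_nehari hw0 hD0 hI0
  set w : Y → ℝ := fun y => t0 * w0 y with hwd
  have hw : Adm ν w := hw0.smul ht0.le
  have hD : 0 < Bf ν G w w := by rw [hwd, Bf_smul]; positivity
  have hI : ∀ t, 0 ≤ t → Iw ν G f F (fun y => t * w y) ≤ sInf (lev ν G f F) := by
    intro t ht
    have := hI0 (t * t0) (by positivity)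
    simpa [hwd, mul_assoc] using this
  have hprodint := h.ker.intg (φ := fun _ => 1) measurable_const (integrable_const _) hw.meas hw.sq
  have hGint : ∀ᵐ x ∂ν, Integrable (fun y => G x y * w y) ν := by
    have := hprodint.prod_right_ae
    filter_upwards [this] with x hx
    simpa using hx
  have hTint : Integrable (fun x => ∫ y, G x y * w y ∂ν) ν := by
    have := hprodint.integral_prod_left
    simpa using this
  have gint : Integrable (fun y => gi (f y) (w y)) ν := int1 (h.gmeas hw.meas) (h.gsq hw)
  have le1 : (fun x => ∫ y, G x y * w y ∂ν) ≤ᵐ[ν] fun y => gi (f y) (w y) := by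
    refine ae_le_of_forall_setIntegral_le hTint gint fun s hs _ => ?_
    have sA : Adm ν (s.indicator fun _ => 1) := by
      refine ⟨measurable_const.indicator hs, fun y => Set.indicator_nonneg (fun _ _ => zero_le_one) _, ?_⟩
      have : (fun y => (s.indicator (fun _ => (1:ℝ)) y) ^ 2) = s.indicator fun _ => 1 := by
        funext y; by_cases hy : y ∈ s <;> simp [hy]
      rw [this]
      exact (integrable_const 1).indicator hs
    have := h.EL2 hw hD hI hN0 sA
    rw [h.ker.iter sA.meas sA.sq hw.meas hw.sq] at this
    rw [← integral_indicator hs, ← integral_indicator hs]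
    convert this using 2
    · funext y; by_cases hy : y ∈ s <;> simp [hy]
    · funext y; by_cases hy : y ∈ s <;> simp [hy]
  have Tm : Measurable (fun x => ∫ y, G x y * w y ∂ν) := by
    have : StronglyMeasurable (fun z : Y × Y => G z.1 z.2 * w z.2) :=
      (h.ker.meas.mul (hw.meas.comp measurable_snd)).stronglyMeasurable
    exact this.integral_prod_right.measurable
  have Tnn : ∀ x, 0 ≤ ∫ y, G x y * w y ∂ν := fun x =>
    integral_nonneg fun y => mul_nonneg (h.ker.nn _ _) (hw.nn y)
  have iwg := h.gw_int hw hw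
  have iwT : Integrable (fun x => w x * ∫ y, G x y * w y ∂ν) ν := by
    refine Integrable.mono' iwg (hw.meas.mul Tm).aestronglyMeasurable ?_
    filter_upwards [le1] with x hx
    rw [norm_mul, Real.norm_eq_abs, Real.norm_eq_abs, abs_of_nonneg (hw.nn x), abs_of_nonneg (Tnn x),
      mul_comm]
    exact mul_le_mul_of_nonneg_right hx (hw.nn x)
  have zero : ∫ x, (gi (f x) (w x) * w x - w x * ∫ y, G x y * w y ∂ν) ∂ν = 0 := by
    rw [integral_sub iwg iwT, ← h.ker.iter hw.meas hw.sq hw.meas hw.sq]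
    exact hN0
  have nn : 0 ≤ᵐ[ν] fun x => (gi (f x) (w x) * w x - w x * ∫ y, G x y * w y ∂ν) := by
    filter_upwards [le1] with x hx
    have := mul_le_mul_of_nonneg_left hx (hw.nn x)
    simp only [Pi.zero_apply] at this ⊢
    linarith
  have z2 := (integral_eq_zero_iff_of_nonneg_ae nn (isub iwg iwT)).1 zero
  have eq : ∀ᵐ x ∂ν, gi (f x) (w x) = ∫ y, G x y * w y ∂ν := by
    filter_upwards [z2, le1] with x hx hx2
    rcases (hw.nn x).eq_or_lt with h0 | h0
    · rw [← h0, (h.nl x).g0] at hx2 ⊢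
      exact le_antisymm (Tnn x) hx2
    · simp only [Pi.zero_apply] at hx
      have : w x * (gi (f x) (w x) - ∫ y, G x y * w y ∂ν) = 0 := by rw [← hx]; ring
      rcases mul_eq_zero.1 this with h1 | h1
      · linarith
      · linarith
  have hfin : (fun x => f x (gi (f x) (w x)) * gi (f x) (w x) / 2 - F x (gi (f x) (w x)))
      = fun x => Fs (f x) (F x) (w x) - gi (f x) (w x) * w x / 2 := by
    funext x
    rw [(h.nl x).fg (hw.nn x)]
    unfold Fs; ring
  refine ⟨w, hw, hD, ?_, hGint, ?_, ?_, eq⟩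
  · filter_upwards [eq] with x hx
    rw [← hx, (h.nl x).fg (hw.nn x)]
  · rw [hfin]; exact isub (h.Fs_int hw) (iwg.div_const 2)
  · rw [hfin, integral_sub (h.Fs_int hw) (iwg.div_const 2), integral_div]
    have h1 := hI 1 zero_le_one
    simp only [one_mul] at h1
    have h2 := csInf_le bddb lmem
    have h3 : ∫ y, gi (f y) (w y) * w y ∂ν = Bf ν G w w := by
      have : Nw ν G f w = 0 := hN0
      unfold Nw at this; linarith
    unfold Iw at h1
    rw [h3]
    exact h1.trans h2

end Ham

namespace Ham

/-- truncated power with linear extension -/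
def Tp (r M s : ℝ) : ℝ := if s ≤ M then s ^ r else M ^ r + r * M ^ (r - 1) * (s - M)

/-- primitive -/
def TF (r M s : ℝ) : ℝ := ∫ τ in (0:ℝ)..s, Tp r M τ

section
variable {r M : ℝ}

theorem Tp_cont (hr : 1 < r) : Continuous (Tp r M) := by
  unfold Tp
  refine Continuous.if_le (Real.continuous_rpow_const (by linarith)) (by fun_prop) continuous_id
    continuous_const ?_
  intro x hx; rw [show x = M from hx]; simp

theorem Tp_zero (hr : 1 < r) (hM : 1 ≤ M) : Tp r M 0 = 0 := by
  unfold Tp; rw [if_pos (by linarith), Real.zero_rpow (by linarith)]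

theorem Tp_of_le {s : ℝ} (h : s ≤ M) : Tp r M s = s ^ r := if_pos h

/-- quotient `Tp / s`. -/
def psi (r M s : ℝ) : ℝ := if s ≤ M then s ^ (r - 1) else r * M ^ (r - 1) - (r - 1) * M ^ r / s

theorem Tp_psi (hM : 1 ≤ M) {s : ℝ} (hs : 0 < s) : Tp r M s = s * psi r M s := by
  unfold Tp psi
  split_ifs with h
  · rw [Real.rpow_sub_one (ne_of_gt hs)]; field_simp
  · have e : M ^ r = M * M ^ (r - 1) := by
      rw [Real.rpow_sub_one (by linarith)]; field_simp
    rw [e]; field_simp; ring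


theorem psi_pos (hr : 1 < r) (hM : 1 ≤ M) {s : ℝ} (hs : 0 < s) : 0 < psi r M s := by
  unfold psi
  split_ifs with h
  · positivity
  · push Not at h
    have hM0 : 0 < M := by linarith
    have e : M ^ r = M * M ^ (r - 1) := by
      rw [Real.rpow_sub_one (by linarith)]; field_simp
    have h1 : M / s < 1 := (div_lt_one hs).2 h
    have h2 : 0 < M ^ (r - 1) := by positivity
    have : r * M ^ (r - 1) - (r - 1) * M ^ r / s = M ^ (r - 1) * (r - (r - 1) * (M / s)) := by
      rw [e]; ring
    rw [this]
    refine mul_pos h2 ?_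
    nlinarith

theorem psi_strict (hr : 1 < r) (hM : 1 ≤ M) {s s' : ℝ} (hs : 0 < s) (h : s < s') :
    psi r M s < psi r M s' := by
  have hM0 : 0 < M := by linarith
  have e : M ^ r = M * M ^ (r - 1) := by
    rw [Real.rpow_sub_one (by linarith)]; field_simp
  have h2 : 0 < M ^ (r - 1) := by positivity
  have c1 : ∀ a b : ℝ, 0 < a → a < b → b ≤ M → psi r M a < psi r M b := by
    intro a b ha hab hb
    unfold psi
    rw [if_pos (hab.le.trans hb), if_pos hb]
    exact Real.rpow_lt_rpow ha.le hab (by linarith)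
  have c2 : ∀ a b : ℝ, M ≤ a → a < b → psi r M a < psi r M b := by
    intro a b ha hab
    have va : psi r M a = r * M ^ (r - 1) - (r - 1) * M ^ r / a := by
      unfold psi
      split_ifs with h
      · have : a = M := le_antisymm h ha
        rw [this, e]; field_simp; ring
      · rfl
    have vb : psi r M b = r * M ^ (r - 1) - (r - 1) * M ^ r / b := by
      unfold psi; rw [if_neg (by linarith)]
    rw [va, vb]
    have : (r - 1) * M ^ r / b < (r - 1) * M ^ r / a := by
      refine div_lt_div_of_pos_left ?_ (by linarith) hab
      have : 0 < M ^ r := by positivity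
      nlinarith
    linarith
  rcases le_or_gt s' M with h1 | h1
  · exact c1 s s' hs h h1
  · rcases le_or_gt M s with h3 | h3
    · exact c2 s s' h3 h
    · exact (c1 s M hs h3 le_rfl).trans (c2 M s' le_rfl h1)

theorem Tp_pos (hr : 1 < r) (hM : 1 ≤ M) {s : ℝ} (hs : 0 < s) : 0 < Tp r M s := by
  rw [Tp_psi hM hs]; exact mul_pos hs (psi_pos hr hM hs)

theorem Tp_nn (hr : 1 < r) (hM : 1 ≤ M) {s : ℝ} (hs : 0 ≤ s) : 0 ≤ Tp r M s := by
  rcases hs.eq_or_lt with rfl | hs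
  · rw [Tp_zero hr hM]
  · exact (Tp_pos hr hM hs).le

theorem Tp_strict (hr : 1 < r) (hM : 1 ≤ M) {s s' : ℝ} (hs : 0 < s) (h : s < s') :
    Tp r M s * s' < Tp r M s' * s := by
  rw [Tp_psi hM hs, Tp_psi hM (hs.trans h)]
  have := psi_strict hr hM hs h
  have : 0 < s * s' := mul_pos hs (hs.trans h)
  nlinarith

theorem Tp_wk (hr : 1 < r) (hM : 1 ≤ M) {s s' : ℝ} (hs : 0 ≤ s) (h : s ≤ s') :
    Tp r M s * s' ≤ Tp r M s' * s := by
  rcases hs.eq_or_lt with rfl | hs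
  · rw [Tp_zero hr hM]; simp
  rcases h.eq_or_lt with rfl | h
  · exact le_rfl
  · exact (Tp_strict hr hM hs h).le

theorem Tp_le_min (hr : 1 < r) (hM : 1 ≤ M) {s : ℝ} (hs : 0 ≤ s) :
    Tp r M s ≤ r * (min s M) ^ (r - 1) * s := by
  rcases hs.eq_or_lt with rfl | hs
  · rw [Tp_zero hr hM]; simp
  have hM0 : 0 < M := by linarith
  rw [Tp_psi hM hs, mul_comm]
  refine mul_le_mul_of_nonneg_right ?_ hs.le
  unfold psi
  split_ifs with h
  · rw [min_eq_left h]
    have : 0 ≤ s ^ (r - 1) := by positivity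
    nlinarith
  · rw [min_eq_right (by linarith)]
    have : 0 < M ^ r := by positivity
    have : 0 ≤ (r - 1) * M ^ r / s := div_nonneg (by nlinarith) hs.le
    linarith

theorem Tp_Q (hr : 1 < r) (hM : 1 ≤ M) {s : ℝ} (hs : 0 ≤ s) :
    Tp r M s ≤ r * M ^ (r - 1) * s := by
  refine (Tp_le_min hr hM hs).trans ?_
  have : (min s M) ^ (r - 1) ≤ M ^ (r - 1) :=
    Real.rpow_le_rpow (le_min hs (by linarith)) (min_le_right _ _) (by linarith)
  gcongr

theorem Tp_lin (hr : 1 < r) (hM : 1 ≤ M) {s : ℝ} (hs : 0 ≤ s) : 1 * s - 1 ≤ Tp r M s := by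
  rcases le_or_gt s 1 with h | h
  · have := Tp_nn hr hM hs
    linarith
  · have h1 := Tp_wk hr hM zero_le_one h.le
    rw [Tp_of_le hM, Real.one_rpow] at h1
    linarith

theorem TF_zero : TF r M 0 = 0 := by simp [TF]

theorem Tp_ii (hr : 1 < r) (a b : ℝ) : IntervalIntegrable (Tp r M) volume a b :=
  (Tp_cont hr).intervalIntegrable a b

theorem TF_sub (hr : 1 < r) (a b : ℝ) : TF r M b - TF r M a = ∫ τ in a..b, Tp r M τ := by
  unfold TF
  rw [intervalIntegral.integral_interval_sub_left (Tp_ii hr _ _) (Tp_ii hr _ _)]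

theorem TF_nn (hr : 1 < r) (hM : 1 ≤ M) {s : ℝ} (hs : 0 ≤ s) : 0 ≤ TF r M s :=
  intervalIntegral.integral_nonneg hs fun τ hτ => Tp_nn hr hM hτ.1

theorem TF_b (hr : 1 < r) (hM : 1 ≤ M) {s s' : ℝ} (hs : 0 ≤ s) (hs' : 0 ≤ s') :
    Tp r M s * (s' ^ 2 - s ^ 2) ≤ 2 * s * (TF r M s' - TF r M s) := by
  have hc := Tp_cont (M := M) hr
  have e1 : ∀ a b : ℝ, ∫ τ in a..b, (s * Tp r M τ - Tp r M s * τ)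
      = s * (TF r M b - TF r M a) - Tp r M s * ((b ^ 2 - a ^ 2) / 2) := by
    intro a b
    rw [TF_sub hr, intervalIntegral.integral_sub ((Tp_ii hr _ _).const_mul _)
      ((by fun_prop : Continuous fun τ : ℝ => Tp r M s * τ).intervalIntegrable _ _),
      intervalIntegral.integral_const_mul, intervalIntegral.integral_const_mul, integral_id]
  rcases le_total s s' with h | h
  · have : 0 ≤ ∫ τ in s..s', (s * Tp r M τ - Tp r M s * τ) :=
      intervalIntegral.integral_nonneg h fun τ hτ => by
        have := Tp_wk hr hM hs hτ.1
        linarith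
    rw [e1] at this
    linarith
  · have : ∫ τ in s'..s, (s * Tp r M τ - Tp r M s * τ) ≤ 0 := by
      have h0 : 0 ≤ ∫ τ in s'..s, -(s * Tp r M τ - Tp r M s * τ) :=
        intervalIntegral.integral_nonneg h fun τ hτ => by
          have := Tp_wk hr hM (hs'.trans hτ.1) hτ.2
          linarith
      rw [intervalIntegral.integral_neg] at h0
      linarith
    rw [e1] at this
    linarith

theorem TF_of_le (hr : 1 < r) (hM : 1 ≤ M) {s : ℝ} (hs : 0 ≤ s) (h : s ≤ M) :
    TF r M s = s ^ (r + 1) / (r + 1) := by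
  unfold TF
  have : ∫ τ in (0:ℝ)..s, Tp r M τ = ∫ τ in (0:ℝ)..s, τ ^ r := by
    refine intervalIntegral.integral_congr fun τ hτ => ?_
    rw [Set.uIcc_of_le hs] at hτ
    exact Tp_of_le (hτ.2.trans h)
  rw [this, integral_rpow (Or.inl (by linarith)), Real.zero_rpow (by linarith), sub_zero]

theorem TF_of_ge (hr : 1 < r) (hM : 1 ≤ M) {s : ℝ} (h : M ≤ s) :
    TF r M s = M ^ (r + 1) / (r + 1) + M ^ r * (s - M) + r * M ^ (r - 1) * (s - M) ^ 2 / 2 := by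
  have e := TF_sub (M := M) hr M s
  rw [TF_of_le hr hM (by linarith) le_rfl] at e
  have : ∫ τ in M..s, Tp r M τ = ∫ τ in M..s, (M ^ r + r * M ^ (r - 1) * (τ - M)) := by
    refine intervalIntegral.integral_congr fun τ hτ => ?_
    rw [Set.uIcc_of_le h] at hτ
    rcases hτ.1.eq_or_lt with h1 | h1
    · rw [← h1]; simp [Tp]
    · simp only [Tp]; rw [if_neg (by linarith)]
  rw [this, intervalIntegral.integral_add (by simp) ((by fun_prop : Continuous fun τ : ℝ =>
    r * M ^ (r - 1) * (τ - M)).intervalIntegrable _ _), intervalIntegral.integral_const_mul,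
    intervalIntegral.integral_sub (by simp) (by simp), integral_id] at e
  simp only [intervalIntegral.integral_const, smul_eq_mul] at e
  linarith

theorem TH_le (hr : 1 < r) (hM : 1 ≤ M) {s : ℝ} (hs : 0 ≤ s) (h : s ≤ M) :
    Tp r M s * s / 2 - TF r M s = (1 / 2 - 1 / (r + 1)) * s ^ (r + 1) := by
  rw [TF_of_le hr hM hs h, Tp_of_le h]
  rcases hs.eq_or_lt with rfl | hs
  · rw [Real.zero_rpow (by linarith), Real.zero_rpow (by linarith)]; simp
  · rw [Real.rpow_add_one (ne_of_gt hs)]; ring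

theorem TH_ge (hr : 1 < r) (hM : 1 ≤ M) {s : ℝ} (h : M ≤ s) :
    Tp r M s * s / 2 - TF r M s
      = (1 / 2 - 1 / (r + 1)) * M ^ (r + 1) + (r - 1) / 2 * M ^ r * (s - M) := by
  have hM0 : M ≠ 0 := by linarith
  have e1 : Tp r M s = M ^ r + r * M ^ (r - 1) * (s - M) := by
    rcases h.eq_or_lt with rfl | h
    · simp [Tp]
    · unfold Tp; rw [if_neg (by linarith)]
  rw [TF_of_ge hr hM h, e1, Real.rpow_add_one hM0]
  have e : M ^ r = M * M ^ (r - 1) := by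
    rw [Real.rpow_sub_one (by linarith)]; field_simp
  rw [e]; ring

theorem TH_low (hr : 1 < r) (hM : 1 ≤ M) {s : ℝ} (hs : 0 ≤ s) :
    (1 / 2 - 1 / (r + 1)) * (min s M) ^ (r + 1) ≤ Tp r M s * s / 2 - TF r M s := by
  rcases le_total s M with h | h
  · rw [min_eq_left h, TH_le hr hM hs h]
  · rw [min_eq_right h, TH_ge hr hM h]
    have : 0 ≤ (r - 1) / 2 * M ^ r * (s - M) := by
      have : 0 ≤ M ^ r := by positivity
      have : 0 ≤ s - M := by linarith
      have : 0 ≤ r - 1 := by linarith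
      positivity
    linarith

theorem TH_nn (hr : 1 < r) (hM : 1 ≤ M) {s : ℝ} (hs : 0 ≤ s) :
    0 ≤ Tp r M s * s / 2 - TF r M s := by
  refine le_trans ?_ (TH_low hr hM hs)
  have : 0 ≤ min s M := le_min hs (by linarith)
  have h2 : 1 / (r + 1) ≤ 1 / 2 := by
    apply one_div_le_one_div_of_le <;> linarith
  have : 0 ≤ (min s M) ^ (r + 1) := by positivity
  exact mul_nonneg (by linarith) this

theorem TH_lin (hr : 1 < r) (hM : 1 ≤ M) {s β : ℝ} (hs : 0 ≤ s) (hβ : 0 < β) (hβr : β ≤ r - 1) :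
    β / 2 * s - β / 2 * M ≤ Tp r M s * s / 2 - TF r M s := by
  rcases le_total s M with h | h
  · have := TH_nn hr hM hs
    nlinarith
  · rw [TH_ge hr hM h]
    have h2 : 1 / (r + 1) ≤ 1 / 2 := by
      apply one_div_le_one_div_of_le <;> linarith
    have h3 : 0 ≤ M ^ (r + 1) := by positivity
    have h4 : 1 ≤ M ^ r := Real.one_le_rpow hM (by linarith)
    have h5 : 0 ≤ (1 / 2 - 1 / (r + 1)) * M ^ (r + 1) := mul_nonneg (by linarith) h3
    have h6 : β / 2 * (s - M) ≤ (r - 1) / 2 * M ^ r * (s - M) := by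
      refine mul_le_mul_of_nonneg_right ?_ (by linarith)
      nlinarith
    linarith

theorem TF_cont (hr : 1 < r) : Continuous (TF r M) :=
  intervalIntegral.continuous_primitive (fun a b => Tp_ii hr a b) 0

theorem Tp_small (hr : 1 < r) (hM : 1 ≤ M) {s γ : ℝ} (hs : 0 ≤ s) (h1 : s ≤ 1) (hγ : γ ≤ r - 1)
    (hγ0 : 0 < γ) : Tp r M s ≤ s ^ γ * s := by
  rw [Tp_of_le (h1.trans hM)]
  rcases hs.eq_or_lt with rfl | hs
  · rw [Real.zero_rpow (by linarith)]; simp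
  · rw [← Real.rpow_add_one (ne_of_gt hs)]
    exact Real.rpow_le_rpow_of_exponent_ge hs h1 (by linarith)

/-- the smallness threshold -/
def dl (γ A : ℝ) : ℝ := min 1 ((2 * A) ^ (-(1 / γ)))

/-- Nonlinearity `T_{r} + β T_q`. -/
theorem NL_sum {q β γ : ℝ} (hr : 1 < r) (hq : 1 < q) (hM : 1 ≤ M) (hβ : 0 ≤ β) (hβ1 : β ≤ 1)
    (hγ : 0 < γ) (hγr : γ ≤ r - 1) (hγq : γ ≤ q - 1) {Q : ℝ} (hQ0 : 0 < Q)
    (hQ : r * M ^ (r - 1) + q * M ^ (q - 1) ≤ Q) :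
    NL (fun s => Tp r M s + β * Tp q M s) (fun s => TF r M s + β * TF q M s) (dl γ) Q 1 1
      (γ / 2) (γ / 2 * M) where
  f0 := by simp [Tp_zero hr hM, Tp_zero hq hM]
  F0 := fun s hs => by
    have := TF_nn hr hM hs
    have := TF_nn hq hM hs
    positivity
  cont := ((Tp_cont hr).add ((Tp_cont hq).const_mul β)).continuousOn
  pos := fun s hs => by
    have := Tp_pos hr hM hs
    have := Tp_pos hq hM hs
    positivity
  strict := fun s s' hs h => by
    have h1 := Tp_strict hr hM hs h
    have h2 := mul_le_mul_of_nonneg_left (Tp_strict hq hM hs h).le hβ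
    nlinarith
  Fb := fun s s' hs hs' => by
    have h1 := TF_b hr hM hs hs'
    have h2 := mul_le_mul_of_nonneg_left (TF_b hq hM hs hs') hβ
    nlinarith
  F00 := by simp [TF_zero]
  Q0 := hQ0
  fQ := fun s hs => by
    have h1 := Tp_Q hr hM hs
    have h2 := mul_le_mul hβ1 (Tp_Q hq hM hs) (Tp_nn hq hM hs) zero_le_one
    have h3 := mul_le_mul_of_nonneg_right hQ hs
    nlinarith
  δ0 := fun A hA => lt_min one_pos (by positivity)
  sm := fun A s hA hs hs' => by
    have h1 : s ≤ 1 := hs'.trans (min_le_left _ _)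
    have h2 : s ≤ (2 * A) ^ (-(1 / γ)) := hs'.trans (min_le_right _ _)
    have h3 : s ^ γ ≤ (2 * A)⁻¹ := by
      calc s ^ γ ≤ ((2 * A) ^ (-(1 / γ))) ^ γ := Real.rpow_le_rpow hs h2 hγ.le
        _ = (2 * A)⁻¹ := by
          rw [← Real.rpow_mul (by positivity), ← Real.rpow_neg_one]
          congr 1; field_simp
    have a1 := Tp_small hr hM hs h1 hγr hγ
    have a2 := Tp_small hq hM hs h1 hγq hγ
    have a3 : β * Tp q M s ≤ 1 * (s ^ γ * s) :=
      mul_le_mul hβ1 a2 (Tp_nn hq hM hs) zero_le_one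
    have a4 : s ^ γ * s ≤ (2 * A)⁻¹ * s := mul_le_mul_of_nonneg_right h3 hs
    calc A * (Tp r M s + β * Tp q M s) ≤ A * (2 * ((2 * A)⁻¹ * s)) :=
          mul_le_mul_of_nonneg_left (by linarith) hA.le
      _ = s := by field_simp
  b0 := one_pos
  C0 := zero_le_one
  lin := fun s hs => by
    have h1 := Tp_lin hr hM hs
    have h2 := mul_nonneg hβ (Tp_nn hq hM hs)
    linarith
  b0' := by positivity
  lin' := fun s hs => by
    have h1 := TH_lin hr hM hs hγ hγr
    have h2 := mul_nonneg hβ (TH_nn hq hM hs)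
    nlinarith

end
end Ham

namespace Ham

abbrev E3 := Euc 3
abbrev E2 := Euc 2

/-- embedding of the plane -/
def io (y : E2) : E3 := !₂[y 0, y 1, 0]

/-- reflection -/
def rho : E3 ≃ₗᵢ[ℝ] E3 :=
  LinearIsometryEquiv.piLpCongrRight 2 fun i : Fin 3 =>
    if i = 2 then LinearIsometryEquiv.neg ℝ else LinearIsometryEquiv.refl ℝ ℝ

theorem rho0 (y : E3) : rho y 0 = y 0 := by simp [rho]
theorem rho1 (y : E3) : rho y 1 = y 1 := by simp [rho]
theorem rho2 (y : E3) : rho y 2 = - y 2 := by simp [rho]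

theorem rho_rho (y : E3) : rho (rho y) = y := by
  ext i; fin_cases i
  · simp [rho0]
  · simp [rho1]
  · simp [rho2]

theorem io_m : Continuous io := by
  unfold io
  fun_prop

theorem rho_io (y : E2) : rho (io y) = io y := by
  ext i; fin_cases i
  · simp [rho0]
  · simp [rho1]
  · simp [rho2, io]

theorem io_norm (y : E2) : ‖io y‖ = ‖y‖ := by
  rw [EuclideanSpace.norm_eq, EuclideanSpace.norm_eq]
  simp [io, Fin.sum_univ_three]

/-- horizontal part -/
def hz (x : E3) : E2 := !₂[x 0, x 1]

theorem io_sub_sq (y : E2) (x : E3) : ‖io y - x‖ ^ 2 = ‖y - hz x‖ ^ 2 + x 2 ^ 2 := by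
  rw [EuclideanSpace.norm_sq_eq, EuclideanSpace.norm_sq_eq]
  simp [io, hz, Fin.sum_univ_three]

def aa (r : ℝ) : ℝ := √(1 + r ^ 2)

theorem aa_sq (r : ℝ) : aa r ^ 2 = 1 + r ^ 2 := Real.sq_sqrt (by positivity)
theorem aa_ge (r : ℝ) : 1 ≤ aa r := Real.one_le_sqrt.2 (by nlinarith)
theorem aa_pos (r : ℝ) : 0 < aa r := by linarith [aa_ge r]
theorem aa_cont : Continuous aa := by unfold aa; fun_prop

def xi (r : ℝ) (x y : E3) : E3 := r⁻¹ • (y - aa r • x)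

theorem xi_sq (r : ℝ) (x y : E3) :
    ‖xi r x y‖ ^ 2 = (r⁻¹) ^ 2 * (‖y‖ ^ 2 - 2 * aa r * inner ℝ x y + (1 + r ^ 2) * ‖x‖ ^ 2) := by
  rw [xi, norm_smul, mul_pow, norm_sub_sq_real, inner_smul_right, real_inner_comm, norm_smul, mul_pow,
    Real.norm_eq_abs, Real.norm_eq_abs, sq_abs, sq_abs, aa_sq]
  ring

theorem xi_rot {r : ℝ} (hr : 0 < r) (x y : E3) :
    ‖xi r x y‖ ^ 2 + ‖y‖ ^ 2 = ‖x‖ ^ 2 + ‖xi r y x‖ ^ 2 := by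
  rw [xi_sq, xi_sq, real_inner_comm]
  field_simp
  ring

def P (r : ℝ) (x y : E3) : ℝ := r⁻¹ ^ 3 * exp (-(‖xi r x y‖ ^ 2 / 4))

def kv (r : ℝ) (x y : E3) : ℝ := r⁻¹ ^ 3 * exp (-((‖xi r x y‖ ^ 2 + ‖xi r y x‖ ^ 2) / 8))

theorem kv_symm (r : ℝ) (x y : E3) : kv r x y = kv r y x := by
  unfold kv; rw [add_comm]

theorem kv_P {r : ℝ} (hr : 0 < r) (x y : E3) :
    kv r x y = exp (‖x‖ ^ 2 / 8) * P r x y * exp (-(‖y‖ ^ 2 / 8)) := by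
  unfold kv P
  have := xi_rot hr x y
  rw [show exp (‖x‖ ^ 2 / 8) * (r⁻¹ ^ 3 * exp (-(‖xi r x y‖ ^ 2 / 4))) * exp (-(‖y‖ ^ 2 / 8))
    = r⁻¹ ^ 3 * (exp (‖x‖ ^ 2 / 8) * exp (-(‖xi r x y‖ ^ 2 / 4)) * exp (-(‖y‖ ^ 2 / 8))) by ring,
    ← exp_add, ← exp_add]
  congr 2
  linarith

theorem kv_nn {r : ℝ} (hr : 0 < r) (x y : E3) : 0 ≤ kv r x y := by unfold kv; positivity
theorem kv_pos {r : ℝ} (hr : 0 < r) (x y : E3) : 0 < kv r x y := by unfold kv; positivity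

theorem kv_le {r : ℝ} (hr : 0 < r) (x y : E3) : kv r x y ≤ r⁻¹ ^ 3 := by
  unfold kv
  have : exp (-((‖xi r x y‖ ^ 2 + ‖xi r y x‖ ^ 2) / 8)) ≤ 1 := exp_le_one_iff.2 (by
    have := sq_nonneg ‖xi r x y‖
    have := sq_nonneg ‖xi r y x‖
    linarith)
  have h3 : 0 ≤ r⁻¹ ^ 3 := by positivity
  nlinarith

theorem kv_gauss {r : ℝ} (hr : 0 < r) (x y : E3) :
    kv r x y ≤ r⁻¹ ^ 3 * exp (-(r⁻¹ ^ 2 / 4) * ‖y - x‖ ^ 2) := by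
  unfold kv
  refine mul_le_mul_of_nonneg_left (exp_le_exp.2 ?_) (by positivity)
  have h0 : 0 ≤ (aa r - 1) * ((aa r + 1) * (‖x‖ ^ 2 + ‖y‖ ^ 2) - 4 * inner ℝ x y) := by
    have h1 := aa_ge r
    have h2 := real_inner_le_norm x y
    refine mul_nonneg (by linarith) ?_
    nlinarith [sq_nonneg (‖x‖ - ‖y‖), sq_nonneg ‖x‖, sq_nonneg ‖y‖]
  have h3 := aa_sq r
  rw [xi_sq, xi_sq, norm_sub_sq_real, real_inner_comm x y]
  have : 0 ≤ r⁻¹ ^ 2 * ((aa r - 1) * ((aa r + 1) * (‖x‖ ^ 2 + ‖y‖ ^ 2) - 4 * inner ℝ x y)) :=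
    mul_nonneg (by positivity) h0
  have h4 : (aa r - 1) * ((aa r + 1) * (‖x‖ ^ 2 + ‖y‖ ^ 2) - 4 * inner ℝ x y)
      = (1 + r ^ 2 - 1) * (‖x‖ ^ 2 + ‖y‖ ^ 2) - 4 * (aa r - 1) * inner ℝ x y := by
    rw [← h3]; ring
  rw [h4] at this
  nlinarith

theorem xi_rho (r : ℝ) (x y : E3) : xi r (rho x) (rho y) = rho (xi r x y) := by
  simp [xi, map_smul, map_sub]

theorem kv_rho (r : ℝ) (x y : E3) : kv r (rho x) (rho y) = kv r x y := by
  unfold kv; rw [xi_rho, xi_rho, LinearIsometryEquiv.norm_map, LinearIsometryEquiv.norm_map]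

theorem kv_rho' (r : ℝ) (x y : E3) : kv r x (rho y) = kv r (rho x) y := by
  rw [← kv_rho, rho_rho]

theorem kv_meas : Measurable (fun z : ℝ × E3 × E3 => kv z.1 z.2.1 z.2.2) := by
  have h1 : Measurable aa := aa_cont.measurable
  unfold kv xi
  fun_prop

theorem P_meas : Measurable (fun z : ℝ × E3 × E3 => P z.1 z.2.1 z.2.2) := by
  have h1 : Measurable aa := aa_cont.measurable
  unfold P xi
  fun_prop

/-- Gaussian integrals -/
theorem gauss3 {b : ℝ} (hb : 0 < b) (x : E3) :
    ∫⁻ y, ENNReal.ofReal (exp (-b * ‖y - x‖ ^ 2)) = ENNReal.ofReal ((π / b) ^ (3 / 2 : ℝ)) := by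
  rw [lintegral_sub_right_eq_self (fun y : E3 => ENNReal.ofReal (exp (-b * ‖y‖ ^ 2))) x]
  have h := GaussianFourier.integral_rexp_neg_mul_sq_norm (V := E3) hb
  simp only [finrank_euclideanSpace, Fintype.card_fin] at h
  have hi : Integrable (fun y : E3 => exp (-b * ‖y‖ ^ 2)) := by
    by_contra hc
    rw [integral_undef hc] at h
    have : (0:ℝ) < (π / b) ^ (((3:ℕ):ℝ) / 2) := by positivity
    linarith
  rw [← ofReal_integral_eq_lintegral_ofReal hi (Eventually.of_forall fun y => (exp_pos _).le), h]
  norm_num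

theorem gauss2 {b : ℝ} (hb : 0 < b) (x : E2) :
    ∫⁻ y, ENNReal.ofReal (exp (-b * ‖y - x‖ ^ 2)) = ENNReal.ofReal (π / b) := by
  rw [lintegral_sub_right_eq_self (fun y : E2 => ENNReal.ofReal (exp (-b * ‖y‖ ^ 2))) x]
  have h := GaussianFourier.integral_rexp_neg_mul_sq_norm (V := E2) hb
  simp only [finrank_euclideanSpace, Fintype.card_fin] at h
  have hi : Integrable (fun y : E2 => exp (-b * ‖y‖ ^ 2)) := by
    by_contra hc
    rw [integral_undef hc] at h
    have : (0:ℝ) < (π / b) ^ (((2:ℕ):ℝ) / 2) := by positivity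
    linarith
  rw [← ofReal_integral_eq_lintegral_ofReal hi (Eventually.of_forall fun y => (exp_pos _).le), h]
  norm_num

end Ham

namespace Ham

def nu0 (γ : ℝ) : Measure E3 :=
  volume.withDensity fun y => ENNReal.ofReal (exp (-(γ / 8) * ‖y‖ ^ 2))

def nub : Measure E3 :=
  ((volume : Measure E2).withDensity fun y => ENNReal.ofReal (2 * exp (-(1 / 4) * ‖y‖ ^ 2))).map io

def nu (γ ε : ℝ) : Measure E3 := nu0 γ + ENNReal.ofReal ε • nub

theorem lint_nu0 (γ : ℝ) {f : E3 → ENNReal} (hf : Measurable f) :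
    ∫⁻ y, f y ∂(nu0 γ) = ∫⁻ y, ENNReal.ofReal (exp (-(γ / 8) * ‖y‖ ^ 2)) * f y := by
  unfold nu0
  rw [lintegral_withDensity_eq_lintegral_mul _ (by fun_prop) hf]
  rfl

theorem lint_nub {f : E3 → ENNReal} (hf : Measurable f) :
    ∫⁻ y, f y ∂nub = ∫⁻ y : E2, ENNReal.ofReal (2 * exp (-(1 / 4) * ‖y‖ ^ 2)) * f (io y) := by
  unfold nub
  have hfi : Measurable fun y => f (io y) := hf.comp io_m.measurable
  rw [lintegral_map hf io_m.measurable,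
    lintegral_withDensity_eq_lintegral_mul _ (by fun_prop) hfi]
  rfl

theorem lint_nu (γ ε : ℝ) (f : E3 → ENNReal) :
    ∫⁻ y, f y ∂(nu γ ε) = ∫⁻ y, f y ∂(nu0 γ) + ENNReal.ofReal ε * ∫⁻ y, f y ∂nub := by
  unfold nu
  rw [lintegral_add_measure, lintegral_smul_measure, smul_eq_mul]

theorem nu0_le {γ : ℝ} (hγ : 0 ≤ γ) {f : E3 → ENNReal} (hf : Measurable f) :
    ∫⁻ y, f y ∂(nu0 γ) ≤ ∫⁻ y, f y := by
  rw [lint_nu0 γ hf]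
  refine lintegral_mono fun y => ?_
  have : ENNReal.ofReal (exp (-(γ / 8) * ‖y‖ ^ 2)) ≤ 1 := by
    rw [ENNReal.ofReal_le_one, exp_le_one_iff]
    have := sq_nonneg ‖y‖
    nlinarith
  calc _ ≤ 1 * f y := by gcongr
    _ = f y := one_mul _

theorem nub_le {f : E3 → ENNReal} (hf : Measurable f) :
    ∫⁻ y, f y ∂nub ≤ 2 * ∫⁻ y : E2, f (io y) := by
  have hfi : Measurable fun y => f (io y) := hf.comp io_m.measurable
  rw [lint_nub hf, ← lintegral_const_mul _ hfi]
  refine lintegral_mono fun y => ?_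
  have : ENNReal.ofReal (2 * exp (-(1 / 4) * ‖y‖ ^ 2)) ≤ 2 := by
    have h : exp (-(1 / 4) * ‖y‖ ^ 2) ≤ 1 := by
      rw [exp_le_one_iff]
      have := sq_nonneg ‖y‖
      nlinarith
    calc _ ≤ ENNReal.ofReal 2 := ENNReal.ofReal_le_ofReal (by linarith)
      _ = 2 := by simp
  gcongr

theorem nu_mono {γ ε : ℝ} (h1 : ε ≤ 1) : nu γ ε ≤ nu γ 1 := by
  unfold nu
  have : ENNReal.ofReal ε ≤ ENNReal.ofReal 1 := ENNReal.ofReal_le_ofReal h1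
  gcongr

instance nub_fin : IsFiniteMeasure nub := by
  refine ⟨?_⟩
  have h := lint_nub (f := fun _ => 1) measurable_const
  rw [lintegral_one] at h
  rw [h]
  have h2 := gauss2 (b := 1 / 4) (by norm_num) 0
  simp only [sub_zero] at h2
  simp only [mul_one]
  simp_rw [ENNReal.ofReal_mul (zero_le_two : (0:ℝ) ≤ 2)]
  rw [lintegral_const_mul _ (by fun_prop), h2]
  finiteness

theorem nu0_fin {γ : ℝ} (hγ : 0 < γ) : IsFiniteMeasure (nu0 γ) := by
  refine ⟨?_⟩
  have h := lint_nu0 γ (f := fun _ => 1) measurable_const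
  rw [lintegral_one] at h
  rw [h]
  have h2 := gauss3 (b := γ / 8) (by positivity) 0
  simp only [sub_zero] at h2
  simp only [mul_one]
  rw [h2]
  finiteness

theorem nu_fin {γ : ℝ} (hγ : 0 < γ) (ε : ℝ) : IsFiniteMeasure (nu γ ε) := by
  have := nu0_fin hγ
  refine ⟨?_⟩
  have : nu γ ε Set.univ = nu0 γ Set.univ + ENNReal.ofReal ε * nub Set.univ := by
    simp [nu]
  rw [this]
  finiteness

def c4 : ℝ := (4 * π) ^ (3 / 2 : ℝ)
theorem c4_pos : 0 < c4 := by unfold c4; positivity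

def om (r : ℝ) : ℝ := 2 / c4 * (r / (1 + r ^ 2))

theorem om_nn {r : ℝ} (hr : 0 < r) : 0 ≤ om r := by
  unfold om; have := c4_pos; positivity
theorem om_pos {r : ℝ} (hr : 0 < r) : 0 < om r := by
  unfold om; have := c4_pos; positivity
theorem om_le {r : ℝ} (hr : 0 < r) : om r ≤ 2 / c4 * r := by
  unfold om; have := c4_pos
  refine mul_le_mul_of_nonneg_left ?_ (by positivity)
  exact div_le_self hr.le (by nlinarith)
theorem om_le' {r : ℝ} (hr : 0 < r) : om r ≤ 2 / c4 * r⁻¹ := by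
  unfold om; have := c4_pos
  refine mul_le_mul_of_nonneg_left ?_ (by positivity)
  rw [div_le_iff₀ (by positivity)]
  have : r⁻¹ * (1 + r ^ 2) = r⁻¹ + r := by field_simp
  rw [this]
  have : 0 < r⁻¹ := by positivity
  linarith
theorem om_meas : Measurable om := by unfold om; fun_prop

def ks (r : ℝ) (x y : E3) : ℝ := (kv r x y + kv r x (rho y)) / 2

theorem ks_symm (r : ℝ) (x y : E3) : ks r x y = ks r y x := by
  unfold ks; rw [kv_symm r x y, kv_rho', kv_symm r (rho x) y]
theorem ks_nn {r : ℝ} (hr : 0 < r) (x y : E3) : 0 ≤ ks r x y := by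
  unfold ks; have := kv_nn hr x y; have := kv_nn hr x (rho y); linarith
theorem ks_pos {r : ℝ} (hr : 0 < r) (x y : E3) : 0 < ks r x y := by
  unfold ks; have := kv_pos hr x y; have := kv_pos hr x (rho y); linarith
theorem ks_le {r : ℝ} (hr : 0 < r) (x y : E3) : ks r x y ≤ r⁻¹ ^ 3 := by
  unfold ks; have := kv_le hr x y; have := kv_le hr x (rho y); linarith
theorem ks_rho (r : ℝ) (x y : E3) : ks r (rho x) y = ks r x y := by
  unfold ks; rw [kv_rho, ← kv_rho', add_comm]
theorem ks_meas : Measurable (fun z : ℝ × E3 × E3 => ks z.1 z.2.1 z.2.2) := by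
  unfold ks
  have h : Measurable (fun z : ℝ × E3 × E3 => (z.1, z.2.1, rho z.2.2)) := by
    have := rho.continuous.measurable
    fun_prop
  exact ((kv_meas).add (kv_meas.comp h)).div_const 2

theorem gau_c4 {r : ℝ} (hr : 0 < r) : r⁻¹ ^ 3 * (π / (r⁻¹ ^ 2 / 4)) ^ (3 / 2 : ℝ) = c4 := by
  have : π / (r⁻¹ ^ 2 / 4) = (4 * π) * r ^ 2 := by field_simp
  rw [this, Real.mul_rpow (by positivity) (by positivity), ← Real.rpow_natCast r 2, ← Real.rpow_mul hr.le]
  have : (r:ℝ) ^ (((2:ℕ):ℝ) * (3 / 2)) = r ^ 3 := by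
    rw [show ((2:ℕ):ℝ) * (3 / 2) = ((3:ℕ):ℝ) by norm_num, Real.rpow_natCast]
  rw [this]
  unfold c4
  field_simp

theorem kv_sec (r : ℝ) (x : E3) : Measurable fun y => kv r x y :=
  kv_meas.comp (measurable_prodMk_left.comp measurable_prodMk_left)

theorem kv_vol {r : ℝ} (hr : 0 < r) (x : E3) : ∫⁻ y, ENNReal.ofReal (kv r x y) ≤ ENNReal.ofReal c4 := by
  calc ∫⁻ y, ENNReal.ofReal (kv r x y)
      ≤ ∫⁻ y, ENNReal.ofReal (r⁻¹ ^ 3) * ENNReal.ofReal (exp (-(r⁻¹ ^ 2 / 4) * ‖y - x‖ ^ 2)) := by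
        refine lintegral_mono fun y => ?_
        rw [← ENNReal.ofReal_mul (by positivity)]
        exact ENNReal.ofReal_le_ofReal (kv_gauss hr x y)
    _ = ENNReal.ofReal c4 := by
        rw [lintegral_const_mul _ (by fun_prop), gauss3 (by positivity), ← ENNReal.ofReal_mul (by positivity),
          gau_c4 hr]

theorem kv_pl {r : ℝ} (hr : 0 < r) (x : E3) :
    ∫⁻ y : E2, ENNReal.ofReal (kv r x (io y)) ≤ ENNReal.ofReal (4 * π * r⁻¹) := by
  calc ∫⁻ y : E2, ENNReal.ofReal (kv r x (io y))
      ≤ ∫⁻ y : E2, ENNReal.ofReal (r⁻¹ ^ 3) * ENNReal.ofReal (exp (-(r⁻¹ ^ 2 / 4) * ‖y - hz x‖ ^ 2)) := by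
        refine lintegral_mono fun y => ?_
        rw [← ENNReal.ofReal_mul (by positivity)]
        refine ENNReal.ofReal_le_ofReal ((kv_gauss hr x (io y)).trans ?_)
        refine mul_le_mul_of_nonneg_left (exp_le_exp.2 ?_) (by positivity)
        rw [io_sub_sq]
        have : 0 ≤ (r⁻¹ ^ 2 / 4) * x 2 ^ 2 := by positivity
        nlinarith
    _ = ENNReal.ofReal (4 * π * r⁻¹) := by
        rw [lintegral_const_mul _ (by fun_prop), gauss2 (by positivity), ← ENNReal.ofReal_mul (by positivity)]
        congr 1
        field_simp

theorem kv_nu0 {γ r : ℝ} (hγ : 0 ≤ γ) (hr : 0 < r) (x : E3) :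
    ∫⁻ y, ENNReal.ofReal (kv r x y) ∂(nu0 γ) ≤ ENNReal.ofReal c4 :=
  (nu0_le hγ (kv_sec r x).ennreal_ofReal).trans (kv_vol hr x)

theorem kv_nub {r : ℝ} (hr : 0 < r) (x : E3) :
    ∫⁻ y, ENNReal.ofReal (kv r x y) ∂nub ≤ ENNReal.ofReal (8 * π * r⁻¹) := by
  refine (nub_le (kv_sec r x).ennreal_ofReal).trans ?_
  calc _ ≤ 2 * ENNReal.ofReal (4 * π * r⁻¹) := by gcongr; exact kv_pl hr x
    _ = ENNReal.ofReal 2 * ENNReal.ofReal (4 * π * r⁻¹) := by simp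
    _ = _ := by
      rw [← ENNReal.ofReal_mul (by norm_num)]
      congr 1; ring

theorem kv_nu {γ r : ℝ} (hγ : 0 ≤ γ) (hr : 0 < r) (x : E3) :
    ∫⁻ y, ENNReal.ofReal (kv r x y) ∂(nu γ 1) ≤ ENNReal.ofReal (c4 + 8 * π * r⁻¹) := by
  rw [lint_nu, ENNReal.ofReal_add c4_pos.le (by positivity)]
  simp only [ENNReal.ofReal_one, one_mul]
  gcongr
  · exact kv_nu0 hγ hr x
  · exact kv_nub hr x

theorem ks_int {μ : Measure E3} {r : ℝ} (hr : 0 < r) {A : ENNReal}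
    (h : ∀ x, ∫⁻ y, ENNReal.ofReal (kv r x y) ∂μ ≤ A) (x : E3) :
    ∫⁻ y, ENNReal.ofReal (ks r x y) ∂μ ≤ A := by
  have e : ∀ y, ENNReal.ofReal (ks r x y)
      = ENNReal.ofReal (1 / 2) * ENNReal.ofReal (kv r x y) + ENNReal.ofReal (1 / 2) * ENNReal.ofReal (kv r (rho x) y) := by
    intro y
    rw [← ENNReal.ofReal_mul (by norm_num), ← ENNReal.ofReal_mul (by norm_num),
      ← ENNReal.ofReal_add (mul_nonneg (by norm_num) (kv_nn hr _ _)) (mul_nonneg (by norm_num) (kv_nn hr _ _)),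
      ← kv_rho']
    congr 1; unfold ks; ring
  simp_rw [e]
  rw [lintegral_add_left ((kv_sec r x).ennreal_ofReal.const_mul _),
    lintegral_const_mul _ (kv_sec r x).ennreal_ofReal, lintegral_const_mul _ (kv_sec r _).ennreal_ofReal]
  calc _ ≤ ENNReal.ofReal (1 / 2) * A + ENNReal.ofReal (1 / 2) * A := by
        gcongr
        · exact h x
        · exact h _
    _ = A := by
        rw [← add_mul, ← ENNReal.ofReal_add (by norm_num) (by norm_num)]
        norm_num

/-- partial Green kernel -/
def gl (A : Set ℝ) (x y : E3) : ENNReal := ∫⁻ r in A, ENNReal.ofReal (om r * ks r x y)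

theorem omks_meas : Measurable (fun z : ℝ × E3 × E3 => ENNReal.ofReal (om z.1 * ks z.1 z.2.1 z.2.2)) :=
  ((om_meas.comp measurable_fst).mul ks_meas).ennreal_ofReal

theorem gl_meas (A : Set ℝ) : Measurable (fun z : E3 × E3 => gl A z.1 z.2) := by
  unfold gl
  exact Measurable.lintegral_prod_left' (f := fun q : ℝ × E3 × E3 =>
    ENNReal.ofReal (om q.1 * ks q.1 q.2.1 q.2.2)) omks_meas

theorem gl_sec (A : Set ℝ) (x : E3) : Measurable fun y => gl A x y := by
  have h := gl_meas A
  exact Measurable.of_uncurry_left (f := fun x y => gl A x y) h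

theorem gl_symm (A : Set ℝ) (x y : E3) : gl A x y = gl A y x := by
  unfold gl; simp_rw [ks_symm _ x y]

theorem gl_rho (A : Set ℝ) (x y : E3) : gl A (rho x) y = gl A x y := by
  unfold gl; simp_rw [ks_rho]

theorem gl_add {δ : ℝ} (hδ : 0 < δ) (x y : E3) :
    gl (Set.Ioi 0) x y = gl (Set.Ioc 0 δ) x y + gl (Set.Ioi δ) x y := by
  unfold gl
  rw [← lintegral_union measurableSet_Ioi (Set.disjoint_left.2 fun z h1 h2 => not_lt.2 h1.2 h2),
    Set.Ioc_union_Ioi_eq_Ioi hδ.le]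

/-- Tonelli -/
theorem gl_ton (A : Set ℝ) (μ : Measure E3) [SFinite μ] (x : E3) {φ : E3 → ENNReal} (hφ : Measurable φ) :
    ∫⁻ y, gl A x y * φ y ∂μ = ∫⁻ r in A, ∫⁻ y, ENNReal.ofReal (om r * ks r x y) * φ y ∂μ := by
  unfold gl
  have hm : Measurable fun z : ℝ × E3 => ENNReal.ofReal (om z.1 * ks z.1 x z.2) :=
    omks_meas.comp (measurable_fst.prodMk (measurable_const.prodMk measurable_snd))
  have : ∀ y, (∫⁻ r in A, ENNReal.ofReal (om r * ks r x y)) * φ y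
      = ∫⁻ r in A, ENNReal.ofReal (om r * ks r x y) * φ y := fun y => by
    have hy : Measurable fun r => ENNReal.ofReal (om r * ks r x y) := hm.comp measurable_prodMk_right
    rw [lintegral_mul_const _ hy]
  simp_rw [this]
  rw [lintegral_lintegral_swap]
  exact ((hm.comp measurable_swap).mul (hφ.comp measurable_fst)).aemeasurable

theorem ks_sec (r : ℝ) (x : E3) : Measurable fun y => ks r x y := by
  unfold ks
  have := rho.continuous.measurable
  exact ((kv_sec r x).add ((kv_sec r x).comp this)).div_const 2

def Cs : ℝ := 2 / c4 * (c4 + 8 * π)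
theorem Cs_pos : 0 < Cs := by unfold Cs; have := c4_pos; positivity

theorem gl_small {γ δ : ℝ} (hγ : 0 < γ) (hδ : 0 < δ) (hδ1 : δ ≤ 1) (x : E3) :
    ∫⁻ y, gl (Set.Ioc 0 δ) x y ∂(nu γ 1) ≤ ENNReal.ofReal (Cs * δ) := by
  have := nu_fin hγ 1
  have e := gl_ton (Set.Ioc 0 δ) (nu γ 1) x (φ := fun _ => 1) measurable_const
  simp only [mul_one] at e
  rw [e]
  calc _ ≤ ∫⁻ r in Set.Ioc 0 δ, ENNReal.ofReal Cs := by
        refine setLIntegral_mono measurable_const fun r hr => ?_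
        have hr0 := hr.1
        simp_rw [ENNReal.ofReal_mul (om_nn hr0)]
        rw [lintegral_const_mul _ (ks_sec r x).ennreal_ofReal]
        refine (mul_le_mul_right (ks_int hr0 (fun x => kv_nu hγ.le hr0 x) x) _).trans ?_
        rw [← ENNReal.ofReal_mul (om_nn hr0)]
        refine ENNReal.ofReal_le_ofReal ?_
        have h4 := c4_pos
        have hp := pi_pos
        have : 0 < r⁻¹ := by positivity
        calc om r * (c4 + 8 * π * r⁻¹) ≤ 2 / c4 * r * (c4 + 8 * π * r⁻¹) :=
              mul_le_mul_of_nonneg_right (om_le hr0) (by positivity)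
          _ = 2 / c4 * (r * c4 + 8 * π) := by field_simp
          _ ≤ Cs := by
              unfold Cs
              refine mul_le_mul_of_nonneg_left ?_ (by positivity)
              have : r ≤ 1 := hr.2.trans hδ1
              nlinarith
    _ = ENNReal.ofReal (Cs * δ) := by
        rw [setLIntegral_const, Real.volume_Ioc, sub_zero, ENNReal.ofReal_mul Cs_pos.le]

theorem gl_large {δ : ℝ} (hδ : 0 < δ) (x y : E3) :
    gl (Set.Ioi δ) x y ≤ ENNReal.ofReal (2 / c4 / δ) := by
  unfold gl
  have h4 := c4_pos
  have hi : IntegrableOn (fun r : ℝ => 2 / c4 * r ^ (-2 : ℝ)) (Set.Ioi δ) :=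
    (integrableOn_Ioi_rpow_of_lt (by norm_num) hδ).const_mul _
  calc _ ≤ ∫⁻ r in Set.Ioi δ, ENNReal.ofReal (2 / c4 * r ^ (-2 : ℝ)) := by
        refine setLIntegral_mono (by fun_prop) fun r hr => ?_
        have hr0 : 0 < r := hδ.trans hr
        refine ENNReal.ofReal_le_ofReal ?_
        calc om r * ks r x y ≤ 2 / c4 * r * r⁻¹ ^ 3 :=
              mul_le_mul (om_le hr0) (ks_le hr0 x y) (ks_nn hr0 x y) (by positivity)
          _ = _ := by
            rw [show (-2:ℝ) = -((2:ℕ):ℝ) by norm_num, Real.rpow_neg hr0.le, Real.rpow_natCast]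
            field_simp
    _ = _ := by
        rw [← ofReal_integral_eq_lintegral_ofReal hi
          ((ae_restrict_iff' measurableSet_Ioi).2 (Eventually.of_forall fun r hr => by
            have hr0 : 0 < r := hδ.trans hr
            positivity)), integral_const_mul, integral_Ioi_rpow_of_lt (by norm_num) hδ]
        congr 1
        rw [show (-2:ℝ) + 1 = -1 by norm_num, Real.rpow_neg_one]
        field_simp

/-- total Schur constant -/
def Sc (γ : ℝ) : ℝ := Cs + 2 / c4 * (nu γ 1).real Set.univ
theorem Sc_pos (γ : ℝ) : 0 < Sc γ := by
  unfold Sc; have := Cs_pos; have := c4_pos; have : 0 ≤ (nu γ 1).real Set.univ := measureReal_nonneg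
  positivity

theorem gl_tot {γ : ℝ} (hγ : 0 < γ) (x : E3) :
    ∫⁻ y, gl (Set.Ioi 0) x y ∂(nu γ 1) ≤ ENNReal.ofReal (Sc γ) := by
  have := nu_fin hγ 1
  simp_rw [gl_add one_pos]
  have m1 : Measurable fun y => gl (Set.Ioc 0 1) x y := gl_sec _ x
  rw [lintegral_add_left m1]
  unfold Sc
  have := c4_pos
  rw [ENNReal.ofReal_add Cs_pos.le (by positivity)]
  gcongr
  · simpa using gl_small hγ one_pos le_rfl x
  · calc _ ≤ ∫⁻ y, ENNReal.ofReal (2 / c4 / 1) ∂(nu γ 1) := lintegral_mono fun y => gl_large one_pos x y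
      _ = _ := by
        rw [lintegral_const, ENNReal.ofReal_mul (by positivity), measureReal_def,
          ENNReal.ofReal_toReal (measure_ne_top _ _), div_one]

theorem gl_tot' {γ ε : ℝ} (hγ : 0 < γ) (h1 : ε ≤ 1) (x : E3) :
    ∫⁻ y, gl (Set.Ioi 0) x y ∂(nu γ ε) ≤ ENNReal.ofReal (Sc γ) :=
  (lintegral_mono' (nu_mono h1) le_rfl).trans (gl_tot hγ x)

def Gk (x y : E3) : ℝ := (gl (Set.Ioi 0) x y).toReal

theorem Gk_le (x y : E3) : ENNReal.ofReal (Gk x y) ≤ gl (Set.Ioi 0) x y := ENNReal.ofReal_toReal_le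

theorem Gk_ker {γ ε : ℝ} (hγ : 0 < γ) (h1 : ε ≤ 1) : KerS (nu γ ε) Gk (Sc γ) where
  meas := (gl_meas _).ennreal_toReal
  nn := fun x y => ENNReal.toReal_nonneg
  symm := fun x y => by unfold Gk; rw [gl_symm]
  S0 := (Sc_pos γ).le
  bd := fun x => (lintegral_mono fun y => Gk_le x y).trans (gl_tot' hγ h1 x)

theorem Gk_split {γ ε : ℝ} (hγ : 0 < γ) (h1 : ε ≤ 1) : ∀ η, 0 < η → ∃ (G1 G2 : E3 → E3 → ℝ) (C2 : ℝ),
    (∀ x y, Gk x y = G1 x y + G2 x y) ∧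
    KerS (nu γ ε) G1 η ∧ Measurable (fun z : E3 × E3 => G2 z.1 z.2) ∧ (∀ x y, 0 ≤ G2 x y) ∧
    (∀ x y, G2 x y ≤ C2) := by
  intro η hη
  have hC := Cs_pos
  have h4 := c4_pos
  obtain ⟨δ, hδ, hδ1, hδη⟩ : ∃ δ, 0 < δ ∧ δ ≤ 1 ∧ Cs * δ ≤ η :=
    ⟨min 1 (η / Cs), lt_min one_pos (by positivity), min_le_left _ _, by
      calc Cs * min 1 (η / Cs) ≤ Cs * (η / Cs) := mul_le_mul_of_nonneg_left (min_le_right _ _) hC.le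
        _ = η := by field_simp⟩
  classical
  have hms : MeasurableSet {z : E3 × E3 | gl (Set.Ioi 0) z.1 z.2 = ⊤} :=
    gl_meas (Set.Ioi 0) (measurableSet_singleton ⊤)
  refine ⟨fun x y => if gl (Set.Ioi 0) x y = ⊤ then 0 else (gl (Set.Ioc 0 δ) x y).toReal,
    fun x y => if gl (Set.Ioi 0) x y = ⊤ then 0 else (gl (Set.Ioi δ) x y).toReal, 2 / c4 / δ,
    fun x y => ?_, ⟨?_, fun x y => ?_, fun x y => ?_, hη.le, fun x => ?_⟩, ?_, fun x y => ?_, fun x y => ?_⟩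
  · by_cases h : gl (Set.Ioi 0) x y = ⊤
    · simp [h, Gk]
    · simp only [h, if_false, Gk]
      rw [gl_add hδ] at h ⊢
      rw [ENNReal.add_eq_top, not_or] at h
      rw [ENNReal.toReal_add h.1 h.2]
  · exact Measurable.ite hms measurable_const (gl_meas _).ennreal_toReal
  · split_ifs
    · exact le_rfl
    · exact ENNReal.toReal_nonneg
  · rw [gl_symm _ x y, gl_symm _ x y]
  · calc _ ≤ ∫⁻ y, gl (Set.Ioc 0 δ) x y ∂(nu γ ε) := by
          refine lintegral_mono fun y => ?_
          dsimp only; split_ifs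
          · simp
          · exact ENNReal.ofReal_toReal_le
      _ ≤ ∫⁻ y, gl (Set.Ioc 0 δ) x y ∂(nu γ 1) := lintegral_mono' (nu_mono h1) le_rfl
      _ ≤ _ := (gl_small hγ hδ hδ1 x).trans (ENNReal.ofReal_le_ofReal hδη)
  · exact Measurable.ite hms measurable_const (gl_meas _).ennreal_toReal
  · dsimp only; split_ifs
    · exact le_rfl
    · exact ENNReal.toReal_nonneg
  · dsimp only; split_ifs
    · positivity
    · exact ENNReal.toReal_le_of_le_ofReal (by positivity) (gl_large hδ x y)

end Ham

namespace Ham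

def kap (p : ℝ) (y : E3) : ℝ := exp (-((6 - p) / 8) * ‖y‖ ^ 2)

theorem kap_le {p : ℝ} (hp : p ≤ 4) (y : E3) : kap p y ≤ 1 := by
  unfold kap
  rw [exp_le_one_iff]
  have := sq_nonneg ‖y‖
  nlinarith

def Eo : Set E3 := {y | y 2 ≠ 0}

open Classical in
def fi (p ε M : ℝ) (y : E3) : ℝ → ℝ :=
  if y ∈ Eo then fun s => Tp (p - 1) M s + (ε ^ 2 * kap p y) * Tp 5 M s
  else fun s => Tp 3 M s + 0 * Tp 5 M s

open Classical in
def Fi (p ε M : ℝ) (y : E3) : ℝ → ℝ :=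
  if y ∈ Eo then fun s => TF (p - 1) M s + (ε ^ 2 * kap p y) * TF 5 M s
  else fun s => TF 3 M s + 0 * TF 5 M s

theorem Eo_meas : MeasurableSet Eo := by
  have : Measurable fun y : E3 => y 2 := by fun_prop
  exact this (measurableSet_singleton (0:ℝ)).compl

theorem Eo_null : (volume : Measure E3) Eoᶜ = 0 := by
  have h := Measure.addHaar_submodule (volume : Measure E3)
    (LinearMap.ker (EuclideanSpace.proj (2 : Fin 3) : E3 →L[ℝ] ℝ).toLinearMap) (by
      intro h
      have h2 : (EuclideanSpace.single (2 : Fin 3) (1:ℝ)) ∈ LinearMap.ker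
        (EuclideanSpace.proj (2 : Fin 3) : E3 →L[ℝ] ℝ).toLinearMap := by rw [h]; trivial
      simp at h2)
  refine le_antisymm (le_trans (measure_mono ?_) h.le) bot_le
  intro y hy
  simp only [Eo, Set.mem_compl_iff, Set.mem_ofPred_eq, not_not] at hy
  simpa using hy

theorem nu0_Eo (γ : ℝ) : ∀ᵐ y ∂(nu0 γ), y ∈ Eo := by
  have h : ∀ᵐ y : E3, y ∈ Eo := by
    rw [ae_iff]; exact Eo_null
  exact (withDensity_absolutelyContinuous _ _).ae_le h

theorem nub_Eo : nub Eo = 0 := by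
  unfold nub
  rw [Measure.map_apply io_m.measurable Eo_meas]
  have : io ⁻¹' Eo = ∅ := by
    ext y; simp [Eo, io]
  rw [this, measure_empty]

theorem nu_Eo (γ ε : ℝ) : nu γ ε Eo = nu0 γ Set.univ := by
  have : nu0 γ Eo = nu0 γ Set.univ := measure_congr (by
    filter_upwards [nu0_Eo γ] with y hy
    exact propext ⟨fun _ => trivial, fun _ => hy⟩)
  simp [nu, nub_Eo, this]

theorem nu0_pos (γ : ℝ) : 0 < nu0 γ Set.univ := by
  rw [pos_iff_ne_zero]
  intro h
  have h2 := lint_nu0 γ (f := fun _ => 1) measurable_const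
  rw [lintegral_one, h] at h2
  simp only [mul_one] at h2
  rw [eq_comm, lintegral_eq_zero_iff (by fun_prop)] at h2
  have h3 : ∀ᵐ y : E3, False := by
    filter_upwards [h2] with y hy
    simp only [Pi.zero_apply, ENNReal.ofReal_eq_zero] at hy
    linarith [exp_pos (-(γ / 8) * ‖y‖ ^ 2)]
  simp [ae_iff] at h3

def Qc (p M : ℝ) : ℝ := (p - 1) * M ^ (p - 1 - 1) + 3 * M ^ ((3:ℝ) - 1) + 5 * M ^ ((5:ℝ) - 1)

section

theorem fi_nl {p ε M : ℝ} (hp1 : 2 < p) (hp2 : p ≤ 4) (hε : 0 < ε) (hε1 : ε ≤ 1) (hM : 1 ≤ M) (y : E3) : NL (fi p ε M y) (Fi p ε M y) (dl (p - 2)) (Qc p M) 1 1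
    ((p - 2) / 2) ((p - 2) / 2 * M) := by
  have h0 : 0 < M := by linarith
  have hQ : 0 < Qc p M := by
    unfold Qc
    have : 0 < p - 1 := by linarith
    positivity
  have q1 : 0 ≤ (p - 1) * M ^ (p - 1 - 1) := by
    have : 0 < p - 1 := by linarith
    positivity
  have q3 : 0 ≤ 3 * M ^ ((3:ℝ) - 1) := by positivity
  have hk := kap_le hp2 y
  have hk0 : 0 ≤ kap p y := by unfold kap; positivity
  unfold fi Fi
  split_ifs with h
  · refine NL_sum (by linarith) (by norm_num) hM (by positivity) ?_ (by linarith) (by linarith)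
      (by linarith) hQ (by unfold Qc; linarith)
    have : ε ^ 2 ≤ 1 := by nlinarith
    nlinarith
  · exact NL_sum (by norm_num) (by norm_num) hM le_rfl zero_le_one (by linarith) (by linarith)
      (by linarith) hQ (by unfold Qc; linarith)

theorem fi_dat {p ε M : ℝ} (hp1 : 2 < p) (hp2 : p ≤ 4) (hε : 0 < ε) (hε1 : ε ≤ 1) (hM : 1 ≤ M) : Dat (nu (p - 2) ε) Gk (fi p ε M) (Fi p ε M) (dl (p - 2)) (Qc p M) 1 1
    ((p - 2) / 2) ((p - 2) / 2 * M) (Sc (p - 2)) where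
  nl := fi_nl hp1 hp2 hε hε1 hM
  fm := by
    classical
    have : (fun z : E3 × ℝ => fi p ε M z.1 z.2) = fun z => if z.1 ∈ Eo then
        Tp (p - 1) M z.2 + (ε ^ 2 * kap p z.1) * Tp 5 M z.2 else Tp 3 M z.2 + 0 * Tp 5 M z.2 := by
      funext z; unfold fi; split_ifs <;> rfl
    rw [this]
    have a1 := (Tp_cont (r := p - 1) (M := M) (by linarith)).measurable
    have a2 := (Tp_cont (r := 5) (M := M) (by norm_num)).measurable
    have a3 := (Tp_cont (r := 3) (M := M) (by norm_num)).measurable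
    refine Measurable.ite (measurable_fst Eo_meas) ?_ ?_
    · unfold kap; fun_prop
    · fun_prop
  Fm := by
    classical
    have : (fun z : E3 × ℝ => Fi p ε M z.1 z.2) = fun z => if z.1 ∈ Eo then
        TF (p - 1) M z.2 + (ε ^ 2 * kap p z.1) * TF 5 M z.2 else TF 3 M z.2 + 0 * TF 5 M z.2 := by
      funext z; unfold Fi; split_ifs <;> rfl
    rw [this]
    have a1 := (TF_cont (r := p - 1) (M := M) (by linarith)).measurable
    have a2 := (TF_cont (r := 5) (M := M) (by norm_num)).measurable
    have a3 := (TF_cont (r := 3) (M := M) (by norm_num)).measurable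
    refine Measurable.ite (measurable_fst Eo_meas) ?_ ?_
    · unfold kap; fun_prop
    · fun_prop
  ker := Gk_ker (by linarith) hε1
  split := Gk_split (by linarith) hε1

theorem Hi_nn {p ε M : ℝ} (hp1 : 2 < p) (hp2 : p ≤ 4) (hε : 0 < ε) (hε1 : ε ≤ 1) (hM : 1 ≤ M) (y : E3) {s : ℝ} (hs : 0 ≤ s) : 0 ≤ fi p ε M y s * s / 2 - Fi p ε M y s := by
  have hk0 : 0 ≤ kap p y := by unfold kap; positivity
  have h1 := TH_nn (r := p - 1) (by linarith) hM hs
  have h2 := TH_nn (r := 5) (by norm_num) hM hs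
  have h3 := TH_nn (r := 3) (by norm_num) hM hs
  unfold fi Fi
  split_ifs
  · have : 0 ≤ (ε ^ 2 * kap p y) * (Tp 5 M s * s / 2 - TF 5 M s) := mul_nonneg (by positivity) h2
    simp only
    nlinarith
  · simp only; linarith

theorem Hi_low {p ε M : ℝ} (hp1 : 2 < p) (hp2 : p ≤ 4) (hε : 0 < ε) (hε1 : ε ≤ 1) (hM : 1 ≤ M) {y : E3} (hy : y ∈ Eo) {s : ℝ} (hs : 0 ≤ s) :
    (1 / 2 - 1 / p) * (min s M) ^ p ≤ fi p ε M y s * s / 2 - Fi p ε M y s := by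
  have hk0 : 0 ≤ kap p y := by unfold kap; positivity
  have h1 := TH_low (r := p - 1) (by linarith) hM hs
  have h2 := TH_nn (r := 5) (by norm_num) hM hs
  rw [show p - 1 + 1 = p by ring] at h1
  unfold fi Fi
  simp only [hy, if_true]
  have : 0 ≤ (ε ^ 2 * kap p y) * (Tp 5 M s * s / 2 - TF 5 M s) := mul_nonneg (by positivity) h2
  nlinarith

end

theorem gl_pos (x y : E3) : gl (Set.Ioi 0) x y ≠ 0 := by
  unfold gl
  intro h
  have hm : Measurable fun r => ENNReal.ofReal (om r * ks r x y) := by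
    have h : Measurable fun r => ((r, x, y) : ℝ × E3 × E3) := by fun_prop
    exact omks_meas.comp h
  rw [lintegral_eq_zero_iff hm, EventuallyEq, ae_restrict_iff' measurableSet_Ioi] at h
  have h3 : ∀ᵐ r : ℝ, r ∉ Set.Ioi (0:ℝ) := by
    filter_upwards [h] with r hr hr0
    have := hr hr0
    simp only [Pi.zero_apply, ENNReal.ofReal_eq_zero] at this
    have := mul_pos (om_pos hr0) (ks_pos hr0 x y)
    linarith
  rw [ae_iff] at h3
  simp only [not_not] at h3
  have h5 : volume (Set.Ioi (0:ℝ)) = 0 := h3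
  rw [Real.volume_Ioi] at h5
  simp at h5

theorem gl_fin {γ ε : ℝ} (hγ : 0 < γ) (h1 : ε ≤ 1) (x : E3) :
    ∀ᵐ y ∂(nu γ ε), gl (Set.Ioi 0) x y < ⊤ :=
  ae_lt_top (gl_sec _ x) ((gl_tot' hγ h1 x).trans_lt ENNReal.ofReal_lt_top).ne

def D0 (γ : ℝ) : ℝ := Bf (nu γ 0) Gk (Eo.indicator fun _ => 1) (Eo.indicator fun _ => 1)

theorem ind_sq {γ : ℝ} (hγ : 0 < γ) (ε : ℝ) :
    Integrable (fun y => (Eo.indicator (fun _ => (1:ℝ)) y) ^ 2) (nu γ ε) := by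
  have := nu_fin hγ ε
  have : (fun y => (Eo.indicator (fun _ => (1:ℝ)) y) ^ 2) = Eo.indicator (fun _ => (1:ℝ)) := by
    funext y; by_cases hy : y ∈ Eo <;> simp [hy]
  rw [this]
  exact (integrable_const 1).indicator Eo_meas

theorem D0_pos {γ : ℝ} (hγ : 0 < γ) : 0 < D0 γ := by
  have := nu_fin hγ 0
  have hk := Gk_ker hγ (zero_le_one : (0:ℝ) ≤ 1)
  have hm : Measurable (Eo.indicator (fun _ => (1:ℝ))) := measurable_const.indicator Eo_meas
  have hi := hk.intg hm (ind_sq hγ 0) hm (ind_sq hγ 0)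
  have hnn : ∀ z : E3 × E3, 0 ≤ Gk z.1 z.2 * Eo.indicator (fun _ => (1:ℝ)) z.1 * Eo.indicator (fun _ => (1:ℝ)) z.2 :=
    fun z => mul_nonneg (mul_nonneg (hk.nn _ _) (Set.indicator_nonneg (fun _ _ => zero_le_one) _))
      (Set.indicator_nonneg (fun _ _ => zero_le_one) _)
  have h0 : 0 ≤ D0 γ := integral_nonneg hnn
  refine lt_of_le_of_ne h0 fun h => ?_
  have h2 := (integral_eq_zero_iff_of_nonneg hnn hi).1 h.symm
  have h3 := Measure.ae_ae_of_ae_prod h2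
  have hE : ∀ᵐ y ∂(nu γ 0), y ∈ Eo := by
    have : nu γ 0 = nu0 γ := by simp [nu]
    rw [this]; exact nu0_Eo γ
  have h4 : ∀ᵐ x ∂(nu γ 0), ∀ᵐ y ∂(nu γ 0), False := by
    filter_upwards [h3, hE] with x hx hxE
    filter_upwards [hx, hE, gl_fin hγ zero_le_one x] with y hy hyE hg
    simp only [hxE, hyE, Set.indicator_of_mem, mul_one, Pi.zero_apply] at hy
    exact (ENNReal.toReal_pos (gl_pos x y) hg.ne).ne' hy
  have hne : nu γ 0 ≠ 0 := by
    intro h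
    have h5 := nu_Eo γ 0
    rw [h] at h5
    exact (nu0_pos γ).ne h5
  have : NeBot (ae (nu γ 0)) := ae_neBot.2 hne
  obtain ⟨x, hx⟩ := h4.exists
  obtain ⟨y, hy⟩ := hx.exists
  exact hy

def m0 (γ : ℝ) : ℝ := (nu0 γ).real Set.univ
theorem m0_pos {γ : ℝ} (hγ : 0 < γ) : 0 < m0 γ := by
  have := nu0_fin hγ
  exact ENNReal.toReal_pos (nu0_pos γ).ne' (measure_ne_top _ _)

theorem D0_le {γ ε : ℝ} (hγ : 0 < γ) (h0 : 0 ≤ ε) (h1 : ε ≤ 1) :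
    D0 γ ≤ Bf (nu γ ε) Gk (Eo.indicator fun _ => 1) (Eo.indicator fun _ => 1) := by
  have := nu_fin hγ 0
  have := nu_fin hγ ε
  have hk := Gk_ker hγ h1
  have hm : Measurable (Eo.indicator (fun _ => (1:ℝ))) := measurable_const.indicator Eo_meas
  have hi := hk.intg hm (ind_sq hγ ε) hm (ind_sq hγ ε)
  unfold D0 Bf
  have hle : nu γ 0 ≤ nu γ ε := by
    unfold nu
    have : ENNReal.ofReal 0 ≤ ENNReal.ofReal ε := ENNReal.ofReal_le_ofReal h0
    gcongr
  refine integral_mono_measure (Measure.prod_mono hle hle) (Eventually.of_forall fun z => ?_) hi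
  exact mul_nonneg (mul_nonneg (hk.nn _ _) (Set.indicator_nonneg (fun _ _ => zero_le_one) _))
      (Set.indicator_nonneg (fun _ _ => zero_le_one) _)

def Vf (γ ε : ℝ) (w : E3 → ℝ) (x : E3) : ENNReal :=
  ∫⁻ y, gl (Set.Ioi 0) x y * ENNReal.ofReal (w y) ∂(nu γ ε)

theorem exists_w {p : ℝ} (hp1 : 2 < p) (hp2 : p ≤ 4) : ∃ Cst M0 : ℝ, 0 < Cst ∧ 1 ≤ M0 ∧
    ∀ ε M : ℝ, 0 < ε → ε ≤ 1 → M0 ≤ M → ∃ w, Adm (nu (p - 2) ε) w ∧ ¬ (w =ᵐ[nu (p - 2) ε] 0) ∧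
      (∀ᵐ x ∂(nu (p - 2) ε), Vf (p - 2) ε w x ≠ ⊤ ∧ w x = fi p ε M x (Vf (p - 2) ε w x).toReal) ∧
      Integrable (fun x => (Vf (p - 2) ε w x).toReal ^ 2) (nu (p - 2) ε) ∧
      ∫⁻ x, ENNReal.ofReal (min (Vf (p - 2) ε w x).toReal M ^ p) ∂(nu0 (p - 2)) ≤ ENNReal.ofReal Cst := by
  have hγ : 0 < p - 2 := by linarith
  set Λ := m0 (p - 2) / D0 (p - 2) with hΛd
  have hm0 := m0_pos hγ
  have hD0 := D0_pos hγ
  have hΛ : 0 < Λ := by positivity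
  set τ := Λ ^ (1 / (p - 2)) with hτd
  have hτ : 0 < τ := by positivity
  have hτΛ : τ ^ (p - 1) = Λ * τ := by
    rw [show p - 1 = (p - 2) + 1 by ring, Real.rpow_add hτ, Real.rpow_one, hτd, ← Real.rpow_mul hΛ.le]
    rw [show 1 / (p - 2) * (p - 2) = 1 by field_simp, Real.rpow_one]
  set CΛ := Λ * τ ^ 2 / 2 with hC
  have hp12 : 0 < 1 / 2 - 1 / p := by
    have : 1 / p < 1 / 2 := one_div_lt_one_div_of_lt (by norm_num) hp1
    linarith
  refine ⟨CΛ * m0 (p - 2) / (1 / 2 - 1 / p), max 1 τ, by positivity, le_max_left _ _, ?_⟩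
  intro ε M hε hε1 hM0
  have hM : 1 ≤ M := (le_max_left _ _).trans hM0
  have hMτ : τ ≤ M := (le_max_right _ _).trans hM0
  have := nu_fin hγ ε
  have hd := fi_dat hp1 hp2 hε hε1 hM
  have hre : (nu (p - 2) ε).real Eo = m0 (p - 2) := by
    rw [measureReal_def, nu_Eo]; rfl
  obtain ⟨w, hw, hB, h1, h2, h3, h4, h5⟩ := hd.solve Eo_meas (by rw [hre]; exact hm0) (CΛ := CΛ) hΛ
    (by
      intro y hy s hs
      have a := TF_b (r := p - 1) (by linarith) hM hτ.le hs
      rw [Tp_of_le hMτ, hτΛ] at a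
      have b := TF_nn (r := p - 1) (by linarith) hM hτ.le
      have c := TF_nn (r := 5) (by norm_num) hM hs
      have hk0 : 0 ≤ kap p y := by unfold kap; positivity
      have d : 0 ≤ (ε ^ 2 * kap p y) * TF 5 M s := mul_nonneg (by positivity) c
      unfold Fi
      simp only [hy, if_true]
      have e : Λ * (s ^ 2 - τ ^ 2) ≤ 2 * (TF (p - 1) M s - TF (p - 1) M τ) := by
        have : τ * (Λ * (s ^ 2 - τ ^ 2)) ≤ τ * (2 * (TF (p - 1) M s - TF (p - 1) M τ)) := by linarith
        exact le_of_mul_le_mul_left this hτ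
      rw [hC]
      linarith) (by
      rw [hre]
      calc m0 (p - 2) = Λ * D0 (p - 2) := by rw [hΛd]; field_simp
        _ ≤ _ := mul_le_mul_of_nonneg_left (D0_le hγ hε.le hε1) hΛ.le)
  have hV : ∀ᵐ x ∂(nu (p - 2) ε), Vf (p - 2) ε w x = ENNReal.ofReal (∫ y, Gk x y * w y ∂(nu (p - 2) ε)) := by
    filter_upwards [h2] with x hx
    rw [ofReal_integral_eq_lintegral_ofReal hx (Eventually.of_forall fun y =>
      mul_nonneg (hd.ker.nn _ _) (hw.nn y))]
    unfold Vf
    refine lintegral_congr_ae ?_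
    filter_upwards [gl_fin hγ hε1 x] with y hy
    rw [ENNReal.ofReal_mul (hd.ker.nn _ _), Gk, ENNReal.ofReal_toReal hy.ne]
  have hnn : ∀ x, 0 ≤ ∫ y, Gk x y * w y ∂(nu (p - 2) ε) := fun x =>
    integral_nonneg fun y => mul_nonneg (hd.ker.nn _ _) (hw.nn y)
  have hVt : ∀ᵐ x ∂(nu (p - 2) ε), (Vf (p - 2) ε w x).toReal = gi (fi p ε M x) (w x) := by
    filter_upwards [hV, h5] with x hx hx5
    rw [hx, ENNReal.toReal_ofReal (hnn x), hx5]
  have hle : nu0 (p - 2) ≤ nu (p - 2) ε := by unfold nu; exact Measure.le_add_right le_rfl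
  refine ⟨w, hw, hw.int_pos hB, ?_, ?_, ?_⟩
  · filter_upwards [hV, h1] with x hx hx1
    rw [hx, ENNReal.toReal_ofReal (hnn x)]
    exact ⟨ENNReal.ofReal_ne_top, hx1⟩
  · refine (hd.gsq hw).congr ?_
    filter_upwards [hVt] with x hx
    rw [hx]
  · have hHnn : ∀ x, 0 ≤ fi p ε M x (gi (fi p ε M x) (w x)) * gi (fi p ε M x) (w x) / 2
        - Fi p ε M x (gi (fi p ε M x) (w x)) := fun x =>
      Hi_nn hp1 hp2 hε hε1 hM x ((hd.nl x).gnn _)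
    have key : ∫⁻ x, ENNReal.ofReal (1 / 2 - 1 / p) *
        ENNReal.ofReal (min (Vf (p - 2) ε w x).toReal M ^ p) ∂(nu0 (p - 2)) ≤ ENNReal.ofReal (CΛ * m0 (p - 2)) := by
      calc _ ≤ ∫⁻ x, ENNReal.ofReal (fi p ε M x (gi (fi p ε M x) (w x)) * gi (fi p ε M x) (w x) / 2
            - Fi p ε M x (gi (fi p ε M x) (w x))) ∂(nu0 (p - 2)) := by
            refine lintegral_mono_ae ?_
            filter_upwards [ae_mono hle hVt, nu0_Eo (p - 2)] with x hx hxE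
            rw [hx, ← ENNReal.ofReal_mul hp12.le]
            exact ENNReal.ofReal_le_ofReal (Hi_low hp1 hp2 hε hε1 hM hxE ((hd.nl x).gnn _))
        _ ≤ ∫⁻ x, ENNReal.ofReal (fi p ε M x (gi (fi p ε M x) (w x)) * gi (fi p ε M x) (w x) / 2
            - Fi p ε M x (gi (fi p ε M x) (w x))) ∂(nu (p - 2) ε) := lintegral_mono' hle le_rfl
        _ ≤ _ := by
            rw [← ofReal_integral_eq_lintegral_ofReal h3 (Eventually.of_forall hHnn)]
            rw [hre] at h4
            exact ENNReal.ofReal_le_ofReal h4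
    rw [lintegral_const_mul' _ _ ENNReal.ofReal_ne_top] at key
    rw [ENNReal.ofReal_div_of_pos hp12, ENNReal.le_div_iff_mul_le (Or.inl (by simpa using hp12)) (Or.inl ENNReal.ofReal_ne_top), mul_comm]
    exact key

end Ham

namespace Ham

theorem contr {Y : Type*} [MeasurableSpace Y] {ν : Measure Y} [SFinite ν] {g : Y → Y → ENNReal}
    (hg : Measurable fun z : Y × Y => g z.1 z.2) (hs : ∀ x y, g x y = g y x) {c v : Y → ENNReal}
    (hc : Measurable c) (hv : Measurable v) {H B : ENNReal} (hH : H * 2 = 1)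
    (h1 : ∀ x, ∫⁻ y, g x y * c y ∂ν ≤ H) (hB : B ≠ ⊤)
    (h2 : ∀ᵐ x ∂ν, v x ≤ B + ∫⁻ y, g x y * (c y * v y) ∂ν) (h3 : ∫⁻ y, c y * v y ∂ν ≠ ⊤) :
    ∀ᵐ x ∂ν, v x ≤ 2 * B := by
  set z : Y → ENNReal := fun x => v x - 2 * B with hz
  have hzm : Measurable z := hv.sub_const _
  have gx : ∀ x, Measurable fun y => g x y := fun x =>
    Measurable.of_uncurry_left (f := g) hg
  have hHB : 2 * B * H = B := by rw [mul_comm, ← mul_assoc, hH, one_mul]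
  have hzle : ∀ᵐ x ∂ν, z x ≤ ∫⁻ y, g x y * (c y * z y) ∂ν := by
    filter_upwards [h2] with x hx
    rw [hz]
    simp only
    rw [tsub_le_iff_left]
    refine hx.trans ?_
    have : ∀ y, g x y * (c y * v y) ≤ (g x y * c y) * (2 * B) + g x y * (c y * z y) := by
      intro y
      have : v y ≤ 2 * B + z y := le_add_tsub
      calc g x y * (c y * v y) ≤ g x y * (c y * (2 * B + z y)) := by gcongr
        _ = _ := by ring
    calc _ ≤ B + ∫⁻ y, (g x y * c y) * (2 * B) + g x y * (c y * z y) ∂ν := by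
          gcongr with y; exact this y
      _ = B + ((∫⁻ y, (g x y * c y) ∂ν) * (2 * B) + ∫⁻ y, g x y * (c y * z y) ∂ν) := by
          have m1 : Measurable fun y => g x y * c y := (gx x).mul hc
          rw [lintegral_add_left (m1.mul_const _), lintegral_mul_const _ m1]
      _ ≤ B + (H * (2 * B) + ∫⁻ y, g x y * (c y * z y) ∂ν) := by gcongr; exact h1 x
      _ = _ := by rw [mul_comm H, hHB]; ring
  set I := ∫⁻ y, c y * z y ∂ν with hI
  have hIt : I ≠ ⊤ := by
    refine ne_top_of_le_ne_top h3 (lintegral_mono fun y => ?_)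
    gcongr; exact tsub_le_self
  have hII : I ≤ H * I := by
    calc I ≤ ∫⁻ x, c x * ∫⁻ y, g x y * (c y * z y) ∂ν ∂ν := by
          refine lintegral_mono_ae ?_
          filter_upwards [hzle] with x hx
          gcongr
      _ = ∫⁻ x, ∫⁻ y, c x * (g x y * (c y * z y)) ∂ν ∂ν := by
          refine lintegral_congr fun x => ?_
          have m1 : Measurable fun y => g x y * (c y * z y) := (gx x).mul (hc.mul hzm)
          rw [lintegral_const_mul _ m1]
      _ = ∫⁻ y, ∫⁻ x, c x * (g x y * (c y * z y)) ∂ν ∂ν := by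
          rw [lintegral_lintegral_swap]
          have : Measurable fun q : Y × Y => c q.1 * (g q.1 q.2 * (c q.2 * z q.2)) :=
            (hc.comp measurable_fst).mul (hg.mul ((hc.comp measurable_snd).mul (hzm.comp measurable_snd)))
          exact this.aemeasurable
      _ = ∫⁻ y, (∫⁻ x, g y x * c x ∂ν) * (c y * z y) ∂ν := by
          refine lintegral_congr fun y => ?_
          have m1 : Measurable fun x => g y x * c x := (gx y).mul hc
          rw [← lintegral_mul_const _ m1]
          refine lintegral_congr fun x => ?_
          rw [hs x y]; ring
      _ ≤ ∫⁻ y, H * (c y * z y) ∂ν := by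
          gcongr with y; exact h1 y
      _ = H * I := by
          have m1 : Measurable fun y => c y * z y := hc.mul hzm
          rw [lintegral_const_mul _ m1]
  have hI0 : I = 0 := by
    by_contra hne
    have h4 : I + I ≤ I := by
      calc I + I ≤ H * I + H * I := add_le_add hII hII
        _ = (H * 2) * I := by ring
        _ = I := by rw [hH, one_mul]
    have h5 : I < I + I := ENNReal.lt_add_right hIt hne
    exact absurd h4 (not_le.2 h5)
  have mcz : Measurable fun y => c y * z y := hc.mul hzm
  rw [hI, lintegral_eq_zero_iff mcz] at hI0
  filter_upwards [hzle] with x hx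
  have : ∫⁻ y, g x y * (c y * z y) ∂ν = 0 := by
    have mg : Measurable fun y => g x y * (c y * z y) := (gx x).mul mcz
    rw [lintegral_eq_zero_iff mg]
    filter_upwards [hI0] with y hy
    simp only [Pi.zero_apply] at hy ⊢
    rw [hy, mul_zero]
  rw [this] at hx
  simpa [hz, tsub_eq_zero_iff_le] using hx

theorem gl_alpha {γ δ A B : ℝ} (hγ : 0 < γ) (hδ : 0 < δ) {α : E3 → ℝ} (hα : Measurable α)
    (h0 : ∀ y, 0 ≤ α y) (hA : 0 ≤ A) (hB : 0 ≤ B)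
    (h2 : ∫⁻ y, ENNReal.ofReal (α y ^ 2) ∂(nu0 γ) ≤ ENNReal.ofReal A)
    (h1 : ∫⁻ y, ENNReal.ofReal (α y) ∂(nu0 γ) ≤ ENNReal.ofReal B) (x : E3) :
    ∫⁻ y, gl (Set.Ioi 0) x y * ENNReal.ofReal (α y) ∂(nu0 γ)
      ≤ ENNReal.ofReal (2 / c4 * (c4 + A) * δ ^ (1 / 2 : ℝ) + 2 / c4 / δ * B) := by
  have := nu0_fin hγ
  have h4 := c4_pos
  simp_rw [gl_add hδ, add_mul]
  have m1 : Measurable fun y => gl (Set.Ioc 0 δ) x y * ENNReal.ofReal (α y) := (gl_sec _ x).mul hα.ennreal_ofReal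
  rw [lintegral_add_left m1, ENNReal.ofReal_add (by positivity) (by positivity)]
  refine add_le_add ?_ ?_
  · rw [gl_ton _ _ x hα.ennreal_ofReal]
    have hi : IntegrableOn (fun r : ℝ => (c4 + A) / c4 * r ^ (-(1 / 2) : ℝ)) (Set.Ioc 0 δ) := by
      have := (intervalIntegral.intervalIntegrable_rpow' (a := 0) (b := δ) (r := -(1/2)) (by norm_num)).const_mul ((c4 + A) / c4)
      rwa [intervalIntegrable_iff_integrableOn_Ioc_of_le hδ.le] at this
    calc _ ≤ ∫⁻ r in Set.Ioc 0 δ, ENNReal.ofReal ((c4 + A) / c4 * r ^ (-(1 / 2) : ℝ)) := by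
          refine setLIntegral_mono (by fun_prop) fun r hr => ?_
          have hr0 := hr.1
          have e1 : ∀ y, ENNReal.ofReal (om r * ks r x y) * ENNReal.ofReal (α y)
              ≤ ENNReal.ofReal (om r / 2 * (r ^ (3/2:ℝ) * r⁻¹ ^ 3)) * ENNReal.ofReal (ks r x y)
                + ENNReal.ofReal (om r / 2 * r ^ (-(3/2):ℝ)) * ENNReal.ofReal (α y ^ 2) := by
            intro y
            have ho := om_nn hr0
            have hk := ks_nn hr0 x y
            rw [← ENNReal.ofReal_mul (mul_nonneg ho hk), ← ENNReal.ofReal_mul (by positivity),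
              ← ENNReal.ofReal_mul (by positivity), ← ENNReal.ofReal_add (by positivity) (by positivity)]
            refine ENNReal.ofReal_le_ofReal ?_
            have hs : 0 < r ^ (3/2:ℝ) := by positivity
            have hinv : r ^ (-(3/2):ℝ) = (r ^ (3/2:ℝ))⁻¹ := Real.rpow_neg hr0.le _
            rw [hinv]
            have am : 2 * (ks r x y * α y) ≤ r ^ (3/2:ℝ) * ks r x y ^ 2 + (r ^ (3/2:ℝ))⁻¹ * α y ^ 2 := by
              have hid : r ^ (3/2:ℝ) * ks r x y ^ 2 + (r ^ (3/2:ℝ))⁻¹ * α y ^ 2 - 2 * (ks r x y * α y)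
                = (r ^ (3/2:ℝ))⁻¹ * (r ^ (3/2:ℝ) * ks r x y - α y) ^ 2 := by field_simp; ring
              have : 0 ≤ (r ^ (3/2:ℝ))⁻¹ * (r ^ (3/2:ℝ) * ks r x y - α y) ^ 2 := by positivity
              linarith
            have kk : ks r x y ^ 2 ≤ r⁻¹ ^ 3 * ks r x y := by
              rw [sq]; exact mul_le_mul_of_nonneg_right (ks_le hr0 x y) hk
            have : r ^ (3/2:ℝ) * ks r x y ^ 2 ≤ r ^ (3/2:ℝ) * (r⁻¹ ^ 3 * ks r x y) :=
              mul_le_mul_of_nonneg_left kk hs.le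
            have := mul_le_mul_of_nonneg_left (am.trans (add_le_add_left this _)) (by positivity : 0 ≤ om r / 2)
            nlinarith
          refine (lintegral_mono e1).trans ?_
          have mk := (ks_sec r x).ennreal_ofReal
          have ma : Measurable fun y => ENNReal.ofReal (α y ^ 2) := (hα.pow_const 2).ennreal_ofReal
          rw [lintegral_add_left (mk.const_mul _), lintegral_const_mul _ mk, lintegral_const_mul _ ma]
          have kb := ks_int hr0 (fun x => kv_nu0 hγ.le hr0 x) x
          refine (add_le_add (mul_le_mul_right kb _) (mul_le_mul_right h2 _)).trans ?_
          have ho := om_nn hr0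
          rw [← ENNReal.ofReal_mul (by positivity),
              ← ENNReal.ofReal_mul (by positivity), ← ENNReal.ofReal_add (by positivity) (by positivity)]
          refine ENNReal.ofReal_le_ofReal ?_
          have e3 : r ^ (3/2:ℝ) * r⁻¹ ^ 3 = r ^ (-(3/2):ℝ) := by
            rw [inv_pow, ← Real.rpow_natCast, ← Real.rpow_neg hr0.le, ← Real.rpow_add hr0]; norm_num
          rw [e3]
          have e4 : r * r ^ (-(3/2):ℝ) = r ^ (-(1/2):ℝ) := by
            rw [← Real.rpow_one_add' hr0.le (by norm_num)]; norm_num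
          calc _ = om r * ((c4 + A) / 2 * r ^ (-(3/2):ℝ)) := by ring
            _ ≤ 2 / c4 * r * ((c4 + A) / 2 * r ^ (-(3/2):ℝ)) :=
              mul_le_mul_of_nonneg_right (om_le hr0) (by positivity)
            _ = (c4 + A) / c4 * (r * r ^ (-(3/2):ℝ)) := by ring
            _ = _ := by rw [e4]
      _ = _ := by
        rw [← ofReal_integral_eq_lintegral_ofReal hi
          ((ae_restrict_iff' measurableSet_Ioc).2 (Eventually.of_forall fun r hr => by
            have hr0 : 0 < r := hr.1
            positivity)), integral_const_mul, ← intervalIntegral.integral_of_le hδ.le,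
            integral_rpow (by left; norm_num)]
        congr 1
        rw [show (-(1/2):ℝ) + 1 = 1/2 by norm_num, Real.zero_rpow (by norm_num)]
        ring
  · calc _ ≤ ∫⁻ y, ENNReal.ofReal (2 / c4 / δ) * ENNReal.ofReal (α y) ∂(nu0 γ) := by
          gcongr with y; exact gl_large hδ x y
      _ = ENNReal.ofReal (2 / c4 / δ) * ∫⁻ y, ENNReal.ofReal (α y) ∂(nu0 γ) := by
          rw [lintegral_const_mul _ hα.ennreal_ofReal]
      _ ≤ ENNReal.ofReal (2 / c4 / δ) * ENNReal.ofReal B := by gcongr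
      _ = _ := by rw [← ENNReal.ofReal_mul (by positivity)]

end Ham

namespace Ham

theorem Vf_meas (γ ε : ℝ) [SFinite (nu γ ε)] {w : E3 → ℝ} (hw : Measurable w) : Measurable (Vf γ ε w) := by
  unfold Vf
  have : Measurable fun z : E3 × E3 => gl (Set.Ioi 0) z.1 z.2 * ENNReal.ofReal (w z.2) :=
    (gl_meas _).mul (hw.comp measurable_snd).ennreal_ofReal
  exact this.lintegral_prod_right'

open Classical in
def cf (p ε M k : ℝ) (v : E3 → ℝ) (y : E3) : ℝ :=
  if y ∈ Eo then (p - 1) * (if k < v y then min (v y) M ^ (p - 2) else 0) + 5 * ε ^ 2 * M ^ 4 else 3 * M ^ 2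

theorem cf_meas (p ε M k : ℝ) {v : E3 → ℝ} (hv : Measurable v) : Measurable (cf p ε M k v) := by
  classical
  unfold cf
  refine Measurable.ite Eo_meas ?_ measurable_const
  refine Measurable.add_const (Measurable.const_mul (Measurable.ite (measurableSet_lt measurable_const hv) ?_ measurable_const) _) _
  exact (hv.min measurable_const).pow_const _

theorem fi_le_cf {p ε M k : ℝ} (hp1 : 2 < p) (hp2 : p ≤ 4) (hε : 0 < ε) (hM : 1 ≤ M) (hk : 1 ≤ k) (hkM : k ≤ M)
    {v : E3 → ℝ} (y : E3) (h0 : 0 ≤ v y) :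
    fi p ε M y (v y) ≤ cf p ε M k v y * v y + (p - 1) * k ^ (p - 1) := by
  have hkp : 0 ≤ (p - 1) * k ^ (p - 1) := mul_nonneg (by linarith) (by positivity)
  unfold fi cf
  split_ifs with h h2
  · have t1 := Tp_le_min (r := p - 1) (by linarith) hM h0
    rw [show p - 1 - 1 = p - 2 by ring] at t1
    have t2 := Tp_Q (r := 5) (by norm_num) hM h0
    have hk1 := kap_le hp2 y
    have t3 : ε ^ 2 * kap p y * Tp 5 M (v y) ≤ ε ^ 2 * Tp 5 M (v y) := by
      have := Tp_nn (r := 5) (by norm_num) hM h0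
      have : 0 ≤ ε ^ 2 * Tp 5 M (v y) := by positivity
      nlinarith
    rw [show (5:ℝ) - 1 = ((4:ℕ):ℝ) by norm_num, Real.rpow_natCast] at t2
    have : ε ^ 2 * Tp 5 M (v y) ≤ ε ^ 2 * (5 * M ^ 4 * v y) := mul_le_mul_of_nonneg_left t2 (by positivity)
    nlinarith
  · have hv : v y ≤ k := not_lt.1 h2
    have t1 : Tp (p - 1) M (v y) ≤ (p - 1) * k ^ (p - 1) := by
      rw [Tp_of_le (hv.trans hkM)]
      have : v y ^ (p - 1) ≤ k ^ (p - 1) := Real.rpow_le_rpow h0 hv (by linarith)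
      have h3 : 0 ≤ k ^ (p - 1) := by positivity
      nlinarith
    have t2 := Tp_Q (r := 5) (by norm_num) hM h0
    have hk1 := kap_le hp2 y
    have t3 : ε ^ 2 * kap p y * Tp 5 M (v y) ≤ ε ^ 2 * Tp 5 M (v y) := by
      have := Tp_nn (r := 5) (by norm_num) hM h0
      have : 0 ≤ ε ^ 2 * Tp 5 M (v y) := by positivity
      nlinarith
    rw [show (5:ℝ) - 1 = ((4:ℕ):ℝ) by norm_num, Real.rpow_natCast] at t2
    have : ε ^ 2 * Tp 5 M (v y) ≤ ε ^ 2 * (5 * M ^ 4 * v y) := mul_le_mul_of_nonneg_left t2 (by positivity)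
    nlinarith
  · have t2 := Tp_Q (r := 3) (by norm_num) hM h0
    rw [show (3:ℝ) - 1 = ((2:ℕ):ℝ) by norm_num, Real.rpow_natCast] at t2
    linarith

theorem cf_int {p ε M k δ Cst : ℝ} (hp1 : 2 < p) (hp2 : p ≤ 4) (hε : 0 < ε) (hε1 : ε ≤ 1) (hM : 1 ≤ M)
    (hk : 1 ≤ k) (hkM : k ≤ M) (hδ : 0 < δ) (hC : 0 < Cst)
    {v : E3 → ℝ} (hv : Measurable v) (h0 : ∀ y, 0 ≤ v y)
    (h : ∫⁻ x, ENNReal.ofReal (min (v x) M ^ p) ∂(nu0 (p - 2)) ≤ ENNReal.ofReal Cst) (x : E3) :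
    ∫⁻ y, gl (Set.Ioi 0) x y * ENNReal.ofReal (cf p ε M k v y) ∂(nu (p - 2) ε)
      ≤ ENNReal.ofReal ((p - 1) * (2 / c4 * (c4 + Cst) * δ ^ (1 / 2 : ℝ) + 2 / c4 / δ * (Cst / k ^ 2))
        + 5 * ε ^ 2 * M ^ 4 * Sc (p - 2) + ε * (3 * M ^ 2 * Sc (p - 2))) := by
  have hγ : 0 < p - 2 := by linarith
  have h4 := c4_pos
  have hS := Sc_pos (p - 2)
  have hk0 : 0 < k := by linarith
  have hp' : 0 < p - 1 := by linarith
  set α : E3 → ℝ := fun y => if k < v y then min (v y) M ^ (p - 2) else 0 with hα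
  have hαm : Measurable α :=
    Measurable.ite (measurableSet_lt measurable_const hv) ((hv.min measurable_const).pow_const _) measurable_const
  have hα0 : ∀ y, 0 ≤ α y := fun y => by
    simp only [hα]; split_ifs
    · have : 0 ≤ min (v y) M := le_min (h0 y) (by linarith)
      positivity
    · exact le_rfl
  have b2 : ∀ y, α y ^ 2 ≤ min (v y) M ^ p := fun y => by
    have hm : 0 ≤ min (v y) M := le_min (h0 y) (by linarith)
    simp only [hα]; split_ifs with hky
    · have hm1 : 1 ≤ min (v y) M := le_min (hk.trans hky.le) hM
      rw [← Real.rpow_natCast, ← Real.rpow_mul hm]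
      refine Real.rpow_le_rpow_of_exponent_le hm1 ?_
      push_cast; linarith
    · simp; positivity
  have b1 : ∀ y, α y ≤ (k ^ 2)⁻¹ * min (v y) M ^ p := fun y => by
    have hm : 0 ≤ min (v y) M := le_min (h0 y) (by linarith)
    simp only [hα]; split_ifs with hky
    · have hm1 : k ≤ min (v y) M := le_min hky.le hkM
      have : min (v y) M ^ p = min (v y) M ^ (p - 2) * min (v y) M ^ 2 := by
        rw [← Real.rpow_natCast, ← Real.rpow_add (by linarith)]; norm_num
      rw [this]
      have h2 : k ^ 2 ≤ min (v y) M ^ 2 := by gcongr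
      have h3 : 0 ≤ min (v y) M ^ (p - 2) := by positivity
      rw [inv_mul_eq_div, le_div_iff₀ (by positivity)]
      exact mul_le_mul_of_nonneg_left h2 h3
    · positivity
  have hmm : Measurable fun y => ENNReal.ofReal (min (v y) M ^ p) := ((hv.min measurable_const).pow_const _).ennreal_ofReal
  have key := gl_alpha hγ hδ hαm hα0 hC.le (B := Cst / k ^ 2) (by positivity)
    ((lintegral_mono fun y => ENNReal.ofReal_le_ofReal (b2 y)).trans h) (by
      calc _ ≤ ∫⁻ y, ENNReal.ofReal ((k ^ 2)⁻¹) * ENNReal.ofReal (min (v y) M ^ p) ∂(nu0 (p - 2)) := by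
            refine lintegral_mono fun y => ?_
            rw [← ENNReal.ofReal_mul (by positivity)]
            exact ENNReal.ofReal_le_ofReal (b1 y)
        _ ≤ _ := by
            rw [lintegral_const_mul _ hmm, div_eq_inv_mul, ENNReal.ofReal_mul (by positivity)]
            gcongr) x
  have tot := gl_tot hγ x
  rw [lint_nu] at tot ⊢
  rw [ENNReal.ofReal_one, one_mul] at tot
  have tot0 := le_self_add.trans tot
  have totb := le_add_self.trans tot
  have g1 := gl_sec (Set.Ioi 0) x
  have P1 : 0 ≤ (p - 1) * (2 / c4 * (c4 + Cst) * δ ^ (1 / 2 : ℝ) + 2 / c4 / δ * (Cst / k ^ 2)) := by positivity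
  rw [ENNReal.ofReal_add (by positivity) (by positivity), ENNReal.ofReal_add (by positivity) (by positivity)]
  refine add_le_add ?_ ?_
  · have m1 : Measurable fun y => gl (Set.Ioi 0) x y * ENNReal.ofReal (α y) := g1.mul hαm.ennreal_ofReal
    calc _ ≤ ∫⁻ y, ENNReal.ofReal (p - 1) * (gl (Set.Ioi 0) x y * ENNReal.ofReal (α y))
              + ENNReal.ofReal (5 * ε ^ 2 * M ^ 4) * gl (Set.Ioi 0) x y ∂(nu0 (p - 2)) := by
            refine lintegral_mono_ae ?_
            filter_upwards [nu0_Eo (p - 2)] with y hy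
            rw [cf, if_pos hy, ENNReal.ofReal_add (mul_nonneg hp'.le (hα0 y)) (by positivity), ENNReal.ofReal_mul hp'.le]
            apply le_of_eq
            simp only [hα]
            ring
      _ = ENNReal.ofReal (p - 1) * (∫⁻ y, (gl (Set.Ioi 0) x y * ENNReal.ofReal (α y)) ∂(nu0 (p - 2)))
              + ENNReal.ofReal (5 * ε ^ 2 * M ^ 4) * ∫⁻ y, gl (Set.Ioi 0) x y ∂(nu0 (p - 2)) := by
            rw [lintegral_add_left (m1.const_mul _), lintegral_const_mul _ m1, lintegral_const_mul _ g1]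
      _ ≤ _ := by
            rw [ENNReal.ofReal_mul hp'.le, ENNReal.ofReal_mul (p := 5 * ε ^ 2 * M ^ 4) (by positivity)]
            gcongr
  · rw [ENNReal.ofReal_mul hε.le]
    refine mul_le_mul_right ?_ _
    have hb : ∀ᵐ y ∂nub, y ∉ Eo := by
      rw [ae_iff]; simpa using nub_Eo
    calc _ ≤ ∫⁻ y, ENNReal.ofReal (3 * M ^ 2) * gl (Set.Ioi 0) x y ∂nub := by
          refine lintegral_mono_ae ?_
          filter_upwards [hb] with y hy
          rw [cf, if_neg hy, mul_comm]
      _ ≤ _ := by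
          rw [lintegral_const_mul _ g1, ENNReal.ofReal_mul (q := Sc (p - 2)) (by positivity)]
          exact mul_le_mul_right totb _

set_option maxHeartbeats 1000000 in
theorem sup_bd {p : ℝ} (hp1 : 2 < p) (hp2 : p ≤ 4) : ∃ M ε0 : ℝ, 1 ≤ M ∧ 0 < ε0 ∧ ε0 ≤ 1 ∧
    ∀ ε, 0 < ε → ε ≤ ε0 → ∃ w : E3 → ℝ, Measurable w ∧ (∀ y, 0 ≤ w y) ∧ ¬ (w =ᵐ[nu (p - 2) ε] 0) ∧
      (∀ᵐ x ∂(nu (p - 2) ε), w x = fi p ε M x (Vf (p - 2) ε w x).toReal) ∧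
      ∀ x, Vf (p - 2) ε w x ≤ ENNReal.ofReal M := by
  obtain ⟨Cst, M0, hC, hM0, H⟩ := exists_w hp1 hp2
  have hγ : 0 < p - 2 := by linarith
  have h4 := c4_pos
  have hS := Sc_pos (p - 2)
  set d := c4 / (48 * (c4 + Cst)) with hd
  have hd0 : 0 < d := by positivity
  set k := 1 + 48 * Cst / (c4 * d ^ 2) with hk
  have hk1 : 1 ≤ k := by rw [hk]; have : 0 ≤ 48 * Cst / (c4 * d ^ 2) := by positivity
                         linarith
  have hk0 : 0 < k := by linarith
  set b := (p - 1) * k ^ (p - 1) with hb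
  have hb0 : 0 < b := mul_pos (by linarith) (by positivity)
  set B := b * Sc (p - 2) with hB
  have hB0 : 0 < B := by positivity
  set M := M0 + k + 2 * B with hM
  have hM1 : 1 ≤ M := by linarith
  have hMk : k ≤ M := by linarith
  have hMB : 2 * B ≤ M := by linarith
  set e0 := 1 / (32 * M ^ 4 * Sc (p - 2)) with he0
  have hMp : 0 < M := by linarith
  have he00 : 0 < e0 := by positivity
  refine ⟨M, min 1 e0, hM1, lt_min one_pos he00, min_le_left _ _, ?_⟩
  intro ε hε hεe
  have hε1 : ε ≤ 1 := hεe.trans (min_le_left _ _)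
  have hεe0 : ε ≤ e0 := hεe.trans (min_le_right _ _)
  obtain ⟨w, hw, hw0, hae, hint, hbd⟩ := H ε M hε hε1 (by linarith)
  have hfin := nu_fin hγ ε
  refine ⟨w, hw.meas, hw.nn, hw0, hae.mono fun x hx => hx.2, ?_⟩
  set V := Vf (p - 2) ε w with hV
  have hVm : Measurable V := Vf_meas _ _ hw.meas
  set v : E3 → ℝ := fun x => (V x).toReal with hv
  have hvm : Measurable v := hVm.ennreal_toReal
  have hv0 : ∀ x, 0 ≤ v x := fun x => ENNReal.toReal_nonneg
  have hci := fun x => cf_int (δ := d ^ 2) hp1 hp2 hε hε1 hM1 hk1 hMk (by positivity) hC hvm hv0 hbd x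
  have hhalf : ((p - 1) * (2 / c4 * (c4 + Cst) * (d ^ 2) ^ (1 / 2 : ℝ) + 2 / c4 / d ^ 2 * (Cst / k ^ 2))
        + 5 * ε ^ 2 * M ^ 4 * Sc (p - 2) + ε * (3 * M ^ 2 * Sc (p - 2))) ≤ 1 / 2 := by
    have t1 : 2 / c4 * (c4 + Cst) * (d ^ 2) ^ (1 / 2 : ℝ) = 1 / 24 := by
      rw [← Real.sqrt_eq_rpow, Real.sqrt_sq hd0.le, hd]; field_simp; norm_num
    have t2 : 2 / c4 / d ^ 2 * (Cst / k ^ 2) ≤ 1 / 24 := by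
      have h1 : 48 * Cst / (c4 * d ^ 2) ≤ k := by rw [hk]; linarith
      have h2 : k ≤ k ^ 2 := by nlinarith
      have h3 : 48 * Cst / (c4 * d ^ 2) ≤ k ^ 2 := h1.trans h2
      have : 2 / c4 / d ^ 2 * (Cst / k ^ 2) = (48 * Cst / (c4 * d ^ 2)) / k ^ 2 / 24 := by field_simp; norm_num
      rw [this]
      have : (48 * Cst / (c4 * d ^ 2)) / k ^ 2 ≤ 1 := by rw [div_le_one (by positivity)]; exact h3
      linarith
    have t3 : 5 * ε ^ 2 * M ^ 4 * Sc (p - 2) + ε * (3 * M ^ 2 * Sc (p - 2)) ≤ 8 * M ^ 4 * Sc (p - 2) * ε := by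
      have e1 : ε ^ 2 ≤ ε := by nlinarith
      have e2 : M ^ 2 ≤ M ^ 4 := by gcongr; norm_num
      have e3 : 5 * ε ^ 2 * M ^ 4 * Sc (p - 2) ≤ 5 * ε * M ^ 4 * Sc (p - 2) := by gcongr
      have e4 : ε * (3 * M ^ 2 * Sc (p - 2)) ≤ ε * (3 * M ^ 4 * Sc (p - 2)) := by gcongr
      linarith
    have t4 : 8 * M ^ 4 * Sc (p - 2) * ε ≤ 1 / 4 := by
      calc 8 * M ^ 4 * Sc (p - 2) * ε ≤ 8 * M ^ 4 * Sc (p - 2) * e0 := by gcongr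
        _ = 1 / 4 := by rw [he0]; field_simp; norm_num
    rw [t1]
    have : (p - 1) * (1 / 24 + 2 / c4 / d ^ 2 * (Cst / k ^ 2)) ≤ 3 * (1 / 24 + 1 / 24) := by
      have : 0 ≤ 2 / c4 / d ^ 2 * (Cst / k ^ 2) := by positivity
      apply mul_le_mul <;> linarith
    linarith
  have hci2 : ∀ x, ∫⁻ y, gl (Set.Ioi 0) x y * ENNReal.ofReal (cf p ε M k v y) ∂(nu (p - 2) ε) ≤ ENNReal.ofReal (1 / 2) :=
    fun x => (hci x).trans (ENNReal.ofReal_le_ofReal hhalf)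
  have hcm := cf_meas p ε M k hvm
  have hVv : ∀ᵐ x ∂(nu (p - 2) ε), V x = ENNReal.ofReal (v x) := by
    filter_upwards [hae] with x hx
    rw [hv]; exact (ENNReal.ofReal_toReal hx.1).symm
  have hc0 : ∀ y, 0 ≤ cf p ε M k v y := by
    intro y
    have hp' : 0 < p - 1 := by linarith
    unfold cf
    split_ifs
    · have : 0 ≤ min (v y) M := le_min (hv0 y) (by linarith)
      positivity
    · positivity
    · positivity
  have hcle : ∀ y, cf p ε M k v y ≤ (p - 1) * M ^ (p - 2) + 5 * ε ^ 2 * M ^ 4 + 3 * M ^ 2 := by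
    intro y
    have hp' : 0 < p - 1 := by linarith
    have h3 : 0 ≤ (p - 1) * M ^ (p - 2) := by positivity
    have h4 : 0 ≤ 5 * ε ^ 2 * M ^ 4 := by positivity
    have h5 : 0 ≤ 3 * M ^ 2 := by positivity
    unfold cf
    split_ifs
    · have : min (v y) M ^ (p - 2) ≤ M ^ (p - 2) :=
        Real.rpow_le_rpow (le_min (hv0 y) (by linarith)) (min_le_right _ _) (by linarith)
      have := mul_le_mul_of_nonneg_left this hp'.le
      linarith
    · linarith
    · linarith
  have hwle : ∀ᵐ y ∂(nu (p - 2) ε), ENNReal.ofReal (w y) ≤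
      ENNReal.ofReal (cf p ε M k v y) * V y + ENNReal.ofReal b := by
    filter_upwards [hae, hVv] with y hy hy2
    rw [hy2, hy.2, ← ENNReal.ofReal_mul (hc0 y), ← ENNReal.ofReal_add (mul_nonneg (hc0 y) (hv0 y)) hb0.le]
    exact ENNReal.ofReal_le_ofReal (fi_le_cf hp1 hp2 hε hM1 hk1 hMk y (hv0 y))
  have hVle : ∀ x, V x ≤ ENNReal.ofReal B + ∫⁻ y, gl (Set.Ioi 0) x y * (ENNReal.ofReal (cf p ε M k v y) * V y) ∂(nu (p - 2) ε) := by
    intro x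
    have g1 := gl_sec (Set.Ioi 0) x
    have m1 : Measurable fun y => gl (Set.Ioi 0) x y * (ENNReal.ofReal (cf p ε M k v y) * V y) :=
      g1.mul (hcm.ennreal_ofReal.mul hVm)
    calc V x ≤ ∫⁻ y, gl (Set.Ioi 0) x y * (ENNReal.ofReal (cf p ε M k v y) * V y) + ENNReal.ofReal b * gl (Set.Ioi 0) x y ∂(nu (p - 2) ε) := by
          have hVx : V x = ∫⁻ y, gl (Set.Ioi 0) x y * ENNReal.ofReal (w y) ∂(nu (p - 2) ε) := rfl
          rw [hVx]
          refine lintegral_mono_ae ?_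
          filter_upwards [hwle] with y hy
          refine (mul_le_mul_right hy _).trans (le_of_eq ?_)
          ring
      _ = (∫⁻ y, gl (Set.Ioi 0) x y * (ENNReal.ofReal (cf p ε M k v y) * V y) ∂(nu (p - 2) ε)) + ENNReal.ofReal b * ∫⁻ y, gl (Set.Ioi 0) x y ∂(nu (p - 2) ε) := by
          rw [lintegral_add_left m1, lintegral_const_mul _ g1]
      _ ≤ _ := by
          rw [hB, ENNReal.ofReal_mul hb0.le, add_comm]
          gcongr
          exact gl_tot' hγ hε1 x
  have hH : ENNReal.ofReal (1 / 2) * 2 = 1 := by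
    rw [show (2 : ENNReal) = ENNReal.ofReal 2 by simp, ← ENNReal.ofReal_mul (by norm_num)]; norm_num
  have hVint : Integrable v (nu (p - 2) ε) := by
    have h2 : MemLp v 2 (nu (p - 2) ε) := (memLp_two_iff_integrable_sq hvm.aestronglyMeasurable).2 hint
    exact h2.integrable (by norm_num)
  have hfc : ∫⁻ y, ENNReal.ofReal (cf p ε M k v y) * V y ∂(nu (p - 2) ε) ≠ ⊤ := by
    have h1 : ∫⁻ y, ENNReal.ofReal (cf p ε M k v y) * V y ∂(nu (p - 2) ε)
        ≤ ENNReal.ofReal ((p - 1) * M ^ (p - 2) + 5 * ε ^ 2 * M ^ 4 + 3 * M ^ 2) * ∫⁻ y, ENNReal.ofReal (v y) ∂(nu (p - 2) ε) := by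
      rw [← lintegral_const_mul _ hvm.ennreal_ofReal]
      refine lintegral_mono_ae ?_
      filter_upwards [hVv] with y hy
      rw [hy]
      exact mul_le_mul_left (ENNReal.ofReal_le_ofReal (hcle y)) _
    refine ne_top_of_le_ne_top (ENNReal.mul_ne_top ENNReal.ofReal_ne_top ?_) h1
    rw [← ofReal_integral_eq_lintegral_ofReal hVint (Eventually.of_forall hv0)]
    exact ENNReal.ofReal_ne_top
  have hcon := contr (gl_meas _) (gl_symm _) hcm.ennreal_ofReal hVm hH hci2 ENNReal.ofReal_ne_top
    (Eventually.of_forall hVle) hfc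
  intro x
  refine le_trans ?_ (ENNReal.ofReal_le_ofReal hMB)
  calc V x ≤ _ := hVle x
    _ ≤ ENNReal.ofReal B + ∫⁻ y, (gl (Set.Ioi 0) x y * ENNReal.ofReal (cf p ε M k v y)) * (2 * ENNReal.ofReal B) ∂(nu (p - 2) ε) := by
        gcongr 1
        refine lintegral_mono_ae ?_
        filter_upwards [hcon] with y hy
        rw [← mul_assoc]
        exact mul_le_mul_right hy _
    _ = ENNReal.ofReal B + (∫⁻ y, (gl (Set.Ioi 0) x y * ENNReal.ofReal (cf p ε M k v y)) ∂(nu (p - 2) ε)) * (2 * ENNReal.ofReal B) := by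
        have m1 : Measurable fun y => gl (Set.Ioi 0) x y * (ENNReal.ofReal (cf p ε M k v y)) :=
          (gl_sec _ x).mul hcm.ennreal_ofReal
        rw [lintegral_mul_const _ m1]
    _ ≤ ENNReal.ofReal B + ENNReal.ofReal (1 / 2) * (2 * ENNReal.ofReal B) := by gcongr; exact hci2 x
    _ = ENNReal.ofReal (2 * B) := by
        rw [← mul_assoc, hH, one_mul, ← ENNReal.ofReal_add hB0.le hB0.le]; congr 1; ring

end Ham

namespace Ham

def Wf (p ε : ℝ) (U : E3 → ℝ) (y : E3) : ℝ := U y ^ (p - 1) + ε ^ 2 * U y ^ 5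
def hf (ε : ℝ) (U : E3 → ℝ) (y : E2) : ℝ := ε * U (io y) ^ 3

structure Sol (p ε M : ℝ) (U : E3 → ℝ) : Prop where
  meas : Measurable U
  pos : ∀ x, 0 < U x
  bd : ∀ x, U x ≤ M * exp (-(1 / 8) * ‖x‖ ^ 2)
  even : ∀ x, U (rho x) = U x
  eq : ∀ x, ENNReal.ofReal (U x) = ∫⁻ r in Set.Ioi 0, ENNReal.ofReal (om r) *
    ((∫⁻ y, ENNReal.ofReal (P r x y * Wf p ε U y)) + ∫⁻ y, ENNReal.ofReal (P r x (io y) * (2 * hf ε U y)))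

theorem exp_rpow (t s q : ℝ) (hs : 0 ≤ s) : (exp t * s) ^ q = exp (q * t) * s ^ q := by
  rw [Real.mul_rpow (exp_pos _).le hs, ← Real.exp_mul]; ring_nf

/-- symmetrization of the kernel -/
theorem ks_even {r : ℝ} (hr : 0 < r) (x : E3) {g : E3 → ℝ} (hg : Measurable g) (h0 : ∀ y, 0 ≤ g y) (he : ∀ y, g (rho y) = g y) :
    ∫⁻ y, ENNReal.ofReal (ks r x y * g y) = ∫⁻ y, ENNReal.ofReal (kv r x y * g y) := by
  have mk : Measurable fun y => ENNReal.ofReal (kv r x y * g y) := ((kv_sec r x).mul hg).ennreal_ofReal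
  have mp : MeasurePreserving (rho : E3 → E3) volume volume := rho.measurePreserving
  have mk2 : Measurable fun y => ENNReal.ofReal (kv r x (rho y) * g (rho y)) := mk.comp mp.measurable
  have e : ∫⁻ y, ENNReal.ofReal (kv r x (rho y) * g (rho y)) = ∫⁻ y, ENNReal.ofReal (kv r x y * g y) :=
    mp.lintegral_comp mk
  have : ∀ y, ENNReal.ofReal (ks r x y * g y) = ENNReal.ofReal (1/2) * ENNReal.ofReal (kv r x y * g y)
      + ENNReal.ofReal (1/2) * ENNReal.ofReal (kv r x (rho y) * g (rho y)) := by
    intro y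
    have h1 : 0 ≤ kv r x y * g y := mul_nonneg (kv_nn hr _ _) (h0 y)
    have h2 : 0 ≤ kv r x (rho y) * g (rho y) := mul_nonneg (kv_nn hr _ _) (h0 _)
    rw [← ENNReal.ofReal_mul (by norm_num), ← ENNReal.ofReal_mul (by norm_num),
      ← ENNReal.ofReal_add (by positivity) (by positivity), he]
    congr 1; unfold ks; ring
  simp_rw [this]
  rw [lintegral_add_left (mk.const_mul _), lintegral_const_mul _ mk, lintegral_const_mul _ mk2, e, ← add_mul,
    ← ENNReal.ofReal_add (by norm_num) (by norm_num)]
  norm_num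

theorem exists_sol {p : ℝ} (hp1 : 2 < p) (hp2 : p ≤ 4) : ∃ M ε0 : ℝ, 1 ≤ M ∧ 0 < ε0 ∧ ε0 ≤ 1 ∧
    ∀ ε, 0 < ε → ε ≤ ε0 → ∃ U : E3 → ℝ, Sol p ε M U := by
  obtain ⟨M, ε0, hM, h0, h1, H⟩ := sup_bd hp1 hp2
  refine ⟨M, ε0, hM, h0, h1, fun ε hε hεe => ?_⟩
  obtain ⟨w, hwm, hwn, hw0, hae, hbd⟩ := H ε hε hεe
  have hγ : 0 < p - 2 := by linarith
  have hfin := nu_fin hγ ε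
  set V := Vf (p - 2) ε w with hV
  have hVm : Measurable V := Vf_meas _ _ hwm
  set v : E3 → ℝ := fun x => (V x).toReal with hv
  have hvm : Measurable v := hVm.ennreal_toReal
  have hVt : ∀ x, V x ≠ ⊤ := fun x => ne_top_of_le_ne_top ENNReal.ofReal_ne_top (hbd x)
  have hVv : ∀ x, ENNReal.ofReal (v x) = V x := fun x => ENNReal.ofReal_toReal (hVt x)
  have hvM : ∀ x, v x ≤ M := fun x => ENNReal.toReal_le_of_le_ofReal (by linarith) (hbd x)
  have hV0 : ∀ x, V x ≠ 0 := by
    intro x hx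
    have e : V x = ∫⁻ y, gl (Set.Ioi 0) x y * ENNReal.ofReal (w y) ∂(nu (p - 2) ε) := rfl
    have m1 : Measurable fun y => gl (Set.Ioi 0) x y * ENNReal.ofReal (w y) := (gl_sec _ x).mul hwm.ennreal_ofReal
    rw [e, lintegral_eq_zero_iff m1] at hx
    apply hw0
    filter_upwards [hx] with y hy
    simp only [Pi.zero_apply, mul_eq_zero, gl_pos x y, false_or, ENNReal.ofReal_eq_zero] at hy
    exact le_antisymm hy (hwn y)
  have hvp : ∀ x, 0 < v x := fun x => ENNReal.toReal_pos (hV0 x) (hVt x)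
  have hve : ∀ x, v (rho x) = v x := fun x => by
    have : V (rho x) = V x := by
      rw [hV]; unfold Vf
      simp_rw [gl_rho]
    simp only [hv, this]
  set U : E3 → ℝ := fun x => exp (-(1 / 8) * ‖x‖ ^ 2) * v x with hU
  have hUm : Measurable U := by
    have : Measurable fun x : E3 => exp (-(1 / 8) * ‖x‖ ^ 2) := by fun_prop
    exact this.mul hvm
  have hUp : ∀ x, 0 < U x := fun x => mul_pos (exp_pos _) (hvp x)
  have hUe : ∀ x, U (rho x) = U x := fun x => by simp only [hU, hve, LinearIsometryEquiv.norm_map]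
  have hWm : Measurable (Wf p ε U) := by
    unfold Wf
    exact (hUm.pow_const _).add ((hUm.pow_const 5).const_mul _)
  have hW0 : ∀ y, 0 ≤ Wf p ε U y := fun y => by have := hUp y; unfold Wf; positivity
  have hhm : Measurable (hf ε U) := by
    unfold hf
    exact ((hUm.comp io_m.measurable).pow_const 3).const_mul _
  have hh0 : ∀ y, 0 ≤ hf ε U y := fun y => by have := hUp (io y); unfold hf; positivity
  refine ⟨U, hUm, hUp, fun x => ?_, hUe, fun x => ?_⟩
  · rw [mul_comm]; exact mul_le_mul_of_nonneg_left (hvM x) (exp_pos _).le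
  -- main formula
  set fv : E3 → ℝ := fun y => fi p ε M y (v y) with hfv
  have hfvm : Measurable fv := by
    classical
    have : fv = fun z => if z ∈ Eo then
        v z ^ (p - 1) + (ε ^ 2 * kap p z) * v z ^ (5:ℝ) else v z ^ (3:ℝ) := by
      funext z; simp only [hfv]; unfold fi; split_ifs
      · simp only [Tp_of_le (hvM z)]
      · simp only [Tp_of_le (hvM z), zero_mul, add_zero]
    rw [this]
    have hk : Measurable (kap p) := by unfold kap; fun_prop
    refine Measurable.ite Eo_meas ?_ (hvm.pow_const _)
    exact (hvm.pow_const _).add ((hk.const_mul _).mul (hvm.pow_const _))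
  have e1 : V x = ∫⁻ y, gl (Set.Ioi 0) x y * ENNReal.ofReal (fv y) ∂(nu (p - 2) ε) := by
    rw [hV]; unfold Vf
    refine lintegral_congr_ae ?_
    filter_upwards [hae] with y hy
    rw [hy]
  rw [gl_ton _ _ x hfvm.ennreal_ofReal] at e1
  have e2 : ENNReal.ofReal (U x) = ENNReal.ofReal (exp (-(1 / 8) * ‖x‖ ^ 2)) * V x := by
    rw [← hVv, ← ENNReal.ofReal_mul (exp_pos _).le]
  have hm3 : Measurable fun q : ℝ × E3 => ENNReal.ofReal (om q.1 * ks q.1 x q.2) * ENNReal.ofReal (fv q.2) :=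
    (omks_meas.comp (measurable_fst.prodMk (measurable_const.prodMk measurable_snd))).mul
      (hfvm.comp measurable_snd).ennreal_ofReal
  have hm2 : Measurable fun r => ∫⁻ y, ENNReal.ofReal (om r * ks r x y) * ENNReal.ofReal (fv y) ∂(nu (p - 2) ε) :=
    hm3.lintegral_prod_right'
  rw [e2, e1, ← lintegral_const_mul _ hm2]
  refine setLIntegral_congr_fun measurableSet_Ioi fun r hr => ?_
  have hr0 : 0 < r := hr
  have mx : Measurable fun y => ENNReal.ofReal (om r * ks r x y) * ENNReal.ofReal (fv y) :=
    ((ks_sec r x).const_mul _).ennreal_ofReal.mul hfvm.ennreal_ofReal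
  have ho := om_nn hr0
  -- interior
  have i1 : ∫⁻ y, ENNReal.ofReal (om r * ks r x y) * ENNReal.ofReal (fv y) ∂(nu0 (p - 2))
      = ENNReal.ofReal (om r * exp (1 / 8 * ‖x‖ ^ 2)) * ∫⁻ y, ENNReal.ofReal (P r x y * Wf p ε U y) := by
    have mE : Measurable fun y : E3 => exp (1 / 8 * ‖y‖ ^ 2) := by fun_prop
    have s2 := ks_even hr0 x (g := fun y => exp (1 / 8 * ‖y‖ ^ 2) * Wf p ε U y) (mE.mul hWm)
      (fun y => mul_nonneg (exp_pos _).le (hW0 y))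
      (fun y => by simp only [Wf, hUe, LinearIsometryEquiv.norm_map])
    have mks : Measurable fun y => ENNReal.ofReal (ks r x y * (exp (1 / 8 * ‖y‖ ^ 2) * Wf p ε U y)) :=
      ((ks_sec r x).mul (mE.mul hWm)).ennreal_ofReal
    have mPW : Measurable fun y => ENNReal.ofReal (P r x y * Wf p ε U y) := by
      have : Measurable fun y => P r x y := by unfold P xi; fun_prop
      exact (this.mul hWm).ennreal_ofReal
    rw [lint_nu0 _ mx]
    calc _ = ∫⁻ y, ENNReal.ofReal (om r) * ENNReal.ofReal (ks r x y * (exp (1 / 8 * ‖y‖ ^ 2) * Wf p ε U y)) := by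
          refine lintegral_congr_ae ?_
          have hE : ∀ᵐ y : E3, y ∈ Eo := by rw [ae_iff]; exact Eo_null
          filter_upwards [hE] with y hy
          have hk := ks_nn hr0 x y
          rw [← ENNReal.ofReal_mul (mul_nonneg ho hk), ← ENNReal.ofReal_mul (exp_pos _).le, ← ENNReal.ofReal_mul ho]
          congr 1
          have hfvy : fv y = v y ^ (p - 1) + ε ^ 2 * kap p y * v y ^ 5 := by
            simp only [hfv, fi, if_pos hy, Tp_of_le (hvM y)]
            rw [show (5:ℝ) = ((5:ℕ):ℝ) by norm_num, Real.rpow_natCast]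
          have : exp (-((p - 2) / 8) * ‖y‖ ^ 2) * fv y = exp (1 / 8 * ‖y‖ ^ 2) * Wf p ε U y := by
            rw [hfvy]
            simp only [Wf, hU, kap]
            rw [exp_rpow _ _ _ (hvp y).le, mul_pow, ← Real.exp_nat_mul, mul_add, mul_add]
            congr 1
            · rw [← mul_assoc, ← Real.exp_add]; congr 2; ring
            · rw [show exp (-((p - 2) / 8) * ‖y‖ ^ 2) * (ε ^ 2 * exp (-((6 - p) / 8) * ‖y‖ ^ 2) * v y ^ 5)
                = (exp (-((p - 2) / 8) * ‖y‖ ^ 2) * exp (-((6 - p) / 8) * ‖y‖ ^ 2)) * (ε ^ 2 * v y ^ 5) by ring,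
                ← Real.exp_add, show ∀ a b : ℝ, a * (ε ^ 2 * (b * v y ^ 5)) = (a * b) * (ε ^ 2 * v y ^ 5) by intros; ring,
                ← Real.exp_add]
              congr 2; push_cast; ring
          linear_combination (om r * ks r x y) * this
      _ = ENNReal.ofReal (om r) * ∫⁻ y, ENNReal.ofReal (kv r x y * (exp (1 / 8 * ‖y‖ ^ 2) * Wf p ε U y)) := by
          rw [lintegral_const_mul _ mks, s2]
      _ = ENNReal.ofReal (om r) * ∫⁻ y, ENNReal.ofReal (exp (1 / 8 * ‖x‖ ^ 2)) * ENNReal.ofReal (P r x y * Wf p ε U y) := by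
          congr 1
          refine lintegral_congr fun y => ?_
          rw [← ENNReal.ofReal_mul (exp_pos _).le]
          congr 1
          rw [kv_P hr0]
          have : exp (-(‖y‖ ^ 2 / 8)) * exp (1 / 8 * ‖y‖ ^ 2) = 1 := by rw [← Real.exp_add]; simp; ring
          rw [show ‖x‖ ^ 2 / 8 = 1 / 8 * ‖x‖ ^ 2 by ring]
          linear_combination (exp (1 / 8 * ‖x‖ ^ 2) * P r x y * Wf p ε U y) * this
      _ = _ := by rw [lintegral_const_mul _ mPW, ENNReal.ofReal_mul ho, mul_assoc]
  have i2 : ENNReal.ofReal ε * ∫⁻ y, ENNReal.ofReal (om r * ks r x y) * ENNReal.ofReal (fv y) ∂nub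
      = ENNReal.ofReal (om r * exp (1 / 8 * ‖x‖ ^ 2)) * ∫⁻ y, ENNReal.ofReal (P r x (io y) * (2 * hf ε U y)) := by
    have mPW : Measurable fun y => ENNReal.ofReal (P r x (io y) * (2 * hf ε U y)) := by
      have : Measurable fun y => P r x y := by unfold P xi; fun_prop
      have h2 : Measurable fun y => P r x (io y) := this.comp io_m.measurable
      exact (h2.mul (hhm.const_mul 2)).ennreal_ofReal
    have mx2 : Measurable fun y : E2 => ENNReal.ofReal (2 * exp (-(1 / 4) * ‖y‖ ^ 2)) *
        (ENNReal.ofReal (om r * ks r x (io y)) * ENNReal.ofReal (fv (io y))) :=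
      (by fun_prop : Measurable fun y : E2 => ENNReal.ofReal (2 * exp (-(1 / 4) * ‖y‖ ^ 2))).mul (mx.comp io_m.measurable)
    rw [lint_nub mx, ← lintegral_const_mul _ mx2, ← lintegral_const_mul _ mPW]
    refine lintegral_congr fun y => ?_
    have hk := ks_nn hr0 x (io y)
    rw [← ENNReal.ofReal_mul (mul_nonneg ho hk), ← ENNReal.ofReal_mul (by positivity),
      ← ENNReal.ofReal_mul hε.le, ← ENNReal.ofReal_mul (by positivity)]
    congr 1
    have hy : io y ∉ Eo := by simp [Eo, io]
    have hfvy : fv (io y) = v (io y) ^ 3 := by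
      simp only [hfv, fi, if_neg hy, Tp_of_le (hvM _), zero_mul, add_zero]
      rw [show (3:ℝ) = ((3:ℕ):ℝ) by norm_num, Real.rpow_natCast]
    have hks : ks r x (io y) = kv r x (io y) := by unfold ks; rw [rho_io]; ring
    rw [hfvy, hks, kv_P hr0]
    simp only [hf, hU, io_norm]
    rw [mul_pow, ← Real.exp_nat_mul]
    have : exp (-(1 / 4) * ‖y‖ ^ 2) * exp (-(‖y‖ ^ 2 / 8)) = exp ((3:ℕ) * (-(1 / 8) * ‖y‖ ^ 2)) := by
      rw [← Real.exp_add]; congr 1; push_cast; ring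
    rw [show ‖x‖ ^ 2 / 8 = 1 / 8 * ‖x‖ ^ 2 by ring]
    linear_combination (2 * ε * om r * exp (1 / 8 * ‖x‖ ^ 2) * P r x (io y) * v (io y) ^ 3) * this
  rw [lint_nu, i1, i2, ← mul_add, ← mul_assoc, ← ENNReal.ofReal_mul (exp_pos _).le]
  congr 2
  have : exp (-(1 / 8) * ‖x‖ ^ 2) * exp (1 / 8 * ‖x‖ ^ 2) = 1 := by rw [← Real.exp_add]; simp
  linear_combination om r * this

end Ham

namespace Ham

abbrev L1 := E3 →L[ℝ] ℝ

def pr (i : Fin 3) : L1 := EuclideanSpace.proj i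
def gv (v : Fin 3 → ℝ) : L1 := ∑ j, v j • pr j

theorem pr_apply (i : Fin 3) (x : E3) : pr i x = x i := rfl
theorem gv_apply (v : Fin 3 → ℝ) (e : E3) : gv v e = v 0 * e 0 + v 1 * e 1 + v 2 * e 2 := by
  simp [gv, ContinuousLinearMap.sum_apply, pr_apply, Fin.sum_univ_three]

theorem gv_of {f : E3 → ℝ} {A : L1} {x : E3} (h : HasFDerivAt f A x) {v : Fin 3 → ℝ}
    (hv : ∀ e, A e = gv v e) : HasFDerivAt f (gv v) x := by
  have : A = gv v := ContinuousLinearMap.ext hv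
  rw [← this]; exact h

theorem nsq3 (z : E3) : ‖z‖ ^ 2 = z 0 ^ 2 + z 1 ^ 2 + z 2 ^ 2 := by
  rw [EuclideanSpace.norm_sq_eq, Fin.sum_univ_three]; simp

theorem abs_le_nrm (z : E3) (i : Fin 3) : |z i| ≤ ‖z‖ := by
  simpa using PiLp.norm_apply_le z i

theorem coord_cont (i : Fin 3) : Continuous fun z : E3 => z i := (pr i).continuous

theorem coord_deriv (i : Fin 3) (z : E3) : HasFDerivAt (fun z : E3 => z i) (pr i) z := (pr i).hasFDerivAt

def kq (z : E3) : ℝ := exp (-(‖z‖ ^ 2 / 4))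
def k1 (i : Fin 3) (z : E3) : ℝ := -(1 / 2) * z i * kq z
def k2 (i j : Fin 3) (z : E3) : ℝ := (z i * z j / 4 - (if i = j then 1 else 0) / 2) * kq z

theorem P_kq (r : ℝ) (x y : E3) : P r x y = r⁻¹ ^ 3 * kq (xi r x y) := rfl
theorem kq_pos (z : E3) : 0 < kq z := exp_pos _

theorem kq_deriv (z : E3) : HasFDerivAt kq (gv fun j => k1 j z) z := by
  have h0 : ∀ i, HasFDerivAt (fun z : E3 => z i ^ 2) ((2 * z i) • pr i) z := fun i => by
    have := (coord_deriv i z).pow 2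
    simpa [two_mul, smul_smul, add_smul] using this
  have h1 : HasFDerivAt (fun z : E3 => -((z 0 ^ 2 + z 1 ^ 2 + z 2 ^ 2) / 4))
      ((-(1 / 4) : ℝ) • ((2 * z 0) • pr 0 + (2 * z 1) • pr 1 + (2 * z 2) • pr 2)) z := by
    have h := (((h0 0).add (h0 1)).add (h0 2)).const_mul (-(1/4))
    have e : (fun z : E3 => -((z 0 ^ 2 + z 1 ^ 2 + z 2 ^ 2) / 4)) = fun z : E3 => -(1/4) * (z 0 ^ 2 + z 1 ^ 2 + z 2 ^ 2) := by
      funext z; ring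
    rw [e]; exact h
  have e : kq = fun z : E3 => exp (-((z 0 ^ 2 + z 1 ^ 2 + z 2 ^ 2) / 4)) := by
    funext z; unfold kq; rw [nsq3]
  have h2 := h1.exp
  rw [← e] at h2
  refine gv_of h2 fun w => ?_
  have e2 : exp (-((z 0 ^ 2 + z 1 ^ 2 + z 2 ^ 2) / 4)) = kq z := by rw [e]
  rw [e2, gv_apply]
  simp only [ContinuousLinearMap.smul_apply, ContinuousLinearMap.add_apply, pr_apply, smul_eq_mul, k1]
  ring

theorem k1_deriv (i : Fin 3) (z : E3) : HasFDerivAt (k1 i) (gv fun j => k2 i j z) z := by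
  have h1 := ((coord_deriv i z).const_mul (-(1/2))).mul (kq_deriv z)
  refine gv_of h1 fun w => ?_
  simp only [ContinuousLinearMap.smul_apply, ContinuousLinearMap.add_apply, pr_apply, smul_eq_mul, gv_apply]
  simp only [k1, k2]
  fin_cases i <;> simp <;> ring

theorem kq_cont : Continuous kq := by unfold kq; fun_prop
theorem k1_cont (i : Fin 3) : Continuous (k1 i) := by
  have := kq_cont
  have := coord_cont i
  unfold k1; fun_prop
theorem k2_cont (i j : Fin 3) : Continuous (k2 i j) := by
  have := kq_cont
  have := coord_cont i
  have := coord_cont j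
  unfold k2; fun_prop

theorem kq_poly (z : E3) : (1 + ‖z‖) ^ 2 * kq z ≤ 34 * exp (-(3 / 16) * ‖z‖ ^ 2) := by
  have h1 : (1 + ‖z‖) ^ 2 ≤ 2 + 2 * ‖z‖ ^ 2 := by nlinarith [sq_nonneg (1 - ‖z‖)]
  have h2 : ‖z‖ ^ 2 / 16 + 1 ≤ exp (‖z‖ ^ 2 / 16) := Real.add_one_le_exp _
  have h3 : kq z = exp (-(3 / 16) * ‖z‖ ^ 2) * exp (-(‖z‖ ^ 2 / 16)) := by
    unfold kq; rw [← Real.exp_add]; congr 1; ring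
  have h4 : exp (‖z‖ ^ 2 / 16) * exp (-(‖z‖ ^ 2 / 16)) = 1 := by rw [← Real.exp_add]; simp
  have h5 : (1 + ‖z‖) ^ 2 ≤ 34 * exp (‖z‖ ^ 2 / 16) := by nlinarith [sq_nonneg ‖z‖]
  rw [h3]
  have e1 := exp_pos (-(3 / 16) * ‖z‖ ^ 2)
  have e2 := exp_pos (-(‖z‖ ^ 2 / 16))
  calc (1 + ‖z‖) ^ 2 * (exp (-(3 / 16) * ‖z‖ ^ 2) * exp (-(‖z‖ ^ 2 / 16)))
      ≤ 34 * exp (‖z‖ ^ 2 / 16) * (exp (-(3 / 16) * ‖z‖ ^ 2) * exp (-(‖z‖ ^ 2 / 16))) := by gcongr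
    _ = _ := by linear_combination 34 * exp (-(3 / 16) * ‖z‖ ^ 2) * h4

structure KQ (Q : E3 → ℝ) : Prop where
  cont : Continuous Q
  bd : ∀ z, |Q z| ≤ 34 * exp (-(3 / 16) * ‖z‖ ^ 2)

structure KD (Q : E3 → ℝ) (Qd : Fin 3 → E3 → ℝ) : Prop where
  kq : KQ Q
  kqd : ∀ j, KQ (Qd j)
  der : ∀ z, HasFDerivAt Q (gv fun j => Qd j z) z

theorem KQ_kq : KQ kq := ⟨kq_cont, fun z => by
  refine le_trans ?_ (kq_poly z)
  have := kq_pos z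
  rw [abs_of_pos this]
  have : 1 ≤ (1 + ‖z‖) ^ 2 := one_le_pow₀ (by linarith [norm_nonneg z])
  nlinarith⟩

theorem KQ_k1 (i : Fin 3) : KQ (k1 i) := ⟨k1_cont i, fun z => by
  refine le_trans ?_ (kq_poly z)
  have := kq_pos z
  unfold k1
  rw [abs_mul, abs_of_pos this, abs_mul]
  have h2 := abs_le_nrm z i
  have h3 := norm_nonneg z
  have : |(-(1/2):ℝ)| = 1/2 := by rw [abs_neg]; norm_num
  rw [this]
  gcongr
  nlinarith [abs_nonneg (z i)]⟩

theorem KQ_k2 (i j : Fin 3) : KQ (k2 i j) := ⟨k2_cont i j, fun z => by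
  refine le_trans ?_ (kq_poly z)
  have := kq_pos z
  unfold k2
  rw [abs_mul, abs_of_pos this]
  have h2 := abs_le_nrm z i
  have h2' := abs_le_nrm z j
  have h3 := norm_nonneg z
  have h4 : |z i * z j| ≤ ‖z‖ * ‖z‖ := by rw [abs_mul]; gcongr
  have h5 := abs_le.1 h4
  gcongr
  rw [abs_le]
  split_ifs <;> constructor <;> nlinarith⟩

theorem KD_kq : KD kq k1 := ⟨KQ_kq, KQ_k1, kq_deriv⟩
theorem KD_k1 (i : Fin 3) : KD (k1 i) (k2 i) := ⟨KQ_k1 i, KQ_k2 i, k1_deriv i⟩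

theorem gauss_int {n : ℕ} {s : ℝ} (hs : 0 < s) : Integrable fun z : Euc n => exp (-s * ‖z‖ ^ 2) := by
  have h := (GaussianFourier.integrable_cexp_neg_mul_sq_norm_add (V := Euc n) (b := (s:ℂ)) (by simpa using hs) 0 0).norm
  refine h.congr (Eventually.of_forall fun z => ?_)
  simp only [zero_mul, add_zero, Complex.norm_exp]
  congr 1
  have : -(s:ℂ) * (‖z‖:ℂ) ^ 2 = ((-s * ‖z‖^2 : ℝ) : ℂ) := by push_cast; ring
  simp [this]
  left; norm_cast

theorem KQ.int {Q : E3 → ℝ} (h : KQ Q) : Integrable Q :=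
  ((gauss_int (n := 3) (by norm_num : (0:ℝ) < 3/16)).const_mul 34).mono' h.cont.aestronglyMeasurable
    (Eventually.of_forall h.bd)

theorem KD.int0 {Q : E3 → ℝ} {Qd} (h : KD Q Qd) (j : Fin 3) : ∫ z, Qd j z = 0 := by
  have i1 := h.kq.int
  have i2 := (h.kqd j).int
  have e : ∀ z, gv (fun j => Qd j z) (EuclideanSpace.single j 1) = Qd j z := fun z => by
    rw [gv_apply]; fin_cases j <;> simp
  have := integral_bilinear_hasFDerivAt_right_eq_neg_left_of_integrable (μ := (volume : Measure E3))
    (B := ContinuousLinearMap.mul ℝ ℝ) (f := fun _ => (1:ℝ)) (f' := fun _ => 0) (g := Q)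
    (g' := fun z => gv (fun j => Qd j z)) (v := EuclideanSpace.single j 1)
    (by simp) (by simpa [e] using i2) (by simpa using i1) (fun z _ => hasFDerivAt_const _ _) (fun z _ => h.der z)
  simpa [e] using this

theorem KQ_int_kq : ∫ z, kq z = c4 := by
  have h := GaussianFourier.integral_rexp_neg_mul_sq_norm (V := E3) (b := 1/4) (by norm_num)
  have e : ∀ z : E3, kq z = exp (-(1/4) * ‖z‖^2) := fun z => by unfold kq; congr 1; ring
  simp_rw [e]
  rw [h]
  unfold c4
  rw [finrank_euclideanSpace_fin]
  congr 1
  · ring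

end Ham

namespace Ham

theorem pr_norm (j : Fin 3) : ‖pr j‖ ≤ 1 :=
  ContinuousLinearMap.opNorm_le_bound _ zero_le_one fun x => by
    rw [one_mul]; exact PiLp.norm_apply_le x j

theorem gv_norm {v : Fin 3 → ℝ} {B : ℝ} (h : ∀ j, |v j| ≤ B) : ‖gv v‖ ≤ 3 * B := by
  have hB : 0 ≤ B := (abs_nonneg _).trans (h 0)
  unfold gv
  refine (norm_sum_le _ _).trans ?_
  have : ∀ j ∈ Finset.univ, ‖v j • pr j‖ ≤ B := fun j _ => by
    rw [norm_smul]
    calc ‖v j‖ * ‖pr j‖ ≤ B * 1 := by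
          have := pr_norm j
          have := h j
          rw [Real.norm_eq_abs]
          gcongr
      _ = B := mul_one _
  refine (Finset.sum_le_sum this).trans ?_
  simp

theorem gv_cont {X : Type*} [TopologicalSpace X] {v : Fin 3 → X → ℝ} {s : Set X} (h : ∀ j, ContinuousOn (v j) s) :
    ContinuousOn (fun x => gv fun j => v j x) s := by
  unfold gv
  refine continuousOn_finset_sum _ fun j _ => ?_
  exact (h j).smul continuousOn_const

theorem dom_deriv {Y : Type*} [MeasurableSpace Y] {μ : Measure Y} {F : E3 → Y → ℝ} {G : Fin 3 → E3 → Y → ℝ}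
    {s : Set E3} (hs : IsOpen s) {x : E3} (hx : x ∈ s) {B : Y → ℝ} (hF : ∀ x ∈ s, Integrable (F x) μ)
    (hGm : ∀ j, AEStronglyMeasurable (G j x) μ)
    (hd : ∀ᵐ y ∂μ, ∀ x ∈ s, HasFDerivAt (fun x => F x y) (gv fun j => G j x y) x)
    (hb : ∀ᵐ y ∂μ, ∀ j, ∀ x ∈ s, |G j x y| ≤ B y) (hB : Integrable B μ) :
    HasFDerivAt (fun x => ∫ y, F x y ∂μ) (gv fun j => ∫ y, G j x y ∂μ) x := by
  have hG : ∀ j, Integrable (G j x) μ := fun j => hB.mono' (hGm j) (hb.mono fun y hy => hy j x hx)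
  have hm : AEStronglyMeasurable (fun y => gv fun j => G j x y) μ := by
    unfold gv
    exact Finset.aestronglyMeasurable_fun_sum _ fun j _ => (hGm j).smul_const _
  have h := hasFDerivAt_integral_of_dominated_of_fderiv_le (𝕜 := ℝ) (μ := μ) (F := F)
    (F' := fun x y => gv fun j => G j x y) (bound := fun y => 3 * B y) (x₀ := x) (s := s) (hs.mem_nhds hx)
    (eventually_of_mem (hs.mem_nhds hx) fun x hx => (hF x hx).aestronglyMeasurable) (hF x hx) hm
    (hb.mono fun y hy x hx => gv_norm fun j => hy j x hx) (hB.const_mul 3) hd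
  have e : ∫ y, (gv fun j => G j x y) ∂μ = gv fun j => ∫ y, G j x y ∂μ := by
    unfold gv
    rw [integral_finset_sum _ fun j _ => (hG j).smul_const _]
    refine Finset.sum_congr rfl fun j _ => ?_
    rw [integral_smul_const]
  rw [← e]; exact h

structure Wt {Y : Type} [MeasurableSpace Y] (μ : Measure Y) (ι : Y → E3) (g : Y → ℝ) (b C : ℝ) : Prop where
  sf : SFinite μ
  im : Measurable ι
  gm : Measurable g
  b0 : 0 < b
  C0 : 0 ≤ C
  bd : ∀ y, |g y| ≤ C * exp (-b * ‖ι y‖ ^ 2)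
  int : ∀ s : ℝ, 0 < s → Integrable (fun y => exp (-s * ‖ι y‖ ^ 2)) μ

/-- smoothing at scale r -/
def Psi {Y : Type} [MeasurableSpace Y] (μ : Measure Y) (ι : Y → E3) (g : Y → ℝ) (Q : E3 → ℝ) (r : ℝ) (x : E3) : ℝ :=
  ∫ y, g y * (r⁻¹ ^ 3 * Q (xi r x (ι y))) ∂μ

theorem KQ.le {Q : E3 → ℝ} (h : KQ Q) (z : E3) : |Q z| ≤ 34 := by
  refine (h.bd z).trans ?_
  have : exp (-(3 / 16) * ‖z‖ ^ 2) ≤ 1 := Real.exp_le_one_iff.2 (by nlinarith [sq_nonneg ‖z‖])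
  linarith

theorem xi_meas : Measurable fun q : (ℝ × E3) × E3 => xi q.1.1 q.1.2 q.2 := by
  unfold xi
  have := aa_cont.measurable
  fun_prop

theorem xi_cont (r : ℝ) : Continuous fun q : E3 × E3 => xi r q.1 q.2 := by
  unfold xi
  fun_prop

section
variable {Y : Type} [MeasurableSpace Y] {μ : Measure Y} {ι : Y → E3} {g : Y → ℝ} {b C : ℝ}

theorem Wt.gint (w : Wt μ ι g b C) : Integrable g μ :=
  ((w.int b w.b0).const_mul C).mono' w.gm.aestronglyMeasurable (Eventually.of_forall w.bd)

theorem Wt.meas3 (w : Wt μ ι g b C) {Q : E3 → ℝ} (h : KQ Q) :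
    Measurable fun q : (ℝ × E3) × Y => g q.2 * (q.1.1⁻¹ ^ 3 * Q (xi q.1.1 q.1.2 (ι q.2))) := by
  have h1 : Measurable fun q : (ℝ × E3) × Y => xi q.1.1 q.1.2 (ι q.2) :=
    xi_meas.comp (measurable_fst.prodMk (w.im.comp measurable_snd))
  have h2 : Measurable fun q : (ℝ × E3) × Y => Q (xi q.1.1 q.1.2 (ι q.2)) := h.cont.measurable.comp h1
  have h3 : Measurable fun q : (ℝ × E3) × Y => g q.2 := w.gm.comp measurable_snd
  have h4 : Measurable fun q : (ℝ × E3) × Y => q.1.1⁻¹ ^ 3 := by fun_prop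
  exact h3.mul (h4.mul h2)

theorem Wt.meas1 (w : Wt μ ι g b C) {Q : E3 → ℝ} (h : KQ Q) (r : ℝ) (x : E3) :
    Measurable fun y => g y * (r⁻¹ ^ 3 * Q (xi r x (ι y))) :=
  (w.meas3 h).comp (measurable_prodMk_left (x := (r, x)))

theorem Wt.dom (w : Wt μ ι g b C) {Q : E3 → ℝ} (h : KQ Q) (r : ℝ) (x : E3) (y : Y) :
    |g y * (r⁻¹ ^ 3 * Q (xi r x (ι y)))| ≤ |g y| * (|r⁻¹ ^ 3| * 34) := by
  rw [abs_mul, abs_mul]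
  have := h.le (xi r x (ι y))
  gcongr

theorem Wt.int1 (w : Wt μ ι g b C) {Q : E3 → ℝ} (h : KQ Q) (r : ℝ) (x : E3) :
    Integrable (fun y => g y * (r⁻¹ ^ 3 * Q (xi r x (ι y)))) μ :=
  ((w.gint.abs).mul_const _).mono' (w.meas1 h r x).aestronglyMeasurable (Eventually.of_forall (w.dom h r x))

theorem Wt.psi_meas (w : Wt μ ι g b C) {Q : E3 → ℝ} (h : KQ Q) :
    Measurable fun q : ℝ × E3 => Psi μ ι g Q q.1 q.2 := by
  haveI := w.sf
  exact (StronglyMeasurable.integral_prod_right (f := fun (q : ℝ × E3) (y : Y) => g y * (q.1⁻¹ ^ 3 * Q (xi q.1 q.2 (ι y))))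
    (w.meas3 h).stronglyMeasurable).measurable

theorem Wt.psi_cont (w : Wt μ ι g b C) {Q : E3 → ℝ} (h : KQ Q) (r : ℝ) : Continuous (Psi μ ι g Q r) := by
  refine continuous_of_dominated (fun x => (w.meas1 h r x).aestronglyMeasurable)
    (fun x => Eventually.of_forall (w.dom h r x)) ((w.gint.abs).mul_const _) (Eventually.of_forall fun y => ?_)
  have h1 : Continuous fun x => xi r x (ι y) := (xi_cont r).comp (by fun_prop : Continuous fun x => (x, ι y))
  have h2 : Continuous fun x => Q (xi r x (ι y)) := h.cont.comp h1
  exact continuous_const.mul (continuous_const.mul h2)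

theorem xi_deriv (r : ℝ) (y x : E3) : HasFDerivAt (fun x => xi r x y) (-(aa r / r) • ContinuousLinearMap.id ℝ E3) x := by
  have e : (fun x => xi r x y) = fun x => r⁻¹ • y + (-(aa r / r)) • x := by
    funext x
    unfold xi
    rw [smul_sub, smul_smul, neg_smul, ← sub_eq_add_neg, mul_comm, div_eq_mul_inv]
  rw [e]
  exact ((hasFDerivAt_id x).const_smul (-(aa r / r))).const_add _

theorem Wt.psi_deriv (w : Wt μ ι g b C) {Q : E3 → ℝ} {Qd} (h : KD Q Qd) (r : ℝ) (x : E3) :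
    HasFDerivAt (Psi μ ι g Q r) (gv fun j => -(aa r / r) * Psi μ ι g (Qd j) r x) x := by
  have hd : ∀ y x, HasFDerivAt (fun x => g y * (r⁻¹ ^ 3 * Q (xi r x (ι y))))
      (gv fun j => -(aa r / r) * (g y * (r⁻¹ ^ 3 * Qd j (xi r x (ι y))))) x := fun y x => by
    have h1 := (h.der (xi r x (ι y))).comp x (xi_deriv r (ι y) x)
    refine gv_of ((h1.const_mul (r⁻¹ ^ 3)).const_mul (g y)) fun e => ?_
    simp only [ContinuousLinearMap.smul_apply, ContinuousLinearMap.comp_apply, map_smul, map_neg, gv_apply, smul_eq_mul,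
      ContinuousLinearMap.neg_apply, ContinuousLinearMap.id_apply]
    ring
  have := dom_deriv (μ := μ) (F := fun x y => g y * (r⁻¹ ^ 3 * Q (xi r x (ι y))))
    (G := fun j x y => -(aa r / r) * (g y * (r⁻¹ ^ 3 * Qd j (xi r x (ι y))))) (s := Set.univ) isOpen_univ
    (Set.mem_univ x) (B := fun y => |(-(aa r / r))| * (|g y| * (|r⁻¹ ^ 3| * 34)))
    (fun x _ => w.int1 h.kq r x) (fun j => ((w.meas1 (h.kqd j) r x).const_mul _).aestronglyMeasurable)
    (Eventually.of_forall fun y x _ => hd y x)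
    (Eventually.of_forall fun y j x _ => by
      rw [abs_mul]
      exact mul_le_mul_of_nonneg_left (w.dom (h.kqd j) r x y) (abs_nonneg _))
    (((w.gint.abs).mul_const _).const_mul _)
  simp_rw [integral_const_mul] at this
  exact this

/-- integral over scales -/
def Isc {Y : Type} [MeasurableSpace Y] (μ : Measure Y) (ι : Y → E3) (g : Y → ℝ) (k : ℕ) (Q : E3 → ℝ) (x : E3) : ℝ :=
  ∫ r in Set.Ioi (0:ℝ), om r * (-(aa r / r)) ^ k * Psi μ ι g Q r x

theorem Wt.isc_meas (w : Wt μ ι g b C) {Q : E3 → ℝ} (h : KQ Q) (k : ℕ) (x : E3) :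
    Measurable fun r => om r * (-(aa r / r)) ^ k * Psi μ ι g Q r x := by
  have h1 := (w.psi_meas h).comp (measurable_prodMk_right (y := x))
  have := aa_cont.measurable
  have := om_meas
  simp only [Function.comp_def] at h1
  fun_prop

theorem Wt.isc_deriv (w : Wt μ ι g b C) {Q : E3 → ℝ} {Qd} (h : KD Q Qd) (k : ℕ) {s : Set E3} (hs : IsOpen s)
    {B : ℝ → ℝ} (hB : IntegrableOn B (Set.Ioi 0))
    (h0 : ∀ x ∈ s, IntegrableOn (fun r => om r * (-(aa r / r)) ^ k * Psi μ ι g Q r x) (Set.Ioi 0))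
    (h1 : ∀ x ∈ s, ∀ j, ∀ r > 0, |om r * (-(aa r / r)) ^ (k + 1) * Psi μ ι g (Qd j) r x| ≤ B r) {x : E3} (hx : x ∈ s) :
    HasFDerivAt (Isc μ ι g k Q) (gv fun j => Isc μ ι g (k + 1) (Qd j) x) x := by
  refine dom_deriv (μ := volume.restrict (Set.Ioi (0:ℝ))) (F := fun x r => om r * (-(aa r / r)) ^ k * Psi μ ι g Q r x)
    (G := fun j x r => om r * (-(aa r / r)) ^ (k + 1) * Psi μ ι g (Qd j) r x) hs hx (B := B) h0
    (fun j => (w.isc_meas (h.kqd j) _ x).aestronglyMeasurable) (Eventually.of_forall fun r x _ => ?_)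
    ((ae_restrict_mem measurableSet_Ioi).mono fun r hr j x hx => h1 x hx j r hr) hB
  refine gv_of ((w.psi_deriv h r x).const_mul (om r * (-(aa r / r)) ^ k)) fun e => ?_
  simp only [ContinuousLinearMap.smul_apply, gv_apply, smul_eq_mul]
  ring

theorem Wt.isc_cont (w : Wt μ ι g b C) {Q : E3 → ℝ} (h : KQ Q) (k : ℕ) {s : Set E3}
    {B : ℝ → ℝ} (hB : IntegrableOn B (Set.Ioi 0))
    (h1 : ∀ x ∈ s, ∀ r > 0, |om r * (-(aa r / r)) ^ k * Psi μ ι g Q r x| ≤ B r) :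
    ContinuousOn (Isc μ ι g k Q) s := by
  refine continuousOn_of_dominated (bound := B) (fun x _ => (w.isc_meas h _ x).aestronglyMeasurable)
    (fun x hx => (ae_restrict_mem measurableSet_Ioi).mono fun r hr => h1 x hx r hr) hB
    (Eventually.of_forall fun r => ?_)
  exact ((w.psi_cont h r).const_mul _).continuousOn

theorem Wt.isc_int (w : Wt μ ι g b C) {Q : E3 → ℝ} (h : KQ Q) (k : ℕ) {x : E3}
    {B : ℝ → ℝ} (hB : IntegrableOn B (Set.Ioi 0))
    (h1 : ∀ r > 0, |om r * (-(aa r / r)) ^ k * Psi μ ι g Q r x| ≤ B r) :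
    IntegrableOn (fun r => om r * (-(aa r / r)) ^ k * Psi μ ι g Q r x) (Set.Ioi 0) :=
  hB.mono' (w.isc_meas h _ x).aestronglyMeasurable
    ((ae_restrict_mem measurableSet_Ioi).mono fun r hr => h1 r hr)

end
end Ham

namespace Ham

theorem cov {n : ℕ} (F : Euc n → ℝ) (c : Euc n) {r : ℝ} (hr : 0 < r) :
    ∫ z, F (c + r • z) = r⁻¹ ^ n * ∫ y, F y := by
  have h := Measure.integral_comp_smul (volume : Measure (Euc n)) (fun y => F (c + y)) r
  rw [finrank_euclideanSpace_fin, integral_add_left_eq_self, abs_of_pos (by positivity), ← inv_pow, smul_eq_mul] at h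
  exact h

theorem xi_cov {r : ℝ} (hr : 0 < r) (x z : E3) : xi r x (aa r • x + r • z) = z := by
  unfold xi
  rw [add_sub_cancel_left, smul_smul, inv_mul_cancel₀ hr.ne', one_smul]

def up (z : E2) (s : ℝ) : E3 := !₂[z 0, z 1, s]

theorem up_sq (z : E2) (s : ℝ) : ‖up z s‖ ^ 2 = ‖z‖ ^ 2 + s ^ 2 := by
  rw [EuclideanSpace.norm_sq_eq, EuclideanSpace.norm_sq_eq]
  simp [up, Fin.sum_univ_three]

theorem up_cont : Continuous fun q : E2 × ℝ => up q.1 q.2 := by unfold up; fun_prop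

theorem xi_cov2 {r : ℝ} (hr : 0 < r) (x : E3) (z : E2) :
    xi r x (io (aa r • hz x + r • z)) = up z (-(aa r / r * x 2)) := by
  ext i
  fin_cases i <;> simp [xi, io, hz, up] <;> field_simp

theorem Psi3 (g : E3 → ℝ) (Q : E3 → ℝ) {r : ℝ} (hr : 0 < r) (x : E3) :
    Psi volume id g Q r x = ∫ z, g (aa r • x + r • z) * Q z := by
  have h := cov (fun y => g y * Q (xi r x y)) (aa r • x) hr
  simp only [xi_cov hr] at h
  rw [h, ← integral_const_mul]
  unfold Psi
  refine integral_congr_ae (Eventually.of_forall fun y => ?_)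
  simp only [id]; ring

theorem Psi2 (g : E2 → ℝ) (Q : E3 → ℝ) {r : ℝ} (hr : 0 < r) (x : E3) :
    Psi volume io g Q r x = r⁻¹ * ∫ z, g (aa r • hz x + r • z) * Q (up z (-(aa r / r * x 2))) := by
  have h := cov (fun y => g y * Q (xi r x (io y))) (aa r • hz x) hr
  simp only [xi_cov2 hr] at h
  rw [h, ← mul_assoc, ← integral_const_mul]
  unfold Psi
  refine integral_congr_ae (Eventually.of_forall fun y => ?_)
  simp only []; ring

theorem pt_exp {r b c θ : ℝ} (hr : 0 < r) (hb : b ≤ 3 / 16) (hc : 0 ≤ c) (hθ : b = c + θ) (x y : E3) :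
    exp (-b * ‖y‖ ^ 2) * exp (-(3 / 16) * ‖xi r x y‖ ^ 2) ≤
      exp (-c * ‖x‖ ^ 2) * (exp (-θ * ‖y‖ ^ 2) * exp (-θ * ‖xi r x y‖ ^ 2)) := by
  rw [← Real.exp_add, ← Real.exp_add, ← Real.exp_add]
  apply Real.exp_le_exp.2
  have h := xi_rot hr x y
  have h2 : c * ‖x‖ ^ 2 ≤ c * (‖xi r x y‖ ^ 2 + ‖y‖ ^ 2) := by
    rw [h]; nlinarith [mul_nonneg hc (sq_nonneg ‖xi r y x‖)]
  have h3 : b * ‖xi r x y‖ ^ 2 ≤ 3/16 * ‖xi r x y‖ ^ 2 := by gcongr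
  subst hθ
  nlinarith

theorem pt_bd {r b c θ C g q : ℝ} (hr : 0 < r) (hb : b ≤ 3 / 16) (hc : 0 ≤ c) (hθ : b = c + θ) (x y : E3)
    (hC : 0 ≤ C) (hg : |g| ≤ C * exp (-b * ‖y‖ ^ 2)) (hq : |q| ≤ 34 * exp (-(3 / 16) * ‖xi r x y‖ ^ 2)) :
    |g * q| ≤ 34 * C * exp (-c * ‖x‖ ^ 2) * (exp (-θ * ‖y‖ ^ 2) * exp (-θ * ‖xi r x y‖ ^ 2)) := by
  rw [abs_mul]
  calc |g| * |q| ≤ (C * exp (-b * ‖y‖ ^ 2)) * (34 * exp (-(3 / 16) * ‖xi r x y‖ ^ 2)) := by gcongr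
    _ = 34 * C * (exp (-b * ‖y‖ ^ 2) * exp (-(3 / 16) * ‖xi r x y‖ ^ 2)) := by ring
    _ ≤ 34 * C * (exp (-c * ‖x‖ ^ 2) * (exp (-θ * ‖y‖ ^ 2) * exp (-θ * ‖xi r x y‖ ^ 2))) :=
        mul_le_mul_of_nonneg_left (pt_exp hr hb hc hθ x y) (by positivity)
    _ = _ := by ring

def Gn (n : ℕ) (θ : ℝ) : ℝ := ∫ z : Euc n, exp (-θ * ‖z‖ ^ 2)

theorem Gn_nn (n : ℕ) (θ : ℝ) : 0 ≤ Gn n θ := integral_nonneg fun z => (exp_pos _).le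

theorem exp_le1 {θ t : ℝ} (hθ : 0 ≤ θ) (ht : 0 ≤ t) : exp (-θ * t) ≤ 1 :=
  Real.exp_le_one_iff.2 (by nlinarith [mul_nonneg hθ ht])

theorem psiA_bd {g : E3 → ℝ} {b c θ C : ℝ} (w : Wt volume id g b C) (hb : b ≤ 3 / 16) (hc : 0 ≤ c) (hθ : 0 < θ)
    (hbc : b = c + θ) {Q : E3 → ℝ} (h : KQ Q) {r : ℝ} (hr : 0 < r) (x : E3) :
    |Psi volume id g Q r x| ≤ 34 * C * Gn 3 θ * exp (-c * ‖x‖ ^ 2) * min 1 (r⁻¹ ^ 3) := by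
  have hC := w.C0
  have hG := Gn_nn 3 θ
  have key : ∀ y, _ := fun y => pt_bd hr hb hc hbc x y hC (w.bd y) (h.bd (xi r x y))
  have i1 := gauss_int (n := 3) hθ
  rw [mul_min_of_nonneg _ _ (by positivity), mul_one, le_min_iff]
  constructor
  · rw [Psi3 g Q hr, ← Real.norm_eq_abs]
    refine (norm_integral_le_of_norm_le (i1.const_mul (34 * C * exp (-c * ‖x‖ ^ 2))) (Eventually.of_forall fun z => ?_)).trans ?_
    · have k := key (aa r • x + r • z)
      rw [xi_cov hr] at k
      refine k.trans ?_
      have := exp_le1 hθ.le (sq_nonneg ‖aa r • x + r • z‖)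
      have := exp_pos (-θ * ‖z‖ ^ 2)
      gcongr
      nlinarith
    · rw [integral_const_mul]; unfold Gn; apply le_of_eq; ring
  · rw [← Real.norm_eq_abs]
    unfold Psi
    refine (norm_integral_le_of_norm_le (i1.const_mul (34 * C * exp (-c * ‖x‖ ^ 2) * r⁻¹ ^ 3)) (Eventually.of_forall fun y => ?_)).trans ?_
    · have k := key y
      have e : g y * (r⁻¹ ^ 3 * Q (xi r x (id y))) = r⁻¹ ^ 3 * (g y * Q (xi r x y)) := by simp only [id]; ring
      rw [e, norm_mul, Real.norm_of_nonneg (by positivity), Real.norm_eq_abs]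
      have := exp_le1 hθ.le (sq_nonneg ‖xi r x y‖)
      have := exp_pos (-θ * ‖y‖ ^ 2)
      calc r⁻¹ ^ 3 * |g y * Q (xi r x y)| ≤ r⁻¹ ^ 3 * (34 * C * exp (-c * ‖x‖ ^ 2) * (exp (-θ * ‖y‖ ^ 2) * 1)) := by
            refine mul_le_mul_of_nonneg_left (k.trans ?_) (by positivity)
            gcongr
        _ = _ := by ring
    · rw [integral_const_mul]; unfold Gn; apply le_of_eq; ring

theorem psiS_bd {g : E2 → ℝ} {b c θ C : ℝ} (w : Wt volume io g b C) (hb : b ≤ 3 / 16) (hc : 0 ≤ c) (hθ : 0 < θ)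
    (hbc : b = c + θ) {Q : E3 → ℝ} (h : KQ Q) {r : ℝ} (hr : 0 < r) (x : E3) :
    |Psi volume io g Q r x| ≤ 34 * C * Gn 2 θ * exp (-c * ‖x‖ ^ 2) * exp (-θ * (aa r / r * x 2) ^ 2) * min r⁻¹ (r⁻¹ ^ 3) := by
  have hC := w.C0
  have hG := Gn_nn 2 θ
  have key := fun y => pt_bd hr hb hc hbc x (io y) hC (w.bd y) (h.bd (xi r x (io y)))
  have i1 := gauss_int (n := 2) hθ
  have hk : ∀ z : E2, exp (-θ * ‖up z (-(aa r / r * x 2))‖ ^ 2) = exp (-θ * (aa r / r * x 2) ^ 2) * exp (-θ * ‖z‖ ^ 2) := fun z => by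
    rw [up_sq, ← Real.exp_add]; congr 1; ring
  have hk2 : ∀ y : E2, exp (-θ * ‖xi r x (io y)‖ ^ 2) ≤ exp (-θ * (aa r / r * x 2) ^ 2) := fun y => by
    have e : y = aa r • hz x + r • (r⁻¹ • (y - aa r • hz x)) := by
      rw [smul_smul, mul_inv_cancel₀ hr.ne', one_smul]; abel
    rw [e, xi_cov2 hr, hk]
    have := exp_le1 hθ.le (sq_nonneg ‖r⁻¹ • (y - aa r • hz x)‖)
    have := exp_pos (-θ * (aa r / r * x 2) ^ 2)
    nlinarith
  rw [mul_min_of_nonneg _ _ (by positivity), le_min_iff]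
  constructor
  · rw [Psi2 g Q hr, ← integral_const_mul, ← Real.norm_eq_abs]
    refine (norm_integral_le_of_norm_le (i1.const_mul (34 * C * exp (-c * ‖x‖ ^ 2) * exp (-θ * (aa r / r * x 2) ^ 2) * r⁻¹)) (Eventually.of_forall fun z => ?_)).trans ?_
    · have k := key (aa r • hz x + r • z)
      rw [xi_cov2 hr, hk] at k
      rw [norm_mul, Real.norm_of_nonneg (by positivity), Real.norm_eq_abs]
      have := exp_le1 hθ.le (sq_nonneg ‖io (aa r • hz x + r • z)‖)
      have := exp_pos (-θ * ‖z‖ ^ 2)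
      calc r⁻¹ * |g (aa r • hz x + r • z) * Q (up z (-(aa r / r * x 2)))| ≤
          r⁻¹ * (34 * C * exp (-c * ‖x‖ ^ 2) * (1 * (exp (-θ * (aa r / r * x 2) ^ 2) * exp (-θ * ‖z‖ ^ 2)))) := by
            refine mul_le_mul_of_nonneg_left (k.trans ?_) (by positivity)
            gcongr
        _ = _ := by ring
    · rw [integral_const_mul]; unfold Gn; apply le_of_eq; ring
  · rw [← Real.norm_eq_abs]
    unfold Psi
    refine (norm_integral_le_of_norm_le (i1.const_mul (34 * C * exp (-c * ‖x‖ ^ 2) * exp (-θ * (aa r / r * x 2) ^ 2) * r⁻¹ ^ 3)) (Eventually.of_forall fun y => ?_)).trans ?_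
    · have k := key y
      have e : g y * (r⁻¹ ^ 3 * Q (xi r x (io y))) = r⁻¹ ^ 3 * (g y * Q (xi r x (io y))) := by ring
      rw [e, norm_mul, Real.norm_of_nonneg (by positivity), Real.norm_eq_abs]
      rw [io_norm] at k
      have := hk2 y
      have := exp_pos (-θ * ‖y‖ ^ 2)
      calc r⁻¹ ^ 3 * |g y * Q (xi r x (io y))| ≤ r⁻¹ ^ 3 * (34 * C * exp (-c * ‖x‖ ^ 2) * (exp (-θ * ‖y‖ ^ 2) * exp (-θ * (aa r / r * x 2) ^ 2))) := by
            refine mul_le_mul_of_nonneg_left (k.trans ?_) (by positivity)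
            gcongr
        _ = _ := by ring
    · rw [integral_const_mul]; unfold Gn; apply le_of_eq; ring

end Ham

namespace Ham

/-- universal majorant -/
def Nm (r : ℝ) : ℝ := min (r ^ (-(3/4) : ℝ)) (r ^ (-2 : ℝ))

theorem Nm_int : IntegrableOn Nm (Set.Ioi 0) := by
  have hm : Measurable Nm := by unfold Nm; fun_prop
  rw [← Set.Ioc_union_Ioi_eq_Ioi (zero_le_one : (0:ℝ) ≤ 1)]
  refine IntegrableOn.union ?_ ?_
  · have h : IntegrableOn (fun r : ℝ => r ^ (-(3/4) : ℝ)) (Set.Ioc 0 1) := by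
      rw [← intervalIntegrable_iff_integrableOn_Ioc_of_le zero_le_one]
      exact intervalIntegral.intervalIntegrable_rpow' (by norm_num)
    refine h.mono' hm.aestronglyMeasurable ((ae_restrict_mem measurableSet_Ioc).mono fun r hr => ?_)
    have : 0 < r := hr.1
    rw [Real.norm_of_nonneg (by unfold Nm; positivity)]
    exact min_le_left _ _
  · have h : IntegrableOn (fun r : ℝ => r ^ (-2 : ℝ)) (Set.Ioi 1) :=
      integrableOn_Ioi_rpow_of_lt (by norm_num) one_pos
    refine h.mono' hm.aestronglyMeasurable ((ae_restrict_mem measurableSet_Ioi).mono fun r hr => ?_)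
    have : 0 < r := one_pos.trans hr
    rw [Real.norm_of_nonneg (by unfold Nm; positivity)]
    exact min_le_right _ _

theorem Nm_nn {r : ℝ} (hr : 0 < r) : 0 ≤ Nm r := by unfold Nm; positivity

theorem Nm_le {r f : ℝ} (hr : 0 < r) (h1 : r ≤ 1 → f ≤ r ^ (-(3/4) : ℝ)) (h2 : 1 ≤ r → f ≤ r ^ (-2 : ℝ)) : f ≤ Nm r := by
  rcases le_total r 1 with h | h
  · exact le_min (h1 h) ((h1 h).trans (Real.rpow_le_rpow_of_exponent_ge hr h (by norm_num)))
  · exact le_min ((h2 h).trans (Real.rpow_le_rpow_of_exponent_le h (by norm_num))) (h2 h)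

/-- power version -/
theorem Nm_pow {r f α β : ℝ} (hr : 0 < r) (h1 : f ≤ r ^ α) (h2 : f ≤ r ^ β) (hα : -(3/4) ≤ α) (hβ : β ≤ -2) : f ≤ Nm r :=
  Nm_le hr (fun h => h1.trans (Real.rpow_le_rpow_of_exponent_ge hr h hα))
    (fun h => h2.trans (Real.rpow_le_rpow_of_exponent_le h hβ))

theorem inv3_rpow {r : ℝ} (hr : 0 < r) : r⁻¹ ^ 3 = r ^ (-3 : ℝ) := by
  rw [Real.rpow_neg hr.le, inv_pow]; norm_cast
theorem inv1_rpow {r : ℝ} (hr : 0 < r) : r⁻¹ = r ^ (-1 : ℝ) := (Real.rpow_neg_one r).symm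
theorem pow1_rpow (r : ℝ) : r = r ^ (1 : ℝ) := (Real.rpow_one r).symm

theorem ar_ge {r : ℝ} (hr : 0 < r) : 1 ≤ aa r / r := by
  rw [le_div_iff₀ hr, one_mul]
  exact Real.le_sqrt_of_sq_le (by linarith)

theorem om2 {r : ℝ} (hr : 0 < r) : om r * (aa r / r) ^ 2 = 2 / c4 * r⁻¹ := by
  unfold om
  rw [div_pow, aa_sq]
  have : 1 + r ^ 2 ≠ 0 := by positivity
  field_simp

theorem c4d : 0 < 2 / c4 := div_pos two_pos c4_pos

theorem om1' {r : ℝ} (hr : 0 < r) : om r * (aa r / r) = 2 / c4 * (aa r)⁻¹ := by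
  unfold om
  rw [← aa_sq]
  have := aa_pos r
  field_simp

theorem om1 {r : ℝ} (hr : 0 < r) : om r * (aa r / r) ≤ 2 / c4 := by
  rw [om1' hr]
  have := inv_le_one_of_one_le₀ (aa_ge r)
  have := c4d
  nlinarith

theorem om_le1 {r : ℝ} (hr : 0 < r) : om r ≤ om r * (aa r / r) := by
  have := om_nn hr
  have := ar_ge hr
  nlinarith

theorem om_half {r : ℝ} (hr : 0 < r) : om r * √(aa r / r) ≤ 2 / c4 * √r := by
  have h0 := om_nn hr
  have h4 := c4d
  refine (pow_le_pow_iff_left₀ (by positivity) (by positivity) (two_ne_zero)).1 ?_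
  have ha := ar_ge hr
  rw [mul_pow, mul_pow, Real.sq_sqrt (by linarith), Real.sq_sqrt hr.le]
  have h1 := om1 hr
  have h2 := om_le hr
  calc om r ^ 2 * (aa r / r) = om r * (om r * (aa r / r)) := by ring
    _ ≤ (2 / c4 * r) * (2 / c4) := by gcongr
    _ = _ := by ring

/-- basic decay -/
def mr (r : ℝ) : ℝ := min r⁻¹ (r⁻¹ ^ 3)

theorem mr_nn {r : ℝ} (hr : 0 < r) : 0 ≤ mr r := by unfold mr; positivity

theorem mr_ge {r : ℝ} (hr : 0 < r) : min 1 (r⁻¹ ^ 3) ≤ mr r := by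
  unfold mr
  refine le_min ?_ (min_le_right _ _)
  rcases le_total r 1 with h | h
  · exact (min_le_left _ _).trans ((one_le_inv₀ hr).2 h)
  · refine (min_le_right _ _).trans ?_
    have h1 := inv_le_one_of_one_le₀ h
    have h2 : 0 < r⁻¹ := by positivity
    calc r⁻¹ ^ 3 ≤ r⁻¹ ^ 1 := pow_le_pow_of_le_one h2.le h1 (by norm_num)
      _ = _ := pow_one _

theorem half_mr {r : ℝ} (hr : 0 < r) : √r * mr r ≤ Nm r := by
  have hs : √r = r ^ (1/2 : ℝ) := Real.sqrt_eq_rpow r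
  refine Nm_pow (α := -(1/2)) (β := -(5/2)) hr ?_ ?_ (by norm_num) (by norm_num)
  · calc √r * mr r ≤ √r * r⁻¹ := by gcongr; exact min_le_left _ _
      _ = _ := by rw [hs, inv1_rpow hr, ← Real.rpow_add hr]; norm_num
  · calc √r * mr r ≤ √r * r⁻¹ ^ 3 := by gcongr; exact min_le_right _ _
      _ = _ := by rw [hs, inv3_rpow hr, ← Real.rpow_add hr]; norm_num

theorem one_mr {r : ℝ} (hr : 0 < r) : r * mr r ≤ Nm r := by
  refine Nm_pow (α := 0) (β := -2) hr ?_ ?_ (by norm_num) (by norm_num)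
  · calc r * mr r ≤ r * r⁻¹ := by gcongr; exact min_le_left _ _
      _ = _ := by rw [mul_inv_cancel₀ hr.ne', Real.rpow_zero]
  · calc r * mr r ≤ r * r⁻¹ ^ 3 := by gcongr; exact min_le_right _ _
      _ = r ^ (1:ℝ) * r ^ (-3 : ℝ) := by rw [inv3_rpow hr, Real.rpow_one]
      _ = _ := by rw [← Real.rpow_add hr]; norm_num

section
variable {Y : Type} [MeasurableSpace Y] {μ : Measure Y} {ι : Y → E3} {g : Y → ℝ} {b C : ℝ}

theorem isc0_bd (w : Wt μ ι g b C) {K : ℝ} (hK : 0 ≤ K) {Q : E3 → ℝ} (x : E3) 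
    (hb : ∀ r > 0, |Psi μ ι g Q r x| ≤ K * mr r) : ∀ r > 0, |om r * (-(aa r / r)) ^ 0 * Psi μ ι g Q r x| ≤ 2 / c4 * K * Nm r := by
  intro r hr
  have h4 := c4d
  have ho := om_nn hr
  rw [pow_zero, mul_one, abs_mul, abs_of_nonneg ho]
  calc om r * |Psi μ ι g Q r x| ≤ (2 / c4 * r) * (K * mr r) := by
        have := hb r hr
        have := om_le hr
        gcongr
    _ = 2 / c4 * K * (r * mr r) := by ring
    _ ≤ _ := by
        have := one_mr hr
        gcongr

theorem min_le_sqrt {t X Y : ℝ} (h0 : 0 ≤ t) (h1 : t ≤ X) (h2 : t ≤ Y) : t ≤ √(X * Y) :=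
  Real.le_sqrt_of_sq_le (by rw [sq]; gcongr; linarith)

theorem isc_holder (w : Wt μ ι g b C) {K : ℝ} (hK : 0 ≤ K) {Q : E3 → ℝ} {Qd} (h : KD Q Qd)
    (hb : ∀ Q, KQ Q → ∀ x, ∀ r > 0, |Psi μ ι g Q r x| ≤ K * mr r) (x x' : E3) :
    |Isc μ ι g 0 Q x - Isc μ ι g 0 Q x'| ≤ (2 / c4 * K * 3 * ∫ r in Set.Ioi 0, Nm r) * √‖x - x'‖ := by
  have h4 := c4d
  have i1 := w.isc_int h.kq 0 (Nm_int.const_mul (2 / c4 * K)) (isc0_bd w hK x (hb Q h.kq x))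
  have i2 := w.isc_int h.kq 0 (Nm_int.const_mul (2 / c4 * K)) (isc0_bd w hK x' (hb Q h.kq x'))
  unfold Isc
  rw [← integral_sub i1 i2, ← Real.norm_eq_abs]
  refine (norm_integral_le_of_norm_le ((Nm_int.const_mul (2 / c4 * K * 3)).mul_const √‖x - x'‖)
    ((ae_restrict_mem measurableSet_Ioi).mono fun r hr => ?_)).trans ?_
  · have hr : 0 < r := hr
    have ho := om_nn hr
    have hm := mr_nn hr
    have ha := ar_ge hr
    have e : om r * (-(aa r / r)) ^ 0 * Psi μ ι g Q r x - om r * (-(aa r / r)) ^ 0 * Psi μ ι g Q r x' =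
      om r * (Psi μ ι g Q r x - Psi μ ι g Q r x') := by ring
    rw [e, norm_mul, Real.norm_of_nonneg ho, Real.norm_eq_abs]
    have b1 : |Psi μ ι g Q r x - Psi μ ι g Q r x'| ≤ 2 * (K * mr r) := by
      refine (abs_sub _ _).trans ?_
      linarith [hb Q h.kq x r hr, hb Q h.kq x' r hr]
    have b2 : |Psi μ ι g Q r x - Psi μ ι g Q r x'| ≤ 3 * (aa r / r * (K * mr r)) * ‖x - x'‖ := by
      rw [← Real.norm_eq_abs]
      refine Convex.norm_image_sub_le_of_norm_hasFDerivWithin_le (𝕜 := ℝ) (s := Set.univ)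
        (fun z _ => (w.psi_deriv h r z).hasFDerivWithinAt) (fun z _ => gv_norm fun j => ?_) convex_univ (Set.mem_univ _) (Set.mem_univ _)
      rw [abs_mul, abs_neg, abs_of_nonneg (by linarith)]
      have := hb (Qd j) (h.kqd j) z r hr
      gcongr
    have b3 := min_le_sqrt (abs_nonneg _) b1 b2
    have e2 : √(2 * (K * mr r) * (3 * (aa r / r * (K * mr r)) * ‖x - x'‖)) ≤ 3 * (K * mr r) * √(aa r / r) * √‖x - x'‖ := by
      refine Real.sqrt_le_iff.2 ⟨by positivity, ?_⟩
      rw [mul_pow, mul_pow, Real.sq_sqrt (by linarith), Real.sq_sqrt (norm_nonneg _)]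
      have : 0 ≤ (K * mr r) ^ 2 * (aa r / r) * ‖x - x'‖ := by positivity
      nlinarith
    have h5 := om_half hr
    have h6 := half_mr hr
    calc om r * |Psi μ ι g Q r x - Psi μ ι g Q r x'| ≤ om r * (3 * (K * mr r) * √(aa r / r) * √‖x - x'‖) := by
          gcongr; exact b3.trans e2
      _ = 3 * K * mr r * √‖x - x'‖ * (om r * √(aa r / r)) := by ring
      _ ≤ 3 * K * mr r * √‖x - x'‖ * (2 / c4 * √r) := by gcongr
      _ = 2 / c4 * K * 3 * √‖x - x'‖ * (√r * mr r) := by ring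
      _ ≤ 2 / c4 * K * 3 * √‖x - x'‖ * Nm r := by gcongr
      _ = _ := by ring
  · rw [integral_mul_const, integral_const_mul]

end
end Ham

namespace Ham

def th (p : ℝ) : ℝ := min (p - 2) (1 / 2) / 16
def cc (p : ℝ) : ℝ := 1 / 8 + th p
def bb (p : ℝ) : ℝ := cc p + th p

theorem th_pos {p : ℝ} (hp : 2 < p) : 0 < th p := by
  unfold th
  have : 0 < min (p - 2) (1 / 2) := lt_min (by linarith) (by norm_num)
  positivity

theorem bb_le (p : ℝ) : bb p ≤ 3 / 16 := by
  unfold bb cc th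
  linarith [min_le_right (p - 2) (1 / 2)]
theorem bb_le' (p : ℝ) : bb p ≤ (p - 1) / 8 := by
  unfold bb cc th
  linarith [min_le_left (p - 2) (1 / 2)]
theorem cc_pos {p : ℝ} (hp : 2 < p) : 1 / 8 < cc p := by
  unfold cc; linarith [th_pos hp]
theorem bb_pos {p : ℝ} (hp : 2 < p) : 0 < bb p := by
  unfold bb; linarith [th_pos hp, cc_pos hp]

/-- all standing assumptions -/
structure Sys (p ε M : ℝ) (U : E3 → ℝ) : Prop where
  hp1 : 2 < p
  hp2 : p ≤ 4
  he : 0 < ε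
  he1 : ε ≤ 1
  hM : 1 ≤ M
  sol : Sol p ε M U

section
variable {p ε M : ℝ} {U : E3 → ℝ}

theorem Sys.wA (s : Sys p ε M U) : Wt volume id (Wf p ε U) (bb p) (2 * M ^ 5) where
  sf := inferInstance
  im := measurable_id
  gm := by
    have := s.sol.meas
    unfold Wf; fun_prop
  b0 := bb_pos s.hp1
  C0 := by have := s.hM; positivity
  int := fun t ht => by simpa using gauss_int (n := 3) ht
  bd := fun y => by
    have hU := s.sol.pos y
    have hb := s.sol.bd y
    have hM := s.hM
    have hp1 := s.hp1
    have hp2 := s.hp2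
    have he := s.he
    have he1 := s.he1
    have hq : 0 ≤ ‖y‖ ^ 2 := sq_nonneg _
    have e1 : U y ^ (p - 1) ≤ M ^ 5 * exp (-(bb p) * ‖y‖ ^ 2) := by
      calc U y ^ (p - 1) ≤ (exp (-(1 / 8) * ‖y‖ ^ 2) * M) ^ (p - 1) :=
            Real.rpow_le_rpow hU.le (by rw [mul_comm]; exact hb) (by linarith)
        _ = exp ((p - 1) * (-(1 / 8) * ‖y‖ ^ 2)) * M ^ (p - 1) := exp_rpow _ _ _ (by linarith)
        _ ≤ exp (-(bb p) * ‖y‖ ^ 2) * M ^ (5 : ℝ) := by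
            refine mul_le_mul (Real.exp_le_exp.2 ?_) (Real.rpow_le_rpow_of_exponent_le hM (by linarith)) (by positivity) (by positivity)
            have := mul_le_mul_of_nonneg_right (bb_le' p) hq
            linarith
        _ = _ := by rw [mul_comm]; norm_cast
    have e2 : ε ^ 2 * U y ^ 5 ≤ M ^ 5 * exp (-(bb p) * ‖y‖ ^ 2) := by
      calc ε ^ 2 * U y ^ 5 ≤ 1 * (M * exp (-(1 / 8) * ‖y‖ ^ 2)) ^ 5 := by
            gcongr
            exact pow_le_one₀ he.le he1
        _ = M ^ 5 * exp (5 * (-(1 / 8) * ‖y‖ ^ 2)) := by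
            rw [one_mul, mul_pow, ← Real.exp_nat_mul]; norm_num
        _ ≤ _ := by
            refine mul_le_mul_of_nonneg_left (Real.exp_le_exp.2 ?_) (by positivity)
            have := mul_le_mul_of_nonneg_right (bb_le p) hq
            linarith
    rw [abs_of_nonneg (by unfold Wf; positivity)]
    unfold Wf
    simp only [id]
    linarith

def Hf (ε : ℝ) (U : E3 → ℝ) (y : E2) : ℝ := 2 * hf ε U y

theorem Sys.wS (s : Sys p ε M U) : Wt volume io (Hf ε U) (bb p) (2 * M ^ 5) where
  sf := inferInstance
  im := io_m.measurable
  gm := by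
    have h : Measurable fun y => U (io y) := s.sol.meas.comp io_m.measurable
    exact ((h.pow_const 3).const_mul ε).const_mul 2
  b0 := bb_pos s.hp1
  C0 := by have := s.hM; positivity
  int := fun t ht => by simpa [io_norm] using gauss_int (n := 2) ht
  bd := fun y => by
    have hU := s.sol.pos (io y)
    have hb := s.sol.bd (io y)
    have hM := s.hM
    have he := s.he
    have he1 := s.he1
    have hq : 0 ≤ ‖io y‖ ^ 2 := sq_nonneg _
    rw [abs_of_nonneg (by unfold Hf hf; positivity)]
    unfold Hf hf
    calc 2 * (ε * U (io y) ^ 3) ≤ 2 * (1 * (M * exp (-(1 / 8) * ‖io y‖ ^ 2)) ^ 3) := by gcongr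
      _ = 2 * M ^ 3 * exp (3 * (-(1 / 8) * ‖io y‖ ^ 2)) := by
          rw [one_mul, mul_pow, ← Real.exp_nat_mul]; push_cast; ring
      _ ≤ _ := by
          have : M ^ 3 ≤ M ^ 5 := pow_le_pow_right₀ hM (by norm_num)
          refine mul_le_mul (by linarith) (Real.exp_le_exp.2 ?_) (by positivity) (by positivity)
          have := mul_le_mul_of_nonneg_right (bb_le p) hq
          linarith

abbrev PA (p ε : ℝ) (U : E3 → ℝ) := Psi volume id (Wf p ε U)
abbrev PS (ε : ℝ) (U : E3 → ℝ) := Psi volume io (Hf ε U)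
abbrev IA (p ε : ℝ) (U : E3 → ℝ) := Isc volume id (Wf p ε U)
abbrev IS (ε : ℝ) (U : E3 → ℝ) := Isc volume io (Hf ε U)

def KK (p M : ℝ) : ℝ := 34 * (2 * M ^ 5) * (Gn 3 (th p) + Gn 2 (th p))

theorem KK_nn (s : Sys p ε M U) : 0 ≤ KK p M := by
  have := s.hM
  have := Gn_nn 3 (th p)
  have := Gn_nn 2 (th p)
  unfold KK; positivity

theorem Sys.A_bd (s : Sys p ε M U) {Q : E3 → ℝ} (h : KQ Q) {r : ℝ} (hr : 0 < r) (x : E3) :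
    |PA p ε U Q r x| ≤ KK p M * exp (-(cc p) * ‖x‖ ^ 2) * min 1 (r⁻¹ ^ 3) := by
  have hM := s.hM
  refine (psiA_bd s.wA (bb_le p) (by linarith [cc_pos s.hp1]) (th_pos s.hp1) rfl h hr x).trans ?_
  have := Gn_nn 3 (th p)
  have := Gn_nn 2 (th p)
  unfold KK
  gcongr
  linarith

theorem Sys.S_bd (s : Sys p ε M U) {Q : E3 → ℝ} (h : KQ Q) {r : ℝ} (hr : 0 < r) (x : E3) :
    |PS ε U Q r x| ≤ KK p M * exp (-(cc p) * ‖x‖ ^ 2) * exp (-(th p) * (aa r / r * x 2) ^ 2) * mr r := by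
  have hM := s.hM
  refine (psiS_bd s.wS (bb_le p) (by linarith [cc_pos s.hp1]) (th_pos s.hp1) rfl h hr x).trans ?_
  have := Gn_nn 3 (th p)
  have := Gn_nn 2 (th p)
  have := mr_nn hr
  unfold KK mr
  gcongr
  linarith

theorem Sys.A_bd' (s : Sys p ε M U) (Q : E3 → ℝ) (h : KQ Q) (x : E3) (r : ℝ) (hr : 0 < r) :
    |PA p ε U Q r x| ≤ KK p M * mr r := by
  refine (s.A_bd h hr x).trans ?_
  have := KK_nn s
  have h1 := mr_ge hr
  have h2 := exp_le1 (θ := cc p) (by linarith [cc_pos s.hp1]) (sq_nonneg ‖x‖)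
  calc _ ≤ KK p M * 1 * mr r := by gcongr
    _ = _ := by ring

theorem Sys.S_bd' (s : Sys p ε M U) (Q : E3 → ℝ) (h : KQ Q) (x : E3) (r : ℝ) (hr : 0 < r) :
    |PS ε U Q r x| ≤ KK p M * mr r := by
  refine (s.S_bd h hr x).trans ?_
  have := KK_nn s
  have h1 := mr_nn hr
  have h2 := exp_le1 (θ := cc p) (by linarith [cc_pos s.hp1]) (sq_nonneg ‖x‖)
  have h3 := exp_le1 (θ := th p) (th_pos s.hp1).le (sq_nonneg (aa r / r * x 2))
  calc _ ≤ KK p M * 1 * 1 * mr r := by gcongr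
    _ = _ := by ring

theorem Sys.W_nn (s : Sys p ε M U) (y : E3) : 0 ≤ Wf p ε U y := by
  have := s.sol.pos y
  unfold Wf; positivity
theorem Sys.H_nn (s : Sys p ε M U) (y : E2) : 0 ≤ Hf ε U y := by
  have := s.sol.pos (io y)
  have := s.he
  unfold Hf hf; positivity

theorem Sys.U_eq (s : Sys p ε M U) (x : E3) : U x = IA p ε U 0 kq x + IS ε U 0 kq x := by
  have hK := KK_nn s
  have i1 := s.wA.isc_int KQ_kq 0 (Nm_int.const_mul (2 / c4 * KK p M)) (isc0_bd s.wA hK x (s.A_bd' kq KQ_kq x))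
  have i2 := s.wS.isc_int KQ_kq 0 (Nm_int.const_mul (2 / c4 * KK p M)) (isc0_bd s.wS hK x (s.S_bd' kq KQ_kq x))
  have h := s.sol.eq x
  have eA : ∀ r > 0, ∫⁻ y, ENNReal.ofReal (P r x y * Wf p ε U y) = ENNReal.ofReal (PA p ε U kq r x) := fun r hr => by
    unfold PA Psi
    rw [ofReal_integral_eq_lintegral_ofReal (s.wA.int1 KQ_kq r x) (Eventually.of_forall fun y => ?_)]
    · refine lintegral_congr fun y => ?_
      rw [P_kq, mul_comm]; rfl
    · have := s.W_nn y
      have := kq_pos (xi r x (id y))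
      have : 0 < r := hr
      simp only [Pi.zero_apply]; positivity
  have eS : ∀ r > 0, ∫⁻ y, ENNReal.ofReal (P r x (io y) * (2 * hf ε U y)) = ENNReal.ofReal (PS ε U kq r x) := fun r hr => by
    unfold PS Psi
    rw [ofReal_integral_eq_lintegral_ofReal (s.wS.int1 KQ_kq r x) (Eventually.of_forall fun y => ?_)]
    · refine lintegral_congr fun y => ?_
      rw [P_kq, mul_comm]; rfl
    · have := s.H_nn y
      have := kq_pos (xi r x (io y))
      have : 0 < r := hr
      simp only [Pi.zero_apply]; positivity
  have nA : ∀ r > 0, 0 ≤ PA p ε U kq r x := fun r hr => integral_nonneg fun y => by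
    have := s.W_nn y
    have := kq_pos (xi r x (id y))
    have : 0 < r := hr
    simp only [Pi.zero_apply]; positivity
  have nS : ∀ r > 0, 0 ≤ PS ε U kq r x := fun r hr => integral_nonneg fun y => by
    have := s.H_nn y
    have := kq_pos (xi r x (io y))
    have : 0 < r := hr
    simp only [Pi.zero_apply]; positivity
  unfold IA IS Isc
  rw [← integral_add i1 i2]
  have h2 : ENNReal.ofReal (U x) = ENNReal.ofReal (∫ r in Set.Ioi 0, (om r * (-(aa r / r)) ^ 0 * PA p ε U kq r x + om r * (-(aa r / r)) ^ 0 * PS ε U kq r x)) := by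
    have i3 : IntegrableOn (fun r => om r * (-(aa r / r)) ^ 0 * PA p ε U kq r x + om r * (-(aa r / r)) ^ 0 * PS ε U kq r x) (Set.Ioi 0) := i1.add i2
    rw [h, ofReal_integral_eq_lintegral_ofReal i3]
    · refine setLIntegral_congr_fun measurableSet_Ioi fun r hr => ?_
      have ho := om_nn hr
      rw [eA r hr, eS r hr, ← ENNReal.ofReal_add (nA r hr) (nS r hr), ← ENNReal.ofReal_mul ho]
      congr 1; ring
    · refine (ae_restrict_mem measurableSet_Ioi).mono fun r hr => ?_
      have ho := om_nn hr
      have := nA r hr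
      have := nS r hr
      simp only [Pi.zero_apply, pow_zero]
      positivity
  have h3 : 0 ≤ ∫ r in Set.Ioi 0, (om r * (-(aa r / r)) ^ 0 * PA p ε U kq r x + om r * (-(aa r / r)) ^ 0 * PS ε U kq r x) := by
    refine setIntegral_nonneg measurableSet_Ioi fun r hr => ?_
    have ho := om_nn hr
    have := nA r hr
    have := nS r hr
    simp only [pow_zero]
    positivity
  exact (ENNReal.ofReal_eq_ofReal_iff (s.sol.pos x).le h3).1 h2

/-- U is Hölder -/
theorem Sys.U_holder (s : Sys p ε M U) : ∃ L, 0 ≤ L ∧ ∀ x x', |U x - U x'| ≤ L * √‖x - x'‖ := by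
  have hK := KK_nn s
  have hI : 0 ≤ ∫ r in Set.Ioi 0, Nm r := setIntegral_nonneg measurableSet_Ioi fun r hr => Nm_nn hr
  have h4 := c4d
  refine ⟨2 * (2 / c4 * KK p M * 3 * ∫ r in Set.Ioi 0, Nm r), by positivity, fun x x' => ?_⟩
  have hA := isc_holder s.wA hK KD_kq s.A_bd' x x'
  have hS := isc_holder s.wS hK KD_kq s.S_bd' x x'
  rw [s.U_eq x, s.U_eq x']
  have e : IA p ε U 0 kq x + IS ε U 0 kq x - (IA p ε U 0 kq x' + IS ε U 0 kq x') =
    (IA p ε U 0 kq x - IA p ε U 0 kq x') + (IS ε U 0 kq x - IS ε U 0 kq x') := by ring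
  rw [e]
  refine (abs_add_le _ _).trans ?_
  linarith

theorem holder_cont {n : ℕ} {f : Euc n → ℝ} {L : ℝ} (h : ∀ x x', |f x - f x'| ≤ L * √‖x - x'‖) : Continuous f := by
  rw [continuous_iff_continuousAt]
  intro x
  rw [ContinuousAt, tendsto_iff_norm_sub_tendsto_zero]
  have h2 : Tendsto (fun y : Euc n => L * √‖y - x‖) (𝓝 x) (𝓝 0) := by
    have : Continuous fun y : Euc n => L * √‖y - x‖ := by fun_prop
    simpa using this.tendsto x
  exact squeeze_zero (fun _ => norm_nonneg _) (fun y => h y x) h2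

theorem Sys.U_cont (s : Sys p ε M U) : Continuous U := by
  obtain ⟨L, _, h⟩ := s.U_holder
  exact holder_cont h

theorem Sys.U_leM (s : Sys p ε M U) (x : E3) : U x ≤ M := by
  refine (s.sol.bd x).trans ?_
  have := s.hM
  have := exp_le1 (θ := 1/8) (by norm_num) (sq_nonneg ‖x‖)
  nlinarith

theorem lip_comp {f f' : ℝ → ℝ} {M B : ℝ} (hd : ∀ t, 0 < t → HasDerivAt f (f' t) t) (hB : ∀ t, 0 < t → t ≤ M → |f' t| ≤ B)
    {a b : ℝ} (ha : 0 < a) (hb : 0 < b) (ha' : a ≤ M) (hb' : b ≤ M) : |f a - f b| ≤ B * |a - b| := by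
  have := Convex.norm_image_sub_le_of_norm_hasDerivWithin_le (s := Set.Ioc 0 M) (f := f) (f' := f') (C := B)
    (fun t ht => (hd t ht.1).hasDerivWithinAt) (fun t ht => hB t ht.1 ht.2) (convex_Ioc 0 M) (x := b) (y := a) ⟨hb, hb'⟩ ⟨ha, ha'⟩
  exact this

theorem Sys.W_holder (s : Sys p ε M U) : ∃ L, 0 ≤ L ∧ ∀ x x', |Wf p ε U x - Wf p ε U x'| ≤ L * √‖x - x'‖ := by
  obtain ⟨L, hL, h⟩ := s.U_holder
  have hp1 := s.hp1
  have hM := s.hM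
  refine ⟨((p - 1) * M ^ (p - 2) + ε ^ 2 * (5 * M ^ 4)) * L, ?_, fun x x' => ?_⟩
  · have : 0 ≤ p - 1 := by linarith
    positivity
  have := lip_comp (f := fun t => t ^ (p - 1) + ε ^ 2 * t ^ 5) (f' := fun t => (p - 1) * t ^ (p - 1 - 1) + ε ^ 2 * (5 * t ^ 4))
    (M := M) (B := (p - 1) * M ^ (p - 2) + ε ^ 2 * (5 * M ^ 4))
    (fun t ht => by
      have h1 := Real.hasDerivAt_rpow_const (x := t) (p := p - 1) (Or.inl ht.ne')
      have h2 := (hasDerivAt_pow 5 t).const_mul (ε ^ 2)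
      exact h1.add h2)
    (fun t ht htM => by
      have e : p - 1 - 1 = p - 2 := by ring
      have hp : 0 ≤ p - 1 := by linarith
      rw [e, abs_of_nonneg (by positivity)]
      have := Real.rpow_le_rpow ht.le htM (by linarith : 0 ≤ p - 2)
      gcongr) (s.sol.pos x) (s.sol.pos x') (s.U_leM x) (s.U_leM x')
  refine this.trans ?_
  rw [mul_assoc]
  have hp : 0 ≤ p - 1 := by linarith
  exact mul_le_mul_of_nonneg_left (h x x') (by positivity)

theorem io_sub (y y' : E2) : ‖io y - io y'‖ = ‖y - y'‖ := by
  have : io y - io y' = io (y - y') := by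
    ext i; fin_cases i <;> simp [io]
  rw [this, io_norm]

theorem Sys.H_holder (s : Sys p ε M U) : ∃ L, 0 ≤ L ∧ ∀ y y', |Hf ε U y - Hf ε U y'| ≤ L * √‖y - y'‖ := by
  obtain ⟨L, hL, h⟩ := s.U_holder
  have hM := s.hM
  have he := s.he
  refine ⟨(2 * (ε * (3 * M ^ 2))) * L, by positivity, fun x x' => ?_⟩
  have := lip_comp (f := fun t => 2 * (ε * t ^ 3)) (f' := fun t => 2 * (ε * (3 * t ^ 2)))
    (M := M) (B := (2 * (ε * (3 * M ^ 2))))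
    (fun t ht => ((hasDerivAt_pow 3 t).const_mul ε).const_mul 2)
    (fun t ht htM => by
      rw [abs_of_nonneg (by positivity)]
      gcongr) (s.sol.pos (io x)) (s.sol.pos (io x')) (s.U_leM (io x)) (s.U_leM (io x'))
  refine this.trans ?_
  rw [mul_assoc _ L]
  rw [← io_sub]
  exact mul_le_mul_of_nonneg_left (h _ _) (by positivity)

theorem Sys.W_cont (s : Sys p ε M U) : Continuous (Wf p ε U) := by
  obtain ⟨L, _, h⟩ := s.W_holder
  exact holder_cont h
theorem Sys.H_cont (s : Sys p ε M U) : Continuous (Hf ε U) := by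
  obtain ⟨L, _, h⟩ := s.H_holder
  exact holder_cont h

end
end Ham

namespace Ham

theorem om_k {r v B : ℝ} (hr : 0 < r) (k : ℕ) (h : |v| ≤ B) : |om r * (-(aa r / r)) ^ k * v| ≤ om r * (aa r / r) ^ k * B := by
  have := om_nn hr
  have ha := ar_ge hr
  rw [abs_mul, abs_mul, abs_of_nonneg this, abs_pow, abs_neg, abs_of_nonneg (by linarith)]
  gcongr

theorem one3_Nm {r : ℝ} (hr : 0 < r) : min 1 (r⁻¹ ^ 3) ≤ Nm r := by
  refine Nm_pow (α := 0) (β := -3) hr ?_ ?_ (by norm_num) (by norm_num)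
  · rw [Real.rpow_zero]; exact min_le_left _ _
  · rw [← inv3_rpow hr]; exact min_le_right _ _

theorem sqrt_kq {Q : E3 → ℝ} (h : KQ Q) (z : E3) : √‖z‖ * |Q z| ≤ 544 * exp (-(1 / 8) * ‖z‖ ^ 2) := by
  have h1 : √‖z‖ ≤ 16 * exp (‖z‖ ^ 2 / 16) := by
    have h2 : ‖z‖ ^ 2 / 16 + 1 ≤ exp (‖z‖ ^ 2 / 16) := Real.add_one_le_exp _
    have h3 : √‖z‖ ≤ 1 + ‖z‖ ^ 2 := by
      refine Real.sqrt_le_iff.2 ⟨by positivity, ?_⟩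
      have := norm_nonneg z
      nlinarith [sq_nonneg (‖z‖ - 1), sq_nonneg (‖z‖^2)]
    linarith
  calc √‖z‖ * |Q z| ≤ (16 * exp (‖z‖ ^ 2 / 16)) * (34 * exp (-(3 / 16) * ‖z‖ ^ 2)) := by
        have := h.bd z
        gcongr
    _ = 544 * (exp (‖z‖ ^ 2 / 16) * exp (-(3 / 16) * ‖z‖ ^ 2)) := by ring
    _ = _ := by rw [← Real.exp_add]; ring_nf

section
variable {p ε M : ℝ} {U : E3 → ℝ}

theorem Sys.A1_bd (s : Sys p ε M U) {Q : E3 → ℝ} (h : KQ Q) {k : ℕ} (hk : k ≤ 1) (x : E3) (r : ℝ) (hr : 0 < r) :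
    |om r * (-(aa r / r)) ^ k * PA p ε U Q r x| ≤ 2 / c4 * KK p M * exp (-(cc p) * ‖x‖ ^ 2) * Nm r := by
  refine (om_k hr k (s.A_bd h hr x)).trans ?_
  have h1 : om r * (aa r / r) ^ k ≤ 2 / c4 := by
    refine le_trans ?_ (om1 hr)
    refine mul_le_mul_of_nonneg_left ?_ (om_nn hr)
    calc (aa r / r) ^ k ≤ (aa r / r) ^ 1 := pow_le_pow_right₀ (ar_ge hr) hk
      _ = _ := pow_one _
  have h2 := one3_Nm hr
  have h3 := KK_nn s
  have h4 := c4d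
  calc _ ≤ 2 / c4 * (KK p M * exp (-(cc p) * ‖x‖ ^ 2) * Nm r) := by gcongr
    _ = _ := by ring

theorem Sys.A1_bd' (s : Sys p ε M U) {Q : E3 → ℝ} (h : KQ Q) {k : ℕ} (hk : k ≤ 1) (x : E3) (r : ℝ) (hr : 0 < r) :
    |om r * (-(aa r / r)) ^ k * PA p ε U Q r x| ≤ 2 / c4 * KK p M * Nm r := by
  refine (s.A1_bd h hk x r hr).trans ?_
  have h3 := KK_nn s
  have h4 := c4d
  have h5 := Nm_nn hr
  have h2 := exp_le1 (θ := cc p) (by linarith [cc_pos s.hp1]) (sq_nonneg ‖x‖)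
  calc _ ≤ 2 / c4 * KK p M * 1 * Nm r := by gcongr
    _ = _ := by ring

theorem Sys.A2_bd (s : Sys p ε M U) : ∃ K, ∀ Q Qd, KD Q Qd → ∀ j x r, 0 < r →
    |om r * (-(aa r / r)) ^ 2 * PA p ε U (Qd j) r x| ≤ K * Nm r := by
  obtain ⟨L, hL, hW⟩ := s.W_holder
  have hG := Gn_nn 3 (1/8)
  have hK := KK_nn s
  refine ⟨2 / c4 * (L * 544 * Gn 3 (1/8) + KK p M), fun Q Qd h j x r hr => ?_⟩
  have hq := h.kqd j
  have b1 : |PA p ε U (Qd j) r x| ≤ L * 544 * Gn 3 (1/8) * √r := by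
    have e : PA p ε U (Qd j) r x = ∫ z, (Wf p ε U (aa r • x + r • z) - Wf p ε U (aa r • x)) * Qd j z := by
      unfold PA
      rw [Psi3 _ _ hr]
      simp_rw [sub_mul]
      rw [integral_sub, integral_const_mul, h.int0, mul_zero, sub_zero]
      · refine (hq.int.norm.const_mul (2 * M ^ 5)).mono' ?_ (Eventually.of_forall fun z => ?_)
        · have := s.W_cont
          have := hq.cont
          exact Continuous.aestronglyMeasurable (by fun_prop)
        · rw [norm_mul]
          have h1 := s.wA.bd (aa r • x + r • z)
          have h2 := exp_le1 (bb_pos s.hp1).le (sq_nonneg ‖id (aa r • x + r • z)‖)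
          have hM := s.hM
          gcongr
          refine h1.trans ?_
          calc _ ≤ 2 * M ^ 5 * 1 := by gcongr
            _ = _ := mul_one _
      · exact hq.int.const_mul _
    rw [e, ← Real.norm_eq_abs]
    refine (norm_integral_le_of_norm_le ((gauss_int (n := 3) (by norm_num : (0:ℝ) < 1/8)).const_mul (L * √r * 544)) (Eventually.of_forall fun z => ?_)).trans ?_
    · rw [norm_mul, Real.norm_eq_abs, Real.norm_eq_abs]
      have h1 := hW (aa r • x + r • z) (aa r • x)
      rw [add_sub_cancel_left, norm_smul, Real.norm_of_nonneg hr.le, Real.sqrt_mul hr.le] at h1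
      calc _ ≤ L * (√r * √‖z‖) * |Qd j z| := by gcongr
        _ = L * √r * (√‖z‖ * |Qd j z|) := by ring
        _ ≤ L * √r * (544 * exp (-(1 / 8) * ‖z‖ ^ 2)) := by
            have := sqrt_kq hq z
            gcongr
        _ = _ := by ring
    · rw [integral_const_mul]; unfold Gn; apply le_of_eq; ring
  have b2 : |PA p ε U (Qd j) r x| ≤ KK p M * r⁻¹ ^ 3 := by
    refine (s.A_bd' _ hq x r hr).trans ?_
    gcongr
    exact min_le_right _ _
  set K := L * 544 * Gn 3 (1/8) + KK p M with hKd
  have hK0 : 0 ≤ K := by positivity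
  have b3 : |PA p ε U (Qd j) r x| ≤ K * min √r (r⁻¹ ^ 3) := by
    rw [mul_min_of_nonneg _ _ hK0]
    have : 0 ≤ L * 544 * Gn 3 (1/8) := by positivity
    refine le_min (b1.trans ?_) (b2.trans ?_)
    · gcongr; linarith
    · gcongr; linarith
  refine (om_k hr 2 b3).trans ?_
  rw [om2 hr]
  have h6 : r⁻¹ * min √r (r⁻¹ ^ 3) ≤ Nm r := by
    have hs : √r = r ^ (1/2 : ℝ) := Real.sqrt_eq_rpow r
    refine Nm_pow (α := -(1/2)) (β := -4) hr ?_ ?_ (by norm_num) (by norm_num)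
    · calc r⁻¹ * min √r (r⁻¹ ^ 3) ≤ r⁻¹ * √r := by gcongr; exact min_le_left _ _
        _ = _ := by rw [hs, inv1_rpow hr, ← Real.rpow_add hr]; norm_num
    · calc r⁻¹ * min √r (r⁻¹ ^ 3) ≤ r⁻¹ * r⁻¹ ^ 3 := by gcongr; exact min_le_right _ _
        _ = r ^ (-1:ℝ) * r ^ (-3:ℝ) := by rw [inv3_rpow hr, ← inv1_rpow hr]
        _ = _ := by rw [← Real.rpow_add hr]; norm_num
  have h4 := c4d
  calc 2 / c4 * r⁻¹ * (K * min √r (r⁻¹ ^ 3)) = 2 / c4 * K * (r⁻¹ * min √r (r⁻¹ ^ 3)) := by ring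
    _ ≤ _ := by gcongr

theorem mul_exp_neg_le (t : ℝ) : t * exp (-t) ≤ 1 := by
  have h1 : t ≤ exp t := by linarith [Real.add_one_le_exp t]
  calc t * exp (-t) ≤ exp t * exp (-t) := by gcongr
    _ = 1 := by rw [← Real.exp_add]; simp

theorem Sys.S2_bd (s : Sys p ε M U) {t : ℝ} (ht : 0 < t) {Q : E3 → ℝ} (h : KQ Q) {k : ℕ} (hk : k ≤ 2) (x : E3) (hx : t < x 2) (r : ℝ) (hr : 0 < r) :
    |om r * (-(aa r / r)) ^ k * PS ε U Q r x| ≤ 2 / c4 * KK p M * (th p * t ^ 2)⁻¹ * Nm r := by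
  have hK := KK_nn s
  have h4 := c4d
  have hm := mr_nn hr
  have hθ := th_pos s.hp1
  have ho := om_nn hr
  have h2 := exp_le1 (θ := cc p) (by linarith [cc_pos s.hp1]) (sq_nonneg ‖x‖)
  have b1 : |PS ε U Q r x| ≤ KK p M * 1 * exp (-(th p) * (aa r / r * x 2) ^ 2) * mr r := by
    refine (s.S_bd h hr x).trans ?_
    gcongr
  refine (om_k hr k b1).trans ?_
  have ha := ar_ge hr
  have h5 : (aa r / r) ^ k ≤ (aa r / r) ^ 2 := pow_le_pow_right₀ ha hk
  have h6 : (aa r / r) ^ 2 * exp (-(th p) * (aa r / r * x 2) ^ 2) ≤ (th p * t ^ 2)⁻¹ := by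
    rw [le_inv_comm₀ (by positivity) (by positivity), inv_eq_one_div, le_div_iff₀ (by positivity)]
    have h7 := mul_exp_neg_le (th p * (aa r / r * x 2) ^ 2)
    rw [← neg_mul] at h7
    refine le_trans ?_ h7
    have : t ^ 2 ≤ x 2 ^ 2 := by gcongr
    have e := exp_pos (-(th p) * (aa r / r * x 2) ^ 2)
    calc th p * t ^ 2 * ((aa r / r) ^ 2 * exp (-(th p) * (aa r / r * x 2) ^ 2)) ≤ th p * x 2 ^ 2 * ((aa r / r) ^ 2 * exp (-(th p) * (aa r / r * x 2) ^ 2)) := by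
          gcongr
      _ = _ := by ring
  have h8 := om_le hr
  have h9 := one_mr hr
  calc om r * (aa r / r) ^ k * (KK p M * 1 * exp (-(th p) * (aa r / r * x 2) ^ 2) * mr r)
      ≤ om r * (aa r / r) ^ 2 * (KK p M * 1 * exp (-(th p) * (aa r / r * x 2) ^ 2) * mr r) := by gcongr
    _ = KK p M * om r * mr r * ((aa r / r) ^ 2 * exp (-(th p) * (aa r / r * x 2) ^ 2)) := by ring
    _ ≤ KK p M * (2 / c4 * r) * mr r * (th p * t ^ 2)⁻¹ := by gcongr
    _ = 2 / c4 * KK p M * (th p * t ^ 2)⁻¹ * (r * mr r) := by ring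
    _ ≤ _ := by gcongr

theorem Sys.DA1 (s : Sys p ε M U) (x : E3) : HasFDerivAt (IA p ε U 0 kq) (gv fun j => IA p ε U 1 (k1 j) x) x :=
  s.wA.isc_deriv KD_kq 0 isOpen_univ (Nm_int.const_mul (2 / c4 * KK p M))
    (fun x _ => s.wA.isc_int KQ_kq 0 (Nm_int.const_mul (2 / c4 * KK p M)) (s.A1_bd' KQ_kq (by norm_num) x))
    (fun x _ j r hr => s.A1_bd' (KQ_k1 j) (by norm_num) x r hr) (Set.mem_univ x)

theorem Sys.DA2 (s : Sys p ε M U) (i : Fin 3) (x : E3) : HasFDerivAt (IA p ε U 1 (k1 i)) (gv fun j => IA p ε U 2 (k2 i j) x) x := by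
  obtain ⟨K, hK⟩ := s.A2_bd
  exact s.wA.isc_deriv (KD_k1 i) 1 isOpen_univ (Nm_int.const_mul K)
    (fun x _ => s.wA.isc_int (KQ_k1 i) 1 (Nm_int.const_mul (2 / c4 * KK p M)) (s.A1_bd' (KQ_k1 i) (by norm_num) x))
    (fun x _ j r hr => hK _ _ (KD_k1 i) j x r hr) (Set.mem_univ x)

theorem Sys.CA1 (s : Sys p ε M U) (i : Fin 3) : Continuous (IA p ε U 1 (k1 i)) := by
  rw [← continuousOn_univ]
  exact s.wA.isc_cont (KQ_k1 i) 1 (Nm_int.const_mul (2 / c4 * KK p M)) (fun x _ => s.A1_bd' (KQ_k1 i) (by norm_num) x)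

theorem Sys.CA2 (s : Sys p ε M U) (i j : Fin 3) : Continuous (IA p ε U 2 (k2 i j)) := by
  obtain ⟨K, hK⟩ := s.A2_bd
  rw [← continuousOn_univ]
  exact s.wA.isc_cont (KQ_k2 i j) 2 (Nm_int.const_mul K) (fun x _ r hr => hK _ _ (KD_k1 i) j x r hr)

theorem half_open (t : ℝ) : IsOpen {x : E3 | t < x 2} := isOpen_lt continuous_const (coord_cont 2)

theorem Sys.DS1 (s : Sys p ε M U) {x : E3} (hx : 0 < x 2) : HasFDerivAt (IS ε U 0 kq) (gv fun j => IS ε U 1 (k1 j) x) x := by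
  have ht : 0 < x 2 / 2 := by positivity
  exact s.wS.isc_deriv KD_kq 0 (half_open (x 2 / 2)) (Nm_int.const_mul (2 / c4 * KK p M * (th p * (x 2 / 2) ^ 2)⁻¹))
    (fun x hx => s.wS.isc_int KQ_kq 0 (Nm_int.const_mul _) (s.S2_bd ht KQ_kq (by norm_num) x hx))
    (fun x hx j r hr => s.S2_bd ht (KQ_k1 j) (by norm_num) x hx r hr) (by show x 2 / 2 < x 2; linarith)

theorem Sys.DS2 (s : Sys p ε M U) (i : Fin 3) {x : E3} (hx : 0 < x 2) : HasFDerivAt (IS ε U 1 (k1 i)) (gv fun j => IS ε U 2 (k2 i j) x) x := by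
  have ht : 0 < x 2 / 2 := by positivity
  exact s.wS.isc_deriv (KD_k1 i) 1 (half_open (x 2 / 2)) (Nm_int.const_mul (2 / c4 * KK p M * (th p * (x 2 / 2) ^ 2)⁻¹))
    (fun x hx => s.wS.isc_int (KQ_k1 i) 1 (Nm_int.const_mul _) (s.S2_bd ht (KQ_k1 i) (by norm_num) x hx))
    (fun x hx j r hr => s.S2_bd ht (KQ_k2 i j) (by norm_num) x hx r hr) (by show x 2 / 2 < x 2; linarith)

theorem Sys.CS2 (s : Sys p ε M U) (i j : Fin 3) {x : E3} (hx : 0 < x 2) : ContinuousAt (IS ε U 2 (k2 i j)) x := by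
  have ht : 0 < x 2 / 2 := by positivity
  have := s.wS.isc_cont (KQ_k2 i j) 2 (s := {y | x 2 / 2 < y 2}) (Nm_int.const_mul (2 / c4 * KK p M * (th p * (x 2 / 2) ^ 2)⁻¹))
    (fun x hx r hr => s.S2_bd ht (KQ_k2 i j) (by norm_num) x hx r hr)
  exact this.continuousAt ((half_open _).mem_nhds (by show x 2 / 2 < x 2; linarith))

end
end Ham

namespace Ham

theorem aa_deriv (r : ℝ) : HasDerivAt aa (r / aa r) r := by
  have h1 : HasDerivAt (fun r : ℝ => 1 + r ^ 2) (2 * r) r := by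
    have := (hasDerivAt_pow 2 r).const_add 1
    simpa using this
  have h2 := h1.sqrt (by positivity)
  have e : 2 * r / (2 * √(1 + r ^ 2)) = r / aa r := by
    rw [mul_div_mul_left _ _ (by norm_num : (2:ℝ) ≠ 0)]; rfl
  rw [e] at h2
  exact h2

theorem xi_apply (r : ℝ) (x y : E3) (i : Fin 3) : xi r x y i = r⁻¹ * (y i - aa r * x i) := by
  simp [xi]

theorem xi_rderiv {r : ℝ} (hr : 0 < r) (x y : E3) (i : Fin 3) :
    HasDerivAt (fun r => xi r x y i) (-(xi r x y i) / r - x i / aa r) r := by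
  have h1 := (hasDerivAt_inv hr.ne').mul (((aa_deriv r).mul_const (x i)).const_sub (y i))
  have e : (fun r => xi r x y i) = fun r => r⁻¹ * (y i - aa r * x i) := by funext r; exact xi_apply r x y i
  rw [e]
  refine h1.congr_deriv ?_
  rw [xi_apply]
  have := aa_pos r
  field_simp
  ring

theorem kq_coord (z : E3) : kq z = exp (-((z 0 ^ 2 + z 1 ^ 2 + z 2 ^ 2) / 4)) := by rw [kq, nsq3]

/-- the integrand of the r-derivative -/
def Dk (r : ℝ) (x z : E3) : ℝ :=
  2 * r⁻¹ * (k2 0 0 z + k2 1 1 z + k2 2 2 z) - (aa r)⁻¹ * (x 0 * k1 0 z + x 1 * k1 1 z + x 2 * k1 2 z)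

theorem P_rderiv {r : ℝ} (hr : 0 < r) (x y : E3) :
    HasDerivAt (fun r => r⁻¹ ^ 3 * kq (xi r x y)) (r⁻¹ ^ 3 * Dk r x (xi r x y)) r := by
  have h0 := xi_rderiv hr x y 0
  have h1 := xi_rderiv hr x y 1
  have h2 := xi_rderiv hr x y 2
  have e : (fun r => r⁻¹ ^ 3 * kq (xi r x y)) = fun r => r⁻¹ ^ 3 * exp (-((xi r x y 0 ^ 2 + xi r x y 1 ^ 2 + xi r x y 2 ^ 2) / 4)) := by
    funext r; rw [kq_coord]
  rw [e]
  have hk := (((((h0.pow 2).add (h1.pow 2)).add (h2.pow 2)).div_const 4).neg).exp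
  have h := ((hasDerivAt_inv hr.ne').pow 3).mul hk
  refine h.congr_deriv ?_
  unfold Dk k2 k1
  rw [kq_coord]
  simp only [Pi.add_apply, Pi.pow_apply, Pi.neg_apply]
  set E := exp (-((xi r x y 0 ^ 2 + xi r x y 1 ^ 2 + xi r x y 2 ^ 2) / 4)) with hE
  have := aa_pos r
  simp
  field_simp
  ring

theorem add6 {X : Type*} [MeasurableSpace X] {ν : Measure X} {f h : Fin 3 → X → ℝ} (hf : ∀ i, Integrable (f i) ν) (hh : ∀ i, Integrable (h i) ν) :
    Integrable (fun y => ((f 0 y + f 1 y) + f 2 y) + ((h 0 y + h 1 y) + h 2 y)) ν ∧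
    ∫ y, ((f 0 y + f 1 y) + f 2 y) + ((h 0 y + h 1 y) + h 2 y) ∂ν =
      ((∫ y, f 0 y ∂ν + ∫ y, f 1 y ∂ν) + ∫ y, f 2 y ∂ν) + ((∫ y, h 0 y ∂ν + ∫ y, h 1 y ∂ν) + ∫ y, h 2 y ∂ν) := by
  have a1 : Integrable (fun y => f 0 y + f 1 y) ν := (hf 0).add (hf 1)
  have a2 : Integrable (fun y => f 0 y + f 1 y + f 2 y) ν := a1.add (hf 2)
  have b1 : Integrable (fun y => h 0 y + h 1 y) ν := (hh 0).add (hh 1)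
  have b2 : Integrable (fun y => h 0 y + h 1 y + h 2 y) ν := b1.add (hh 2)
  refine ⟨a2.add b2, ?_⟩
  rw [integral_add a2 b2, integral_add a1 (hf 2), integral_add (hf 0) (hf 1), integral_add b1 (hh 2), integral_add (hh 0) (hh 1)]

section
variable {Y : Type} [MeasurableSpace Y] {μ : Measure Y} {ι : Y → E3} {g : Y → ℝ} {b C : ℝ}

theorem Dk_bd {r : ℝ} (hr : 0 < r) (x z : E3) : |Dk r x z| ≤ 204 * r⁻¹ + 102 * ‖x‖ := by
  have a2 := fun i => KQ.le (KQ_k2 i i) z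
  have a1 := fun i => KQ.le (KQ_k1 i) z
  have ai := inv_le_one_of_one_le₀ (aa_ge r)
  have ap := inv_pos.2 (aa_pos r)
  have b1 : |k2 0 0 z + k2 1 1 z + k2 2 2 z| ≤ 102 := by
    have := abs_add_three (k2 0 0 z) (k2 1 1 z) (k2 2 2 z)
    linarith [a2 0, a2 1, a2 2]
  have b2 : ∀ i, |x i * k1 i z| ≤ 34 * ‖x‖ := fun i => by
    rw [abs_mul, mul_comm]
    have := abs_le_nrm x i
    have := a1 i
    gcongr
  have b3 : |x 0 * k1 0 z + x 1 * k1 1 z + x 2 * k1 2 z| ≤ 102 * ‖x‖ := by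
    have := abs_add_three (x 0 * k1 0 z) (x 1 * k1 1 z) (x 2 * k1 2 z)
    linarith [b2 0, b2 1, b2 2]
  unfold Dk
  refine (abs_sub _ _).trans ?_
  rw [abs_mul, abs_mul (aa r)⁻¹, abs_of_pos ap, abs_of_pos (by positivity : 0 < 2 * r⁻¹)]
  have := norm_nonneg x
  calc _ ≤ 2 * r⁻¹ * 102 + 1 * (102 * ‖x‖) := by gcongr
    _ = _ := by ring

theorem Wt.Dk_eq (w : Wt μ ι g b C) {r : ℝ} (hr : 0 < r) (x : E3) :
    ∫ y, g y * (r⁻¹ ^ 3 * Dk r x (xi r x (ι y))) ∂μ =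
      c4 * (((om r * (-(aa r / r)) ^ 2 * Psi μ ι g (k2 0 0) r x + om r * (-(aa r / r)) ^ 2 * Psi μ ι g (k2 1 1) r x)
         + om r * (-(aa r / r)) ^ 2 * Psi μ ι g (k2 2 2) r x)
        + ((1/2 * x 0 * (om r * (-(aa r / r)) ^ 1 * Psi μ ι g (k1 0) r x) + 1/2 * x 1 * (om r * (-(aa r / r)) ^ 1 * Psi μ ι g (k1 1) r x))
         + 1/2 * x 2 * (om r * (-(aa r / r)) ^ 1 * Psi μ ι g (k1 2) r x))) := by
  have e : ∀ y, g y * (r⁻¹ ^ 3 * Dk r x (xi r x (ι y))) =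
      ((2 * r⁻¹ * (g y * (r⁻¹ ^ 3 * k2 0 0 (xi r x (ι y)))) + 2 * r⁻¹ * (g y * (r⁻¹ ^ 3 * k2 1 1 (xi r x (ι y)))))
        + 2 * r⁻¹ * (g y * (r⁻¹ ^ 3 * k2 2 2 (xi r x (ι y)))))
      + (((-(aa r)⁻¹ * x 0) * (g y * (r⁻¹ ^ 3 * k1 0 (xi r x (ι y)))) + (-(aa r)⁻¹ * x 1) * (g y * (r⁻¹ ^ 3 * k1 1 (xi r x (ι y)))))
        + (-(aa r)⁻¹ * x 2) * (g y * (r⁻¹ ^ 3 * k1 2 (xi r x (ι y))))) := fun y => by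
    unfold Dk; ring
  simp_rw [e]
  have i2 := fun i => (w.int1 (KQ_k2 i i) r x).const_mul (2 * r⁻¹)
  have i1 := fun i => (w.int1 (KQ_k1 i) r x).const_mul (-(aa r)⁻¹ * x i)
  rw [(add6 i2 i1).2]
  simp_rw [integral_const_mul]
  have o2 : om r * (-(aa r / r)) ^ 2 = 2 / c4 * r⁻¹ := by rw [neg_sq, om2 hr]
  have o1 : om r * (-(aa r / r)) ^ 1 = -(2 / c4 * (aa r)⁻¹) := by rw [pow_one, mul_neg, om1' hr]
  rw [o2, o1]
  unfold Psi
  have := c4_pos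
  field_simp

theorem Wt.psi_rderiv (w : Wt μ ι g b C) {r : ℝ} (hr : 0 < r) (x : E3) :
    HasDerivAt (fun r => Psi μ ι g kq r x) (∫ y, g y * (r⁻¹ ^ 3 * Dk r x (xi r x (ι y))) ∂μ) r := by
  have hs : Set.Ioi (r/2) ∈ 𝓝 r := Ioi_mem_nhds (by linarith)
  refine (hasDerivAt_integral_of_dominated_loc_of_deriv_le (μ := μ) (F := fun r y => g y * (r⁻¹ ^ 3 * kq (xi r x (ι y))))
    (F' := fun r y => g y * (r⁻¹ ^ 3 * Dk r x (xi r x (ι y)))) (x₀ := r) (s := Set.Ioi (r/2))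
    (bound := fun y => |g y| * ((r/2)⁻¹ ^ 3 * (204 * (r/2)⁻¹ + 102 * ‖x‖))) hs
    (Eventually.of_forall fun r => (w.meas1 KQ_kq r x).aestronglyMeasurable) (w.int1 KQ_kq r x) ?_
    (Eventually.of_forall fun y r' hr' => ?_) (w.gint.abs.mul_const _)
    (Eventually.of_forall fun y r' hr' => ?_)).2
  · have hc : Continuous (Dk r x) := by
      have c2 := fun i => (KQ_k2 i i).cont
      have c1 := fun i => (KQ_k1 i).cont
      have := c2 0; have := c2 1; have := c2 2; have := c1 0; have := c1 1; have := c1 2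
      unfold Dk
      fun_prop
    have h1 : Measurable fun y => xi r x (ι y) := by
      have := xi_cont r
      have h2 : Continuous fun y => xi r x y := (xi_cont r).comp (by fun_prop : Continuous fun y => (x, y))
      exact h2.measurable.comp w.im
    have h2 : Measurable fun y => Dk r x (xi r x (ι y)) := hc.measurable.comp h1
    exact (w.gm.mul (measurable_const.mul h2)).aestronglyMeasurable
  · have hr0 : r / 2 < r' := hr'
    have hr1 : 0 < r' := by linarith
    rw [norm_mul, norm_mul, Real.norm_eq_abs, Real.norm_eq_abs, Real.norm_eq_abs]
    have := Dk_bd hr1 x (xi r' x (ι y))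
    have h3 : r'⁻¹ ≤ (r/2)⁻¹ := inv_anti₀ (by linarith) hr0.le
    rw [abs_of_pos (by positivity : 0 < r'⁻¹ ^ 3)]
    gcongr
    refine this.trans ?_
    gcongr
  · have hr0 : r / 2 < r' := hr'
    exact (P_rderiv (by linarith) x (ι y)).const_mul _

/-- integrating the r-derivative -/
theorem Wt.ftc (w : Wt μ ι g b C) (x : E3) {ℓ K K1 K2 : ℝ}
    (h2 : ∀ i r, 0 < r → |om r * (-(aa r / r)) ^ 2 * Psi μ ι g (k2 i i) r x| ≤ K2 * Nm r)
    (h1 : ∀ i r, 0 < r → |om r * (-(aa r / r)) ^ 1 * Psi μ ι g (k1 i) r x| ≤ K1 * Nm r)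
    (h0 : ∀ r, 0 < r → |Psi μ ι g kq r x| ≤ K * mr r)
    (hl : Tendsto (fun r => Psi μ ι g kq r x) (𝓝[>] 0) (𝓝 ℓ)) :
    c4 * ((Isc μ ι g 2 (k2 0 0) x + Isc μ ι g 2 (k2 1 1) x + Isc μ ι g 2 (k2 2 2) x)
      + (1/2 * x 0 * Isc μ ι g 1 (k1 0) x + 1/2 * x 1 * Isc μ ι g 1 (k1 1) x + 1/2 * x 2 * Isc μ ι g 1 (k1 2) x)) = -ℓ := by
  have i2 := fun i => w.isc_int (KQ_k2 i i) 2 (Nm_int.const_mul K2) (h2 i)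
  have i1 := fun i => (w.isc_int (KQ_k1 i) 1 (Nm_int.const_mul K1) (h1 i)).const_mul (1/2 * x i)
  have i6 := add6 (ν := volume.restrict (Set.Ioi (0:ℝ))) i2 i1
  have iC := i6.1.const_mul c4
  have K0 : 0 ≤ K := by
    have h := h0 1 one_pos
    have e : mr 1 = 1 := by unfold mr; norm_num
    rw [e, mul_one] at h
    exact (abs_nonneg _).trans h
  have htop : Tendsto (fun r => Psi μ ι g kq r x) atTop (𝓝 0) := by
    refine squeeze_zero_norm' (a := fun r : ℝ => K * r⁻¹) ?_ ?_
    · filter_upwards [eventually_gt_atTop 0] with r hr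
      refine (h0 r hr).trans ?_
      gcongr
      exact min_le_left _ _
    · simpa using tendsto_inv_atTop_zero.const_mul K
  have key := integral_Ioi_of_hasDerivAt_of_tendsto (a := (0:ℝ)) (f := Function.update (fun r => Psi μ ι g kq r x) 0 ℓ)
    (f' := fun r => c4 * (((om r * (-(aa r / r)) ^ 2 * Psi μ ι g (k2 0 0) r x + om r * (-(aa r / r)) ^ 2 * Psi μ ι g (k2 1 1) r x)
         + om r * (-(aa r / r)) ^ 2 * Psi μ ι g (k2 2 2) r x)
        + ((1/2 * x 0 * (om r * (-(aa r / r)) ^ 1 * Psi μ ι g (k1 0) r x) + 1/2 * x 1 * (om r * (-(aa r / r)) ^ 1 * Psi μ ι g (k1 1) r x))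
         + 1/2 * x 2 * (om r * (-(aa r / r)) ^ 1 * Psi μ ι g (k1 2) r x)))) (m := 0) ?_ ?_ iC ?_
  · rw [Function.update_self, zero_sub] at key
    rw [← key, integral_const_mul]
    congr 1
    rw [i6.2]
    simp_rw [integral_const_mul]
    rfl
  · rw [continuousWithinAt_update_same]
    have e : Set.Ici (0:ℝ) \ {0} = Set.Ioi 0 := by ext t; simp [lt_iff_le_and_ne, eq_comm]
    rwa [e]
  · intro r hr
    rw [← w.Dk_eq hr x]
    refine (w.psi_rderiv hr x).congr_of_eventuallyEq ?_
    filter_upwards [Ioi_mem_nhds (show (0:ℝ) < r from hr)] with s hs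
    rw [Function.update_of_ne (ne_of_gt hs)]
  · refine htop.congr' ?_
    filter_upwards [eventually_gt_atTop 0] with s hs
    rw [Function.update_of_ne (ne_of_gt hs)]
end

section
variable {p ε M : ℝ} {U : E3 → ℝ}

theorem Sys.W_bd (s : Sys p ε M U) (y : E3) : |Wf p ε U y| ≤ 2 * M ^ 5 := by
  have h2 := exp_le1 (bb_pos s.hp1).le (sq_nonneg ‖id y‖)
  have hM := s.hM
  calc _ ≤ _ := s.wA.bd y
    _ ≤ 2 * M ^ 5 * 1 := by gcongr
    _ = _ := mul_one _

theorem Sys.H_bd (s : Sys p ε M U) (y : E2) : |Hf ε U y| ≤ 2 * M ^ 5 := by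
  have h2 := exp_le1 (bb_pos s.hp1).le (sq_nonneg ‖io y‖)
  have hM := s.hM
  calc _ ≤ _ := s.wS.bd y
    _ ≤ 2 * M ^ 5 * 1 := by gcongr
    _ = _ := mul_one _

theorem aa_zero : aa 0 = 1 := by unfold aa; simp

theorem Sys.limA (s : Sys p ε M U) (x : E3) :
    Tendsto (fun r => PA p ε U kq r x) (𝓝[>] 0) (𝓝 (c4 * Wf p ε U x)) := by
  have hW := s.W_cont
  have hc := KQ_kq.cont
  have ha := aa_cont
  have h1 : Tendsto (fun r : ℝ => ∫ z : E3, Wf p ε U (aa r • x + r • z) * kq z) (𝓝[>] 0)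
      (𝓝 (∫ z : E3, Wf p ε U (aa 0 • x + (0:ℝ) • z) * kq z)) := by
    refine tendsto_integral_filter_of_dominated_convergence (fun z => 2 * M ^ 5 * |kq z|)
      (Eventually.of_forall fun r => Continuous.aestronglyMeasurable (by fun_prop))
      (Eventually.of_forall fun r => Eventually.of_forall fun z => ?_) (KQ_kq.int.abs.const_mul _)
      (Eventually.of_forall fun z => ?_)
    · rw [norm_mul, Real.norm_eq_abs, Real.norm_eq_abs]
      have := s.W_bd (aa r • x + r • z)
      gcongr
    · have : Continuous fun r : ℝ => Wf p ε U (aa r • x + r • z) * kq z := by fun_prop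
      exact (this.tendsto 0).mono_left nhdsWithin_le_nhds
  have e : ∫ z : E3, Wf p ε U (aa 0 • x + (0:ℝ) • z) * kq z = c4 * Wf p ε U x := by
    simp_rw [aa_zero, one_smul, zero_smul, add_zero]
    rw [integral_const_mul, KQ_int_kq, mul_comm]
  rw [e] at h1
  refine h1.congr' ?_
  filter_upwards [self_mem_nhdsWithin] with r hr
  exact (Psi3 _ _ hr x).symm

theorem Sys.limS (s : Sys p ε M U) {x : E3} (hx : 0 < x 2) :
    Tendsto (fun r => PS ε U kq r x) (𝓝[>] 0) (𝓝 0) := by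
  have hθ := th_pos s.hp1
  have hK := KK_nn s
  refine squeeze_zero_norm' (a := fun r : ℝ => KK p M * (th p * x 2 ^ 2)⁻¹ * r) ?_ ?_
  · filter_upwards [self_mem_nhdsWithin] with r hr
    have hr : 0 < r := hr
    rw [Real.norm_eq_abs]
    refine (s.S_bd KQ_kq hr x).trans ?_
    have h2 := exp_le1 (θ := cc p) (by linarith [cc_pos s.hp1]) (sq_nonneg ‖x‖)
    have h7 := mul_exp_neg_le (th p * (aa r / r * x 2) ^ 2)
    rw [← neg_mul] at h7
    have h8 : exp (-(th p) * (aa r / r * x 2) ^ 2) ≤ (th p * x 2 ^ 2)⁻¹ * r ^ 2 := by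
      have h9 : th p * x 2 ^ 2 * r⁻¹ ^ 2 ≤ th p * (aa r / r * x 2) ^ 2 := by
        have : r⁻¹ ≤ aa r / r := by
          rw [div_eq_mul_inv]
          have := aa_ge r
          have := inv_pos.2 hr
          nlinarith
        calc th p * x 2 ^ 2 * r⁻¹ ^ 2 = th p * (r⁻¹ * x 2) ^ 2 := by ring
          _ ≤ _ := by gcongr
      have h10 : exp (-(th p) * (aa r / r * x 2) ^ 2) * (th p * x 2 ^ 2 * r⁻¹ ^ 2) ≤ 1 := by
        rw [mul_comm]
        refine le_trans ?_ h7
        gcongr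
      rw [← le_div_iff₀ (by positivity)] at h10
      refine h10.trans (le_of_eq ?_)
      field_simp
    have h11 : mr r ≤ r⁻¹ := min_le_left _ _
    have h12 := mr_nn hr
    calc _ ≤ KK p M * 1 * ((th p * x 2 ^ 2)⁻¹ * r ^ 2) * r⁻¹ := by gcongr
      _ = _ := by field_simp
  · have : Continuous fun r : ℝ => KK p M * (th p * x 2 ^ 2)⁻¹ * r := by fun_prop
    have := (this.tendsto 0).mono_left (nhdsWithin_le_nhds (s := Set.Ioi 0))
    simpa using this

/-- the equation inside -/
theorem Sys.pde (s : Sys p ε M U) {x : E3} (hx : 0 < x 2) :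
    ((IA p ε U 2 (k2 0 0) x + IS ε U 2 (k2 0 0) x) + (IA p ε U 2 (k2 1 1) x + IS ε U 2 (k2 1 1) x)
      + (IA p ε U 2 (k2 2 2) x + IS ε U 2 (k2 2 2) x))
      + 1/2 * (x 0 * (IA p ε U 1 (k1 0) x + IS ε U 1 (k1 0) x) + x 1 * (IA p ε U 1 (k1 1) x + IS ε U 1 (k1 1) x)
        + x 2 * (IA p ε U 1 (k1 2) x + IS ε U 1 (k1 2) x)) = -Wf p ε U x := by
  obtain ⟨K, hK⟩ := s.A2_bd
  have hx2 : x 2 / 2 < x 2 := by linarith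
  have ht : 0 < x 2 / 2 := by positivity
  have fA := s.wA.ftc x (fun i r hr => hK _ _ (KD_k1 i) i x r hr) (fun i r hr => s.A1_bd' (KQ_k1 i) le_rfl x r hr)
    (fun r hr => s.A_bd' kq KQ_kq x r hr) (s.limA x)
  have fS := s.wS.ftc x (fun i r hr => s.S2_bd ht (KQ_k2 i i) le_rfl x hx2 r hr)
    (fun i r hr => s.S2_bd ht (KQ_k1 i) (by norm_num) x hx2 r hr)
    (fun r hr => s.S_bd' kq KQ_kq x r hr) (s.limS hx)
  have h4 := c4_pos
  have := congrArg (fun t => t / c4) (congrArg₂ (· + ·) fA fS)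
  simp only at this
  rw [← mul_add, mul_div_cancel_left₀ _ h4.ne'] at this
  have e : (-(c4 * Wf p ε U x) + -0) / c4 = -Wf p ε U x := by field_simp; ring
  rw [e] at this
  rw [← this]
  unfold IA IS
  ring
end
end Ham

namespace Ham

theorem up_neg_sq (z : E2) (s : ℝ) : ‖up (-z) s‖ ^ 2 = ‖up z s‖ ^ 2 := by rw [up_sq, up_sq, norm_neg]

theorem k1_odd (i : Fin 3) (hi : i ≠ 2) (z : E2) (s : ℝ) : k1 i (up (-z) s) = -k1 i (up z s) := by
  unfold k1 kq
  rw [up_neg_sq]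
  fin_cases i
  · simp [up]
  · simp [up]
  · simp at hi

theorem k1_int0 (i : Fin 3) (hi : i ≠ 2) (s : ℝ) : ∫ z, k1 i (up z s) = 0 := by
  have h := integral_neg_eq_self (fun z => k1 i (up z s)) (volume : Measure E2)
  simp_rw [k1_odd i hi] at h
  rw [integral_neg] at h
  linarith

theorem le_up (z : E2) (s : ℝ) : ‖z‖ ≤ ‖up z s‖ := by
  refine le_of_sq_le_sq ?_ (norm_nonneg _)
  rw [up_sq]; nlinarith [sq_nonneg s]

theorem upQ_bd {Q : E3 → ℝ} (h : KQ Q) (z : E2) (s : ℝ) : √‖z‖ * |Q (up z s)| ≤ 544 * exp (-(1 / 8) * ‖z‖ ^ 2) := by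
  have h1 : √‖z‖ ≤ √‖up z s‖ := Real.sqrt_le_sqrt (le_up z s)
  have h2 := sqrt_kq h (up z s)
  have h3 : ‖z‖ ^ 2 ≤ ‖up z s‖ ^ 2 := by rw [up_sq]; nlinarith [sq_nonneg s]
  have h4 : exp (-(1 / 8) * ‖up z s‖ ^ 2) ≤ exp (-(1 / 8) * ‖z‖ ^ 2) := Real.exp_le_exp.2 (by linarith)
  calc _ ≤ √‖up z s‖ * |Q (up z s)| := by gcongr
    _ ≤ _ := h2
    _ ≤ _ := by gcongr

theorem upQ_bd0 {Q : E3 → ℝ} (h : KQ Q) (z : E2) (s : ℝ) : |Q (up z s)| ≤ 34 * exp (-(3 / 16) * ‖z‖ ^ 2) := by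
  refine (h.bd _).trans (mul_le_mul_of_nonneg_left (Real.exp_le_exp.2 ?_) (by norm_num))
  rw [up_sq]; nlinarith [sq_nonneg s]

theorem upQ_cont {Q : E3 → ℝ} (h : KQ Q) (s : ℝ) : Continuous fun z => Q (up z s) :=
  h.cont.comp (up_cont.comp (by fun_prop : Continuous fun z : E2 => (z, s)))

theorem upQ_int {Q : E3 → ℝ} (h : KQ Q) (s : ℝ) : Integrable fun z => Q (up z s) :=
  ((gauss_int (n := 2) (by norm_num : (0:ℝ) < 3/16)).const_mul 34).mono' (upQ_cont h s).aestronglyMeasurable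
    (Eventually.of_forall fun z => upQ_bd0 h z s)

section
variable {p ε M : ℝ} {U : E3 → ℝ}

theorem Sys.T_bd (s : Sys p ε M U) : ∃ K, ∀ i : Fin 3, i ≠ 2 → ∀ x r, 0 < r →
    |om r * (-(aa r / r)) ^ 1 * PS ε U (k1 i) r x| ≤ K * Nm r := by
  obtain ⟨L, hL, hW⟩ := s.H_holder
  have hG := Gn_nn 2 (1/8)
  have hK := KK_nn s
  refine ⟨2 / c4 * (L * 544 * Gn 2 (1/8) + KK p M), fun i hi x r hr => ?_⟩
  have hq := KQ_k1 i
  have b1 : |PS ε U (k1 i) r x| ≤ r⁻¹ * (L * 544 * Gn 2 (1/8) * √r) := by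
    set t := -(aa r / r * x 2) with ht
    have e : PS ε U (k1 i) r x = r⁻¹ * ∫ z, (Hf ε U (aa r • hz x + r • z) - Hf ε U (aa r • hz x)) * k1 i (up z t) := by
      unfold PS
      rw [Psi2 _ _ hr]
      simp_rw [sub_mul]
      rw [integral_sub, integral_const_mul, k1_int0 i hi, mul_zero, sub_zero]
      · refine ((upQ_int hq t).norm.const_mul (2 * M ^ 5)).mono' ?_ (Eventually.of_forall fun z => ?_)
        · have := s.H_cont
          have := upQ_cont hq t
          exact Continuous.aestronglyMeasurable (by fun_prop)
        · rw [norm_mul]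
          have h1 := s.H_bd (aa r • hz x + r • z)
          gcongr
          exact h1
      · exact (upQ_int hq t).const_mul _
    rw [e, abs_mul, abs_of_pos (inv_pos.2 hr)]
    refine mul_le_mul_of_nonneg_left ?_ (inv_pos.2 hr).le
    rw [← Real.norm_eq_abs]
    refine (norm_integral_le_of_norm_le ((gauss_int (n := 2) (by norm_num : (0:ℝ) < 1/8)).const_mul (L * √r * 544)) (Eventually.of_forall fun z => ?_)).trans ?_
    · rw [norm_mul, Real.norm_eq_abs, Real.norm_eq_abs]
      have h1 := hW (aa r • hz x + r • z) (aa r • hz x)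
      rw [add_sub_cancel_left, norm_smul, Real.norm_of_nonneg hr.le, Real.sqrt_mul hr.le] at h1
      calc _ ≤ L * (√r * √‖z‖) * |k1 i (up z t)| := by gcongr
        _ = L * √r * (√‖z‖ * |k1 i (up z t)|) := by ring
        _ ≤ L * √r * (544 * exp (-(1 / 8) * ‖z‖ ^ 2)) := by
            have := upQ_bd hq z t
            gcongr
        _ = _ := by ring
    · rw [integral_const_mul]; unfold Gn; apply le_of_eq; ring
  have b2 : |PS ε U (k1 i) r x| ≤ KK p M * r⁻¹ ^ 3 := by
    refine (s.S_bd' _ hq x r hr).trans ?_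
    gcongr
    exact min_le_right _ _
  set K := L * 544 * Gn 2 (1/8) + KK p M with hKd
  have hK0 : 0 ≤ K := by positivity
  have b3 : |PS ε U (k1 i) r x| ≤ K * min (r⁻¹ * √r) (r⁻¹ ^ 3) := by
    rw [mul_min_of_nonneg _ _ hK0]
    have : 0 ≤ L * 544 * Gn 2 (1/8) := by positivity
    refine le_min (b1.trans ?_) (b2.trans ?_)
    · calc _ = (L * 544 * Gn 2 (1/8)) * (r⁻¹ * √r) := by ring
        _ ≤ _ := by gcongr; linarith
    · gcongr; linarith
  refine (om_k hr 1 b3).trans ?_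
  rw [pow_one]
  have h6 : min (r⁻¹ * √r) (r⁻¹ ^ 3) ≤ Nm r := by
    have hs : √r = r ^ (1/2 : ℝ) := Real.sqrt_eq_rpow r
    refine Nm_pow (α := -(1/2)) (β := -3) hr ?_ ?_ (by norm_num) (by norm_num)
    · refine (min_le_left _ _).trans (le_of_eq ?_)
      rw [hs, inv1_rpow hr, ← Real.rpow_add hr]; norm_num
    · refine (min_le_right _ _).trans (le_of_eq ?_)
      rw [inv3_rpow hr]
  have h4 := c4d
  have h5 := om1 hr
  calc om r * (aa r / r) * (K * min (r⁻¹ * √r) (r⁻¹ ^ 3)) ≤ 2 / c4 * (K * Nm r) := by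
        gcongr
    _ = _ := by ring

theorem Sys.CT (s : Sys p ε M U) (i : Fin 3) (hi : i ≠ 2) : Continuous (IS ε U 1 (k1 i)) := by
  obtain ⟨K, hK⟩ := s.T_bd
  rw [← continuousOn_univ]
  exact s.wS.isc_cont (KQ_k1 i) 1 (Nm_int.const_mul K) (fun x _ r hr => hK i hi x r hr)

theorem Sys.W_even (s : Sys p ε M U) (y : E3) : Wf p ε U (rho y) = Wf p ε U y := by
  unfold Wf; rw [s.sol.even]

theorem k1_rho (z : E3) : k1 2 (rho z) = -k1 2 z := by
  unfold k1 kq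
  rw [rho2, LinearIsometryEquiv.norm_map]; ring

theorem rho_fix {x : E3} (hx : x 2 = 0) : rho x = x := by
  ext i; fin_cases i
  · simp [rho0]
  · simp [rho1]
  · simp [rho2, hx]

theorem Sys.PA_zero (s : Sys p ε M U) {x : E3} (hx : x 2 = 0) (r : ℝ) : PA p ε U (k1 2) r x = 0 := by
  have h := (rho.measurePreserving).integral_comp rho.toHomeomorph.measurableEmbedding
    (fun y => Wf p ε U y * (r⁻¹ ^ 3 * k1 2 (xi r x (id y))))
  have e : ∀ y, Wf p ε U (rho y) * (r⁻¹ ^ 3 * k1 2 (xi r x (id (rho y)))) = -(Wf p ε U y * (r⁻¹ ^ 3 * k1 2 (xi r x (id y)))) := fun y => by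
    have h1 : xi r x (rho y) = rho (xi r x y) := by
      rw [← xi_rho, rho_fix hx]
    simp only [id]
    rw [h1, k1_rho, s.W_even]; ring
  simp_rw [e] at h
  rw [integral_neg] at h
  unfold PA Psi
  linarith

theorem Sys.IA_zero (s : Sys p ε M U) {x : E3} (hx : x 2 = 0) : IA p ε U 1 (k1 2) x = 0 := by
  unfold IA Isc
  have h := s.PA_zero hx
  unfold PA at h
  simp_rw [h, mul_zero]
  simp

/-- planar Gaussian average -/
def Gh (ε : ℝ) (U : E3 → ℝ) (r : ℝ) (x : E2) : ℝ := ∫ z : E2, Hf ε U (aa r • x + r • z) * exp (-(1/4) * ‖z‖ ^ 2)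

theorem Sys.Gh_cont (s : Sys p ε M U) : Continuous fun q : ℝ × E2 => Gh ε U q.1 q.2 := by
  have hH := s.H_cont
  have ha := aa_cont
  unfold Gh
  refine continuous_of_dominated (bound := fun z : E2 => 2 * M ^ 5 * exp (-(1/4) * ‖z‖ ^ 2)) (fun q => Continuous.aestronglyMeasurable (by fun_prop))
    (fun q => Eventually.of_forall fun z => ?_) ((gauss_int (by norm_num)).const_mul _)
    (Eventually.of_forall fun z => by fun_prop)
  rw [norm_mul, Real.norm_eq_abs, Real.norm_of_nonneg (exp_pos _).le]
  have := s.H_bd (aa q.1 • q.2 + q.1 • z)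
  gcongr

theorem Sys.Gh_bd (s : Sys p ε M U) (r : ℝ) (x : E2) : |Gh ε U r x| ≤ 2 * M ^ 5 * Gn 2 (1/4) := by
  unfold Gh
  rw [← Real.norm_eq_abs]
  refine (norm_integral_le_of_norm_le ((gauss_int (n := 2) (by norm_num : (0:ℝ) < 1/4)).const_mul (2 * M ^ 5)) (Eventually.of_forall fun z => ?_)).trans ?_
  · rw [norm_mul, Real.norm_eq_abs, Real.norm_of_nonneg (exp_pos _).le]
    have := s.H_bd (aa r • x + r • z)
    gcongr
  · rw [integral_const_mul]; rfl

theorem Gh_zero (x : E2) : Gh ε U 0 x = Hf ε U x * (4 * π) := by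
  unfold Gh
  simp_rw [aa_zero, one_smul, zero_smul, add_zero]
  rw [integral_const_mul]
  have h := GaussianFourier.integral_rexp_neg_mul_sq_norm (V := E2) (b := 1/4) (by norm_num)
  rw [h, finrank_euclideanSpace_fin]
  congr 1
  norm_num
  ring

def gs (s : ℝ) : ℝ := s⁻¹ ^ 2 * exp (-(1/4) * s⁻¹ ^ 2)

theorem gs_nn (s : ℝ) : 0 ≤ gs s := by unfold gs; positivity
theorem gs_meas : Measurable gs := by unfold gs; fun_prop

theorem gs_bd {s : ℝ} (hs : 0 < s) : gs s ≤ 4 * Nm s := by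
  have h : gs s / 4 ≤ Nm s := by
    refine Nm_pow (α := 0) (β := -2) hs ?_ ?_ (by norm_num) (by norm_num)
    · rw [Real.rpow_zero]
      have := mul_exp_neg_le (1/4 * s⁻¹ ^ 2)
      rw [← neg_mul] at this
      unfold gs; linarith
    · have e : s ^ (-2 : ℝ) = s⁻¹ ^ 2 := by
        rw [Real.rpow_neg hs.le, inv_pow]; norm_num
      rw [e]
      unfold gs
      have := exp_le1 (θ := 1/4) (by norm_num) (sq_nonneg s⁻¹)
      have h2 : 0 ≤ s⁻¹ ^ 2 := by positivity
      nlinarith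
  linarith

theorem gs_int : IntegrableOn gs (Set.Ioi 0) :=
  (Nm_int.const_mul 4).mono' gs_meas.aestronglyMeasurable
    ((ae_restrict_mem measurableSet_Ioi).mono fun s hs => by
      rw [Real.norm_of_nonneg (gs_nn s)]; exact gs_bd hs)

theorem gs_val : ∫ s in Set.Ioi 0, gs s = √π := by
  have h := integral_comp_rpow_Ioi (fun y : ℝ => exp (-(1/4) * y ^ 2)) (p := -1) (by norm_num)
  rw [integral_gaussian_Ioi] at h
  have e : √(π / (1/4)) / 2 = √π := by
    rw [show π / (1/4) = 2 ^ 2 * π by ring, Real.sqrt_mul (by positivity), Real.sqrt_sq (by norm_num)]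
    ring
  rw [e] at h
  rw [← h]
  refine setIntegral_congr_fun measurableSet_Ioi fun s hs => ?_
  have hs : 0 < s := hs
  simp only [smul_eq_mul]
  have e1 : s ^ (-1 : ℝ) = s⁻¹ := (Real.rpow_neg_one s)
  have e2 : s ^ (-1 - 1 : ℝ) = s⁻¹ ^ 2 := by
    rw [show (-1 - 1 : ℝ) = -2 by norm_num, Real.rpow_neg hs.le, inv_pow]; norm_num
  rw [e1, e2]
  unfold gs
  norm_num

/-- continuous extension of the normal derivative of the layer part -/
def Vn (ε : ℝ) (U : E3 → ℝ) (x : E3) : ℝ :=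
  -(1 / c4) * exp (-(x 2 ^ 2 / 4)) * ∫ s in Set.Ioi 0, gs s * Gh ε U (x 2 * s) (hz x)

theorem hz_cont : Continuous hz := by unfold hz; fun_prop

theorem Sys.Gh_comp (s : Sys p ε M U) {X : Type*} [TopologicalSpace X] {f : X → ℝ} {g : X → E2} (hf : Continuous f) (hg : Continuous g) :
    Continuous fun x => Gh ε U (f x) (g x) := by
  have h := s.Gh_cont.comp (hf.prodMk hg)
  simp only [Function.comp_def] at h
  exact h

theorem Sys.Vn_cont (s : Sys p ε M U) : Continuous (Vn ε U) := by
  have hG := s.Gh_cont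
  have h2 := coord_cont 2
  have h3 : Continuous fun x : E3 => ∫ s in Set.Ioi 0, gs s * Gh ε U (x 2 * s) (hz x) := by
    have hc : ∀ x : E3, Continuous fun r : ℝ => Gh ε U (x 2 * r) (hz x) := fun x =>
      s.Gh_comp (continuous_const.mul continuous_id) continuous_const
    have hc2 : ∀ r : ℝ, Continuous fun x : E3 => Gh ε U (x 2 * r) (hz x) := fun r =>
      s.Gh_comp (h2.mul continuous_const) hz_cont
    refine continuous_of_dominated (bound := fun s => gs s * (2 * M ^ 5 * Gn 2 (1/4)))
      (fun x => (gs_meas.mul (hc x).measurable).aestronglyMeasurable)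
      (fun x => Eventually.of_forall fun r => ?_) (gs_int.mul_const _)
      (Eventually.of_forall fun r => continuous_const.mul (hc2 r))
    rw [norm_mul, Real.norm_of_nonneg (gs_nn r), Real.norm_eq_abs]
    exact mul_le_mul_of_nonneg_left (s.Gh_bd _ _) (gs_nn r)
  have h5 : Continuous fun x : E3 => -(1 / c4) * exp (-(x 2 ^ 2 / 4)) :=
    continuous_const.mul (Real.continuous_exp.comp ((h2.pow 2).div_const 4).neg)
  exact h5.mul h3

theorem io_hz {x : E3} (hx : x 2 = 0) : io (hz x) = x := by
  ext i; fin_cases i <;> simp [io, hz, hx]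

theorem c4_val : c4 = 8 * π * √π := by
  unfold c4
  have hp := Real.pi_pos
  rw [show (3/2 : ℝ) = 1 + 1/2 by norm_num, Real.rpow_add (by positivity), Real.rpow_one, ← Real.sqrt_eq_rpow,
    show 4 * π = 2 ^ 2 * π by ring, Real.sqrt_mul (by positivity), Real.sqrt_sq (by norm_num)]
  ring

theorem Vn_zero {x : E3} (hx : x 2 = 0) : Vn ε U x = -(ε * U x ^ 3) := by
  unfold Vn
  simp_rw [hx, zero_mul, Gh_zero]
  rw [integral_mul_const, gs_val, c4_val]
  unfold Hf hf
  rw [io_hz hx]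
  have hp := Real.pi_pos
  have : √π ≠ 0 := (Real.sqrt_pos.2 hp).ne'
  simp
  field_simp
  ring

theorem Sys.Vn_eq (s : Sys p ε M U) {x : E3} (hx : 0 < x 2) : IS ε U 1 (k1 2) x = Vn ε U x := by
  set t := x 2 with ht
  set F : ℝ → ℝ := fun r => t * r⁻¹ ^ 2 * exp (-(1/4) * (t * r⁻¹) ^ 2) * Gh ε U r (hz x) with hF
  have e1 : IS ε U 1 (k1 2) x = -(1 / c4) * exp (-(t ^ 2 / 4)) * ∫ r in Set.Ioi 0, F r := by
    unfold IS Isc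
    rw [← integral_const_mul]
    refine setIntegral_congr_fun measurableSet_Ioi fun r hr => ?_
    have hr : 0 < r := hr
    show om r * (-(aa r / r)) ^ 1 * Psi volume io (Hf ε U) (k1 2) r x = -(1 / c4) * exp (-(t ^ 2 / 4)) * F r
    rw [Psi2 _ _ hr]
    have ha := aa_pos r
    have e2 : ∀ z : E2, Hf ε U (aa r • hz x + r • z) * k1 2 (up z (-(aa r / r * x 2))) =
        (1/2 * (aa r / r * t) * (exp (-(t ^ 2 / 4)) * exp (-(1/4) * (t * r⁻¹) ^ 2))) * (Hf ε U (aa r • hz x + r • z) * exp (-(1/4) * ‖z‖ ^ 2)) := fun z => by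
      have e3 : k1 2 (up z (-(aa r / r * x 2))) = (1/2 * (aa r / r * t) * (exp (-(t ^ 2 / 4)) * exp (-(1/4) * (t * r⁻¹) ^ 2) * exp (-(1/4) * ‖z‖ ^ 2))) := by
        unfold k1 kq
        rw [← Real.exp_add, ← Real.exp_add, up_sq]
        have e4 : up z (-(aa r / r * x 2)) 2 = -(aa r / r * t) := by simp [up, ht]
        rw [e4]
        have e5 : -((‖z‖ ^ 2 + (-(aa r / r * x 2)) ^ 2) / 4) = -(t ^ 2 / 4) + -(1/4) * (t * r⁻¹) ^ 2 + -(1/4) * ‖z‖ ^ 2 := by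
          rw [neg_sq, mul_pow, div_pow, aa_sq, ← ht]
          field_simp
          ring
        rw [e5]; ring
      rw [e3]; ring
    simp_rw [e2]
    rw [integral_const_mul, pow_one, mul_neg, om1' hr]
    show _ = -(1 / c4) * exp (-(t ^ 2 / 4)) * (t * r⁻¹ ^ 2 * exp (-(1/4) * (t * r⁻¹) ^ 2) * Gh ε U r (hz x))
    unfold Gh
    have h4 := c4_pos
    field_simp
  have e6 := integral_comp_mul_left_Ioi F 0 hx
  rw [mul_zero] at e6
  have e7 : ∫ r in Set.Ioi 0, F r = ∫ s in Set.Ioi 0, gs s * Gh ε U (t * s) (hz x) := by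
    have e8 : ∫ r in Set.Ioi 0, F r = t * ∫ s in Set.Ioi 0, F (t * s) := by
      rw [e6, smul_eq_mul, ← mul_assoc, mul_inv_cancel₀ hx.ne', one_mul]
    rw [e8, ← integral_const_mul]
    refine setIntegral_congr_fun measurableSet_Ioi fun r hr => ?_
    have hr : 0 < r := hr
    simp only [hF]
    have e9 : t * (t * r)⁻¹ = r⁻¹ := by field_simp
    rw [e9]
    unfold gs
    field_simp
  rw [e1, e7]
  rfl

/-- gradient, continuous up to the boundary -/
def Vg (p ε : ℝ) (U : E3 → ℝ) (j : Fin 3) (x : E3) : ℝ :=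
  IA p ε U 1 (k1 j) x + if j = 2 then Vn ε U x else IS ε U 1 (k1 j) x

theorem Sys.Vg_cont (s : Sys p ε M U) (j : Fin 3) : Continuous (Vg p ε U j) := by
  unfold Vg
  refine (s.CA1 j).add ?_
  split_ifs with h
  · exact s.Vn_cont
  · exact s.CT j h

theorem Sys.Vg_eq (s : Sys p ε M U) (j : Fin 3) {x : E3} (hx : 0 < x 2) :
    Vg p ε U j x = IA p ε U 1 (k1 j) x + IS ε U 1 (k1 j) x := by
  unfold Vg
  split_ifs with h
  · subst h; rw [s.Vn_eq hx]
  · rfl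

theorem Sys.Vg_bc (s : Sys p ε M U) {x : E3} (hx : x 2 = 0) : Vg p ε U 2 x = -(ε * U x ^ 3) := by
  unfold Vg
  rw [if_pos rfl, s.IA_zero hx, Vn_zero hx, zero_add]

theorem Sys.U_deriv (s : Sys p ε M U) {x : E3} (hx : 0 < x 2) : HasFDerivAt U (gv fun j => Vg p ε U j x) x := by
  have h := ((s.DA1 x).add (s.DS1 hx)).congr_of_eventuallyEq (f₁ := U) (Eventually.of_forall s.U_eq)
  refine gv_of h fun e => ?_
  rw [ContinuousLinearMap.add_apply, gv_apply, gv_apply, gv_apply, s.Vg_eq _ hx, s.Vg_eq _ hx, s.Vg_eq _ hx]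
  ring
end
end Ham

namespace Ham

structure Reg (u : E3 → ℝ) (V : Fin 3 → E3 → ℝ) (V2 : Fin 3 → Fin 3 → E3 → ℝ) : Prop where
  cont : Continuous u
  vc : ∀ j, Continuous (V j)
  d1 : ∀ x : E3, 0 < x 2 → HasFDerivAt u (gv fun j => V j x) x
  d2 : ∀ i, ∀ x : E3, 0 < x 2 → HasFDerivAt (V i) (gv fun j => V2 i j x) x
  c2 : ∀ i j, ∀ x : E3, 0 < x 2 → ContinuousAt (V2 i j) x

abbrev OH : Set E3 := {x | 0 < x 2}
abbrev CH : Set E3 := {x | 0 ≤ x 2}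

theorem upper_eq (h : 0 < 3) : upperHS 3 h = OH := rfl
theorem upperc_eq (h : 0 < 3) : upperHSc 3 h = CH := rfl
theorem OH_open : IsOpen OH := half_open 0

theorem pr_single (i : Fin 3) : pr i (EuclideanSpace.single i 1) = 1 := by rw [pr_apply]; simp
theorem gv_single (v : Fin 3 → ℝ) (i : Fin 3) : gv v (EuclideanSpace.single i 1) = v i := by
  rw [gv_apply]; fin_cases i <;> simp

theorem OH_closure : closure OH = CH := by
  have ho : IsOpenMap (pr 2) := by
    refine ContinuousLinearMap.isOpenMap _ fun t => ⟨t • EuclideanSpace.single 2 1, ?_⟩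
    rw [map_smul, pr_single, smul_eq_mul, mul_one]
  have h := ho.preimage_closure_eq_closure_preimage (pr 2).continuous (Set.Ioi 0)
  rw [closure_Ioi] at h
  exact h.symm

theorem OH_convex : Convex ℝ OH := by
  intro x hx y hy a b ha hb hab
  have hx : 0 < x 2 := hx
  have hy : 0 < y 2 := hy
  show 0 < (a • x + b • y) 2
  simp only [PiLp.add_apply, PiLp.smul_apply, smul_eq_mul]
  rcases ha.eq_or_lt with h | h
  · have : b = 1 := by linarith
    subst this; rw [← h]; linarith
  · have : 0 ≤ b * y 2 := by positivity
    have : 0 < a * x 2 := by positivity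
    linarith

theorem CH_ud : UniqueDiffOn ℝ CH := by
  rw [← OH_closure]
  refine uniqueDiffOn_convex OH_convex.closure ?_
  refine ⟨EuclideanSpace.single 2 1, mem_interior.2 ⟨OH, subset_closure, OH_open, ?_⟩⟩
  show (0:ℝ) < (EuclideanSpace.single (2 : Fin 3) (1:ℝ)) 2
  simp

section
variable {u : E3 → ℝ} {V : Fin 3 → E3 → ℝ} {V2 : Fin 3 → Fin 3 → E3 → ℝ}

theorem Reg.v1 (h : Reg u V V2) (i : Fin 3) : ContDiffOn ℝ 1 (V i) OH := by
  rw [← zero_add (1 : WithTop ℕ∞), contDiffOn_succ_iff_fderiv_of_isOpen OH_open]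
  refine ⟨fun x hx => (h.d2 i x hx).differentiableAt.differentiableWithinAt, by simp, ?_⟩
  rw [contDiffOn_zero]
  refine (gv_cont (v := V2 i) (s := OH) fun j x hx => (h.c2 i j x hx).continuousWithinAt).congr fun x hx => ?_
  exact (h.d2 i x hx).fderiv

theorem Reg.s2 (h : Reg u V V2) : ContDiffOn ℝ 2 u OH := by
  have h0 : ContDiffOn ℝ ((1 : WithTop ℕ∞) + 1) u OH := by
    rw [contDiffOn_succ_iff_fderiv_of_isOpen OH_open]
    refine ⟨fun x hx => (h.d1 x hx).differentiableAt.differentiableWithinAt, by simp, ?_⟩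
    have h2 : ContDiffOn ℝ 1 (fun x => gv fun j => V j x) OH := by
      unfold gv
      exact ContDiffOn.sum fun j _ => (h.v1 j).smul contDiffOn_const
    exact h2.congr fun x hx => (h.d1 x hx).fderiv
  exact h0.of_le (le_of_eq one_add_one_eq_two.symm)

theorem Reg.dw (h : Reg u V V2) {x : E3} (hx : x ∈ CH) : HasFDerivWithinAt u (gv fun j => V j x) CH x := by
  have hc : Continuous fun x => gv fun j => V j x := by
    rw [← continuousOn_univ]
    exact gv_cont fun j => (h.vc j).continuousOn
  have := hasFDerivWithinAt_closure_of_tendsto_fderiv (f := u) (s := OH) (x := x) (f' := gv fun j => V j x)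
    (fun x hx => (h.d1 x hx).differentiableAt.differentiableWithinAt) OH_convex OH_open
    (fun y _ => h.cont.continuousWithinAt) ?_
  · rwa [OH_closure] at this
  · refine ((hc.tendsto x).mono_left nhdsWithin_le_nhds).congr' ?_
    filter_upwards [self_mem_nhdsWithin] with y hy
    exact ((h.d1 y hy).fderiv).symm

theorem Reg.s1 (h : Reg u V V2) : ContDiffOn ℝ 1 u CH := by
  rw [← zero_add (1 : WithTop ℕ∞), contDiffOn_succ_iff_fderivWithin CH_ud]
  refine ⟨fun x hx => (h.dw hx).differentiableWithinAt, by simp, ?_⟩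
  rw [contDiffOn_zero]
  refine (gv_cont (v := V) (s := CH) fun j => (h.vc j).continuousOn).congr fun x hx => ?_
  exact (h.dw hx).fderivWithin (CH_ud x hx)

theorem Reg.pdN (h : Reg u V V2) (h3 : 0 < 3) {x : E3} (hx : x 2 = 0) : pdN 3 h3 u x = V 2 x := by
  have hx' : x ∈ CH := hx.ge
  unfold _root_.pdN
  rw [upperc_eq, (h.dw hx').fderivWithin (CH_ud x hx')]
  exact gv_single _ 2

theorem Reg.pd (h : Reg u V V2) (i : Fin 3) {x : E3} (hx : 0 < x 2) : pd u i x = V i x := by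
  unfold _root_.pd
  rw [(h.d1 x hx).fderiv, gv_single]

theorem Reg.pd2 (h : Reg u V V2) (i : Fin 3) {x : E3} (hx : 0 < x 2) : _root_.pd (_root_.pd u i) i x = V2 i i x := by
  have e : HasFDerivAt (_root_.pd u i) (gv fun j => V2 i j x) x := by
    refine (h.d2 i x hx).congr_of_eventuallyEq ?_
    filter_upwards [OH_open.mem_nhds hx] with y hy
    exact h.pd i hy
  rw [_root_.pd, e.fderiv, gv_single]

theorem Reg.lap (h : Reg u V V2) {x : E3} (hx : 0 < x 2) : lap u x = V2 0 0 x + V2 1 1 x + V2 2 2 x := by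
  unfold _root_.lap
  rw [Fin.sum_univ_three, h.pd2 0 hx, h.pd2 1 hx, h.pd2 2 hx]

theorem Reg.radial (h : Reg u V V2) {x : E3} (hx : 0 < x 2) : radial u x = x 0 * V 0 x + x 1 * V 1 x + x 2 * V 2 x := by
  unfold _root_.radial
  rw [Fin.sum_univ_three, h.pd 0 hx, h.pd 1 hx, h.pd 2 hx]

theorem Reg.gradSq (h : Reg u V V2) {x : E3} (hx : 0 < x 2) : gradSq u x = V 0 x ^ 2 + V 1 x ^ 2 + V 2 x ^ 2 := by
  unfold _root_.gradSq
  rw [Fin.sum_univ_three, h.pd 0 hx, h.pd 1 hx, h.pd 2 hx]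

theorem gv_smul (σ : ℝ) (v : Fin 3 → ℝ) (e : E3) : (σ • gv v) e = gv (fun j => σ * v j) e := by
  rw [ContinuousLinearMap.smul_apply, gv_apply, gv_apply, smul_eq_mul]; ring

theorem Reg.smul (h : Reg u V V2) (σ : ℝ) : Reg (fun x => σ * u x) (fun j x => σ * V j x) (fun i j x => σ * V2 i j x) where
  cont := continuous_const.mul h.cont
  vc := fun j => continuous_const.mul (h.vc j)
  d1 := fun x hx => gv_of ((h.d1 x hx).const_mul σ) fun e => gv_smul _ _ _
  d2 := fun i x hx => gv_of ((h.d2 i x hx).const_mul σ) fun e => gv_smul _ _ _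
  c2 := fun i j x hx => (h.c2 i j x hx).const_mul σ
end

section
variable {p ε M : ℝ} {U : E3 → ℝ}

theorem Sys.reg (s : Sys p ε M U) : Reg U (Vg p ε U) (fun i j x => IA p ε U 2 (k2 i j) x + IS ε U 2 (k2 i j) x) where
  cont := s.U_cont
  vc := s.Vg_cont
  d1 := fun x hx => s.U_deriv hx
  d2 := fun i x hx => by
    have h := ((s.DA2 i x).add (s.DS2 i hx)).congr_of_eventuallyEq (f₁ := Vg p ε U i) (by
      filter_upwards [OH_open.mem_nhds hx] with y hy
      exact s.Vg_eq i hy)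
    refine gv_of h fun e => ?_
    rw [ContinuousLinearMap.add_apply, gv_apply, gv_apply, gv_apply]
    ring
  c2 := fun i j x hx => ((s.CA2 i j).continuousAt).add (s.CS2 i j hx)

theorem Sys.pde' (s : Sys p ε M U) {x : E3} (hx : 0 < x 2) :
    -lap U x - 1/2 * radial U x = Wf p ε U x := by
  rw [s.reg.lap hx, s.reg.radial hx, s.Vg_eq 0 hx, s.Vg_eq 1 hx, s.Vg_eq 2 hx]
  linarith [s.pde hx]
end
end Ham

namespace Ham

theorem exp_q {q : ℝ} (hq : 0 < q) : exp (-q ^ 2) ≤ q ^ (-(1/4) : ℝ) := by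
  rcases le_total q 1 with h | h
  · have h1 : exp (-q ^ 2) ≤ 1 := Real.exp_le_one_iff.2 (by nlinarith)
    exact h1.trans (Real.one_le_rpow_of_pos_of_le_one_of_nonpos hq h (by norm_num))
  · have h1 := mul_exp_neg_le (q ^ 2)
    have h2 : exp (-q ^ 2) ≤ q ^ (-2 : ℝ) := by
      have e : q ^ (-2 : ℝ) = (q ^ 2)⁻¹ := by rw [Real.rpow_neg hq.le]; norm_num
      rw [e, ← one_div, le_div_iff₀ (by positivity)]
      linarith
    exact h2.trans (Real.rpow_le_rpow_of_exponent_le h (by norm_num))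

theorem quarter_mr {r : ℝ} (hr : 0 < r) : r ^ (1/4 : ℝ) * mr r ≤ Nm r := by
  refine Nm_pow (α := -(3/4)) (β := -(11/4)) hr ?_ ?_ (by norm_num) (by norm_num)
  · calc r ^ (1/4 : ℝ) * mr r ≤ r ^ (1/4 : ℝ) * r⁻¹ := by gcongr; exact min_le_left _ _
      _ = _ := by rw [inv1_rpow hr, ← Real.rpow_add hr]; norm_num
  · calc r ^ (1/4 : ℝ) * mr r ≤ r ^ (1/4 : ℝ) * r⁻¹ ^ 3 := by gcongr; exact min_le_right _ _
      _ = _ := by rw [inv3_rpow hr, ← Real.rpow_add hr]; norm_num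

theorem exp_th {θ r t a : ℝ} (hθ : 0 < θ) (hr : 0 < r) (ht : 0 < t) (ha : r⁻¹ ≤ a) :
    exp (-θ * (a * t) ^ 2) ≤ (√θ) ^ (-(1/4) : ℝ) * t ^ (-(1/4) : ℝ) * r ^ (1/4 : ℝ) := by
  have hs : 0 < √θ := Real.sqrt_pos.2 hθ
  have h := exp_q (q := √θ * t * r⁻¹) (by positivity)
  rw [Real.mul_rpow (by positivity) (by positivity), Real.mul_rpow hs.le ht.le, Real.inv_rpow hr.le, Real.rpow_neg hr.le, inv_inv] at h
  refine le_trans (Real.exp_le_exp.2 ?_) h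
  have e : (√θ * t * r⁻¹) ^ 2 = θ * (r⁻¹ * t) ^ 2 := by
    rw [mul_pow, mul_pow, mul_pow, Real.sq_sqrt hθ.le]; ring
  rw [e, neg_mul, neg_le_neg_iff]
  have : 0 < r⁻¹ := by positivity
  gcongr

section
variable {p ε M : ℝ} {U : E3 → ℝ}

def CE (p M : ℝ) : ℝ := 2 / c4 * KK p M * (1 + (√(th p)) ^ (-(1/4) : ℝ)) * (∫ r in Set.Ioi 0, Nm r)

theorem Nm_int_nn : 0 ≤ ∫ r in Set.Ioi 0, Nm r := setIntegral_nonneg measurableSet_Ioi fun r hr => Nm_nn hr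

theorem Sys.CE_nn (s : Sys p ε M U) : 0 ≤ CE p M := by
  have := KK_nn s
  have := c4d
  have := Nm_int_nn
  unfold CE
  positivity

theorem Sys.S1_q (s : Sys p ε M U) {Q : E3 → ℝ} (h : KQ Q) {k : ℕ} (hk : k ≤ 1) {x : E3} (hx : 0 < x 2) (r : ℝ) (hr : 0 < r) :
    |om r * (-(aa r / r)) ^ k * PS ε U Q r x| ≤
      2 / c4 * KK p M * ((√(th p)) ^ (-(1/4) : ℝ) * x 2 ^ (-(1/4) : ℝ)) * exp (-(cc p) * ‖x‖ ^ 2) * Nm r := by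
  have hK := KK_nn s
  refine (om_k hr k (s.S_bd h hr x)).trans ?_
  have h1 : om r * (aa r / r) ^ k ≤ 2 / c4 := by
    refine le_trans ?_ (om1 hr)
    refine mul_le_mul_of_nonneg_left ?_ (om_nn hr)
    calc (aa r / r) ^ k ≤ (aa r / r) ^ 1 := pow_le_pow_right₀ (ar_ge hr) hk
      _ = _ := pow_one _
  have h4 := c4d
  have hm := mr_nn hr
  have ha : r⁻¹ ≤ aa r / r := by
    rw [div_eq_mul_inv]
    have := aa_ge r
    have : 0 < r⁻¹ := by positivity
    nlinarith
  have h2 := exp_th (th_pos s.hp1) hr hx ha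
  have h3 := quarter_mr hr
  have h5 : 0 ≤ (√(th p)) ^ (-(1/4) : ℝ) * x 2 ^ (-(1/4) : ℝ) := by positivity
  calc om r * (aa r / r) ^ k * (KK p M * exp (-(cc p) * ‖x‖ ^ 2) * exp (-(th p) * (aa r / r * x 2) ^ 2) * mr r)
      ≤ 2 / c4 * (KK p M * exp (-(cc p) * ‖x‖ ^ 2) * ((√(th p)) ^ (-(1/4) : ℝ) * x 2 ^ (-(1/4) : ℝ) * r ^ (1/4 : ℝ)) * mr r) := by
        gcongr
    _ = 2 / c4 * KK p M * ((√(th p)) ^ (-(1/4) : ℝ) * x 2 ^ (-(1/4) : ℝ)) * exp (-(cc p) * ‖x‖ ^ 2) * (r ^ (1/4 : ℝ) * mr r) := by ring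
    _ ≤ _ := by gcongr

theorem isc_abs {C : ℝ} {f : ℝ → ℝ} (h : ∀ r > 0, |f r| ≤ C * Nm r) : |∫ r in Set.Ioi (0:ℝ), f r| ≤ C * ∫ r in Set.Ioi 0, Nm r := by
  rw [← integral_const_mul, ← Real.norm_eq_abs]
  refine norm_integral_le_of_norm_le (Nm_int.const_mul C) ?_
  exact (ae_restrict_mem measurableSet_Ioi).mono fun r hr => h r hr

theorem Sys.sum_bd (s : Sys p ε M U) {Q : E3 → ℝ} (h : KQ Q) {k : ℕ} (hk : k ≤ 1) {x : E3} (hx : 0 < x 2) :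
    |IA p ε U k Q x + IS ε U k Q x| ≤ CE p M * (1 + x 2 ^ (-(1/4) : ℝ)) * exp (-(cc p) * ‖x‖ ^ 2) := by
  have h1 : |IA p ε U k Q x| ≤ _ := isc_abs fun r hr => s.A1_bd h hk x r hr
  have h2 : |IS ε U k Q x| ≤ _ := isc_abs fun r hr => s.S1_q h hk hx r hr
  have hK := KK_nn s
  have h4 := c4d
  have hN := Nm_int_nn
  have hq : 0 ≤ (√(th p)) ^ (-(1/4) : ℝ) := by positivity
  have ht : 0 ≤ x 2 ^ (-(1/4) : ℝ) := by positivity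
  have he : 0 ≤ exp (-(cc p) * ‖x‖ ^ 2) := (Real.exp_pos _).le
  refine (abs_add_le _ _).trans ((add_le_add h1 h2).trans ?_)
  have e : CE p M * (1 + x 2 ^ (-(1/4) : ℝ)) * exp (-(cc p) * ‖x‖ ^ 2) =
    2 / c4 * KK p M * exp (-(cc p) * ‖x‖ ^ 2) * (∫ r in Set.Ioi 0, Nm r) * ((1 + (√(th p)) ^ (-(1/4) : ℝ)) * (1 + x 2 ^ (-(1/4) : ℝ))) := by
    unfold CE; ring
  have e2 : 2 / c4 * KK p M * exp (-(cc p) * ‖x‖ ^ 2) * (∫ r in Set.Ioi 0, Nm r) +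
      2 / c4 * KK p M * ((√(th p)) ^ (-(1/4) : ℝ) * x 2 ^ (-(1/4) : ℝ)) * exp (-(cc p) * ‖x‖ ^ 2) * (∫ r in Set.Ioi 0, Nm r) =
      2 / c4 * KK p M * exp (-(cc p) * ‖x‖ ^ 2) * (∫ r in Set.Ioi 0, Nm r) * (1 + (√(th p)) ^ (-(1/4) : ℝ) * x 2 ^ (-(1/4) : ℝ)) := by ring
  rw [e, e2]
  refine mul_le_mul_of_nonneg_left ?_ (by positivity)
  nlinarith
end

theorem half_gauss {s : ℝ} (hs : 0 < s) : Integrable fun x : E3 => (1 + x 2 ^ (-(1/2) : ℝ)) * exp (-s * ‖x‖ ^ 2) := by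
  have g : Integrable fun t : ℝ => exp (-s * t ^ 2) := integrable_exp_neg_mul_sq hs
  have g2 : Integrable fun t : ℝ => t ^ (-(1/2) : ℝ) * exp (-s * t ^ 2) := integrable_rpow_mul_exp_neg_mul_sq hs (by norm_num)
  have g3 : Integrable fun t : ℝ => (1 + t ^ (-(1/2) : ℝ)) * exp (-s * t ^ 2) :=
    (g.add g2).congr (Eventually.of_forall fun t => by simp only [Pi.add_apply]; ring)
  have h := Integrable.fintype_prod (ι := Fin 3) (E := ℝ) (μ := fun _ => volume)
    (f := ![fun t : ℝ => exp (-s * t ^ 2), fun t : ℝ => exp (-s * t ^ 2), fun t : ℝ => (1 + t ^ (-(1/2) : ℝ)) * exp (-s * t ^ 2)])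
    (by intro i; fin_cases i; exacts [g, g, g3])
  have h' := (PiLp.volume_preserving_ofLp (Fin 3)).integrable_comp_of_integrable h
  refine h'.congr (Eventually.of_forall fun x => ?_)
  simp only [Function.comp_def, Fin.prod_univ_three]
  show exp (-s * x 0 ^ 2) * exp (-s * x 1 ^ 2) * ((1 + x 2 ^ (-(1/2) : ℝ)) * exp (-s * x 2 ^ 2)) = _
  have e : -s * ‖x‖ ^ 2 = -s * x 0 ^ 2 + -s * x 1 ^ 2 + -s * x 2 ^ 2 := by rw [nsq3]; ring
  rw [e, Real.exp_add, Real.exp_add]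
  ring

section
variable {p ε M : ℝ} {U : E3 → ℝ}

theorem sq_b {v C τ e : ℝ} (h : |v| ≤ C * (1 + τ) * e) : v ^ 2 ≤ 2 * C ^ 2 * (1 + τ ^ 2) * e ^ 2 := by
  have h1 : v ^ 2 ≤ (C * (1 + τ) * e) ^ 2 := sq_le_sq' (by linarith [neg_abs_le v]) (le_trans (le_abs_self v) h)
  refine h1.trans ?_
  have : 2 * C ^ 2 * (1 + τ ^ 2) * e ^ 2 - (C * (1 + τ) * e) ^ 2 = (C * e * (1 - τ)) ^ 2 := by ring
  nlinarith [sq_nonneg (C * e * (1 - τ))]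

theorem Sys.energy (s : Sys p ε M U) (h3 : 0 < 3) (σ : ℝ) : FiniteEnergy 3 h3 (fun x => σ * U x) := by
  unfold FiniteEnergy
  rw [upper_eq]
  have hr := s.reg.smul σ
  have hs : 0 < 2 * cc p - 1/4 := by linarith [cc_pos s.hp1]
  have hc : Continuous fun x : E3 => Kw x * ((σ * Vg p ε U 0 x) ^ 2 + (σ * Vg p ε U 1 x) ^ 2 + (σ * Vg p ε U 2 x) ^ 2 + (σ * U x) ^ 2) := by
    have h0 := s.Vg_cont 0
    have h1 := s.Vg_cont 1
    have h2 := s.Vg_cont 2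
    have h3 := s.U_cont
    unfold Kw
    fun_prop
  have hi : IntegrableOn (fun x : E3 => Kw x * ((σ * Vg p ε U 0 x) ^ 2 + (σ * Vg p ε U 1 x) ^ 2 + (σ * Vg p ε U 2 x) ^ 2 + (σ * U x) ^ 2)) OH := by
    refine Integrable.mono' (((half_gauss hs).const_mul (8 * σ ^ 2 * CE p M ^ 2)).integrableOn (s := OH)) hc.aestronglyMeasurable ?_
    refine (ae_restrict_mem OH_open.measurableSet).mono fun x hx => ?_
    have hx : 0 < x 2 := hx
    have b : ∀ j, |Vg p ε U j x| ≤ CE p M * (1 + x 2 ^ (-(1/4) : ℝ)) * exp (-(cc p) * ‖x‖ ^ 2) := fun j => by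
      rw [s.Vg_eq j hx]; exact s.sum_bd (KQ_k1 j) le_rfl hx
    have b3 : |U x| ≤ CE p M * (1 + x 2 ^ (-(1/4) : ℝ)) * exp (-(cc p) * ‖x‖ ^ 2) := by
      rw [s.U_eq x]; exact s.sum_bd KQ_kq (by norm_num) hx
    have c0 := sq_b (b 0)
    have c1 := sq_b (b 1)
    have c2 := sq_b (b 2)
    have c3 := sq_b b3
    have et : (x 2 ^ (-(1/4) : ℝ)) ^ 2 = x 2 ^ (-(1/2) : ℝ) := by
      rw [← Real.rpow_natCast, ← Real.rpow_mul hx.le]; norm_num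
    have ee : exp (-(2 * cc p - 1/4) * ‖x‖ ^ 2) = Kw x * exp (-(cc p) * ‖x‖ ^ 2) ^ 2 := by
      unfold Kw
      rw [← Real.exp_nat_mul, ← Real.exp_add]; congr 1; push_cast; ring
    have hk : 0 ≤ Kw x := (Real.exp_pos _).le
    rw [et] at c0 c1 c2 c3
    rw [Real.norm_eq_abs, abs_of_nonneg (by positivity), ee]
    calc Kw x * ((σ * Vg p ε U 0 x) ^ 2 + (σ * Vg p ε U 1 x) ^ 2 + (σ * Vg p ε U 2 x) ^ 2 + (σ * U x) ^ 2)
        = Kw x * (σ ^ 2 * (Vg p ε U 0 x ^ 2 + Vg p ε U 1 x ^ 2 + Vg p ε U 2 x ^ 2 + U x ^ 2)) := by ring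
      _ ≤ Kw x * (σ ^ 2 * (4 * (2 * CE p M ^ 2 * (1 + x 2 ^ (-(1/2) : ℝ)) * exp (-(cc p) * ‖x‖ ^ 2) ^ 2))) := by
          refine mul_le_mul_of_nonneg_left (mul_le_mul_of_nonneg_left ?_ (sq_nonneg _)) hk
          linarith
      _ = _ := by ring
  refine hi.congr_fun (fun x hx => ?_) OH_open.measurableSet
  show _ = Kw x * (gradSq (fun x => σ * U x) x + (σ * U x) ^ 2)
  rw [hr.gradSq hx]

theorem final_sol (s : Sys p ε M U) {lam mu σ : ℝ} (hσ : 0 < σ) (h1 : mu * σ ^ (p - 2) = 1) (h2 : √lam * σ ^ 2 = ε) (hl : 0 < lam) (h3 : 0 < 3) :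
    IsClassicalSolution 3 h3 lam mu p (fun x => σ * U x) := by
  have hr := s.reg.smul σ
  have hq : lam * σ ^ 4 = ε ^ 2 := by
    rw [← h2, mul_pow, Real.sq_sqrt hl.le]; ring
  refine ⟨?_, ?_, ?_, ?_⟩
  · rw [upper_eq]; exact hr.s2
  · rw [upperc_eq]; exact hr.s1
  · intro x hx
    have hx : 0 < x 2 := hx
    have hU := s.sol.pos x
    have hu : 0 < σ * U x := mul_pos hσ hU
    have hL : lap (fun x => σ * U x) x = σ * lap U x := by
      rw [hr.lap hx, s.reg.lap hx]; ring
    have hR : radial (fun x => σ * U x) x = σ * radial U x := by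
      rw [hr.radial hx, s.reg.radial hx]; ring
    have hp := s.pde' hx
    have e6 : twoStar 3 - 2 = ((4 : ℕ) : ℝ) := by unfold twoStar; norm_num
    rw [hL, hR, e6, Real.rpow_natCast, abs_of_pos hu, Real.mul_rpow hσ.le hU.le]
    have eU : U x ^ (p - 1) = U x ^ (p - 2) * U x := by
      rw [← Real.rpow_add_one hU.ne']; congr 1; ring
    unfold Wf at hp
    rw [eU, ← hq] at hp
    calc -(σ * lap U x) - 1 / 2 * (σ * radial U x) = σ * (-lap U x - 1/2 * radial U x) := by ring
      _ = lam * (σ * U x) ^ 4 * (σ * U x) + (1 * U x ^ (p - 2)) * (σ * U x) := by rw [hp]; ring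
      _ = _ := by rw [← h1]; ring
  · intro x hx
    have hx : x 2 = 0 := hx
    have hU := s.sol.pos x
    have hu : 0 < σ * U x := mul_pos hσ hU
    have e4 : twoStarL 3 - 2 = ((2 : ℕ) : ℝ) := by unfold twoStarL; norm_num
    rw [hr.pdN h3 hx, s.Vg_bc hx, e4, Real.rpow_natCast, abs_of_pos hu, ← h2]
    ring
end
end Ham

/-- Theorem 1.1 (iii): for `N = 3`, `λ > 0`, `2 < p ≤ 4`, there is `μ₀ > 0`
such that for all `μ > μ₀` problem (1.1) has a positive finite-energy classical solution. -/
theorem statement3 (lam p : ℝ) (hlam : 0 < lam) (hp1 : 2 < p) (hp2 : p ≤ 4) :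
    ∃ μ₀ : ℝ, 0 < μ₀ ∧ ∀ mu : ℝ, μ₀ < mu →
      ∃ u : Euc 3 → ℝ, IsClassicalSolution 3 (by norm_num) lam mu p u ∧
        FiniteEnergy 3 (by norm_num) u ∧
        ∀ x ∈ upperHS 3 (by norm_num : 0 < 3), 0 < u x := by
  obtain ⟨M, ε0, hM, h0, h01, hsol⟩ := Ham.exists_sol hp1 hp2
  have hs : 0 < √lam := Real.sqrt_pos.2 hlam
  have hq : 0 < √(ε0 / √lam) := Real.sqrt_pos.2 (by positivity)
  refine ⟨√(ε0 / √lam) ^ (-(p - 2)), by positivity, fun mu hmu => ?_⟩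
  have hmu0 : 0 < mu := lt_trans (by positivity) hmu
  have hp : 0 < p - 2 := by linarith
  set σ : ℝ := mu ^ (-(p - 2)⁻¹) with hσd
  have hσ : 0 < σ := by positivity
  have h1 : mu * σ ^ (p - 2) = 1 := by
    rw [hσd, ← Real.rpow_mul hmu0.le, neg_mul, inv_mul_cancel₀ hp.ne', Real.rpow_neg_one, mul_inv_cancel₀ hmu0.ne']
  have hσ2 : σ ≤ √(ε0 / √lam) := by
    have h := Real.rpow_le_rpow_of_nonpos (by positivity) hmu.le (z := -(p - 2)⁻¹) (by
      rw [neg_nonpos]; positivity)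
    rwa [← Real.rpow_mul hq.le, neg_mul_neg, mul_inv_cancel₀ hp.ne', Real.rpow_one] at h
  have hε : √lam * σ ^ 2 ≤ ε0 := by
    have : σ ^ 2 ≤ ε0 / √lam := by
      rw [← Real.sq_sqrt (show 0 ≤ ε0 / √lam by positivity)]
      gcongr
    rw [le_div_iff₀ hs] at this
    linarith
  have hε0 : 0 < √lam * σ ^ 2 := by positivity
  obtain ⟨U, hU⟩ := hsol _ hε0 hε
  have s : Ham.Sys p (√lam * σ ^ 2) M U := ⟨hp1, hp2, hε0, hε.trans h01, hM, hU⟩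
  exact ⟨fun x => σ * U x, Ham.final_sol s hσ h1 rfl hlam _, s.energy _ σ, fun x _ => mul_pos hσ (hU.pos x)⟩
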